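/- Let H be a geometric complete multipartite graph which contains a non-rainbow plane cycle of length t, where t ≥ 6. Then H contains a non-rainbow plane cycle of length t' for some t' with ⌈t/2⌉ + 1 ≤ t' ≤ t − 1. -/

import Mathlib

noncomputable section

/-- Points of the plane. -/
abbrev Pt : Type := ℝ × ℝ

/-- Signed side of point `p` with respect to the oriented line through `u` and `u'`
(the usual cross-product / determinant test). -/
def sideSign (u u' p : Pt) : ℝ :=
  (u'.1 - u.1) * (p.2 - u.2) - (u'.2 - u.2) * (p.1 - u.1)

/-- `v` and `v'` lie on strictly opposite sides of the straight line through `u` and `u'`. -/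
def StrictlyOppositeSides (u u' v v' : Pt) : Prop :=
  sideSign u u' v * sideSign u u' v' < 0

/-- A set of points is in general position: no three (distinct) points of it are collinear. -/
def GenPos (P : Set Pt) : Prop :=
  ∀ a ∈ P, ∀ b ∈ P, ∀ c ∈ P, a ≠ b → a ≠ c → b ≠ c →
    ¬ Collinear ℝ ({a, b, c} : Set Pt)

/-- `γ : ZMod t → Pt` is a plane cycle of length `t` for the coloring `φ`:
a cyclic sequence of `t ≥ 3` distinct points in which cyclically consecutive points have
different colors, and in which two distinct edges meet exactly in their common endpoint
if they are cyclically consecutive, and not at all otherwise. -/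
def IsPlaneCycle (φ : Pt → ℕ) (t : ℕ) (γ : ZMod t → Pt) : Prop :=
  3 ≤ t ∧ Function.Injective γ ∧
  (∀ i : ZMod t, φ (γ i) ≠ φ (γ (i + 1))) ∧
  ∀ i j : ZMod t, i ≠ j →
    (j = i + 1 →
      segment ℝ (γ i) (γ (i + 1)) ∩ segment ℝ (γ j) (γ (j + 1)) = ({γ (i + 1)} : Set Pt)) ∧
    (j ≠ i + 1 → i ≠ j + 1 →
      segment ℝ (γ i) (γ (i + 1)) ∩ segment ℝ (γ j) (γ (j + 1)) = (∅ : Set Pt))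

/-- A cycle is non-rainbow if some color appears on two of its points. -/
def NonRainbow (φ : Pt → ℕ) (t : ℕ) (γ : ZMod t → Pt) : Prop :=
  ∃ i j : ZMod t, i ≠ j ∧ φ (γ i) = φ (γ j)

/-- A set of points is in convex position (each point is a vertex of the convex hull). -/
def ConvexPosition (s : Set Pt) : Prop :=
  ∀ p ∈ s, p ∉ convexHull ℝ (s \ {p})


open Finset

lemma ss_cyc (a b c : Pt) : sideSign a b c = sideSign b c a := by unfold sideSign; ring
lemma ss_swap (a b c : Pt) : sideSign a b c = - sideSign b a c := by unfold sideSign; ring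
lemma ss_swap' (a b c : Pt) : sideSign a b c = - sideSign a c b := by unfold sideSign; ring
lemma ss_self1 (a b : Pt) : sideSign a b a = 0 := by unfold sideSign; ring
lemma ss_self2 (a b : Pt) : sideSign a b b = 0 := by unfold sideSign; ring

lemma ss_comb2 (u v a b : Pt) (x y : ℝ) (h : x + y = 1) :
    sideSign u v (x • a + y • b) = x * sideSign u v a + y * sideSign u v b := by
  have : x = 1 - y := by linarith
  subst this
  unfold sideSign; simp; ring

lemma ss_comb3 (u v a b c : Pt) (x y z : ℝ) (h : x + y + z = 1) :
    sideSign u v (x • a + y • b + z • c)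
      = x * sideSign u v a + y * sideSign u v b + z * sideSign u v c := by
  have : x = 1 - y - z := by linarith
  subst this
  unfold sideSign; simp; ring

lemma bary (a b c p : Pt) (h : sideSign a b c ≠ 0) :
    p = (sideSign b c p / sideSign a b c) • a + (sideSign c a p / sideSign a b c) • b
      + (sideSign a b p / sideSign a b c) • c := by
  ext
  · simp only [Prod.fst_add, Prod.smul_fst, smul_eq_mul]
    field_simp
    unfold sideSign; ring
  · simp only [Prod.snd_add, Prod.smul_snd, smul_eq_mul]
    field_simp
    unfold sideSign; ring

lemma bary_sum (a b c p : Pt) (h : sideSign a b c ≠ 0) :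
    sideSign b c p / sideSign a b c + sideSign c a p / sideSign a b c
      + sideSign a b p / sideSign a b c = 1 := by
  field_simp
  unfold sideSign; ring

/-- open triangle -/
def InTri (a b c p : Pt) : Prop :=
  ∃ x y z : ℝ, 0 < x ∧ 0 < y ∧ 0 < z ∧ x + y + z = 1 ∧ p = x • a + y • b + z • c

lemma InTri.rot {a b c p : Pt} (h : InTri a b c p) : InTri b c a p := by
  obtain ⟨x, y, z, hx, hy, hz, hs, rfl⟩ := h
  exact ⟨y, z, x, hy, hz, hx, by linarith, by abel⟩

lemma InTri.swap {a b c p : Pt} (h : InTri a b c p) : InTri b a c p := by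
  obtain ⟨x, y, z, hx, hy, hz, hs, rfl⟩ := h
  exact ⟨y, x, z, hy, hx, hz, by linarith, by abel⟩

lemma inTri_of_pos {a b c p : Pt} (h1 : 0 < sideSign b c p * sideSign a b c)
    (h2 : 0 < sideSign c a p * sideSign a b c) (h3 : 0 < sideSign a b p * sideSign a b c) :
    InTri a b c p := by
  have h : sideSign a b c ≠ 0 := by rintro h; simp [h] at h1
  refine ⟨_, _, _, ?_, ?_, ?_, bary_sum a b c p h, bary a b c p h⟩ <;>
  · rw [div_eq_mul_inv]
    have : (sideSign a b c)⁻¹ = sideSign a b c * ((sideSign a b c)⁻¹ ^ 2) := by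
      field_simp
    rw [this, ← mul_assoc]
    positivity

lemma ss_ne_zero {P : Set Pt} (hg : GenPos P) {a b c : Pt} (ha : a ∈ P) (hb : b ∈ P) (hc : c ∈ P)
    (hab : a ≠ b) (hac : a ≠ c) (hbc : b ≠ c) : sideSign a b c ≠ 0 := by
  intro h
  apply hg a ha b hb c hc hab hac hbc
  rw [collinear_iff_of_mem (p₀ := a) (by simp)]
  refine ⟨b - a, ?_⟩
  intro p hp
  simp only [Set.mem_insert_iff, Set.mem_singleton_iff] at hp
  rcases hp with rfl | rfl | rfl
  · exact ⟨0, by simp⟩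
  · exact ⟨1, by simp⟩
  · unfold sideSign at h
    by_cases h1 : b.1 - a.1 = 0
    · have h2 : b.2 - a.2 ≠ 0 := by
        intro h2
        apply hab
        ext <;> linarith
      refine ⟨(p.2 - a.2) / (b.2 - a.2), ?_⟩
      ext
      · simp
        rw [h1] at h ⊢
        have : p.1 - a.1 = 0 := by
          have : (b.2 - a.2) * (p.1 - a.1) = 0 := by linarith
          simpa [h2] using this
        linarith
      · simp
        field_simp
        ring
    · refine ⟨(p.1 - a.1) / (b.1 - a.1), ?_⟩
      ext
      · simp
        field_simp
        ring
      · simp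
        field_simp
        linarith

lemma mem_seg {a b p : Pt} : p ∈ segment ℝ a b ↔
    ∃ x y : ℝ, 0 ≤ x ∧ 0 ≤ y ∧ x + y = 1 ∧ p = x • a + y • b := by
  constructor
  · rintro ⟨x, y, hx, hy, h, rfl⟩
    exact ⟨x, y, hx, hy, h, rfl⟩
  · rintro ⟨x, y, hx, hy, h, rfl⟩
    exact ⟨x, y, hx, hy, h, rfl⟩

lemma mem_oseg {a b p : Pt} : p ∈ openSegment ℝ a b ↔
    ∃ x y : ℝ, 0 < x ∧ 0 < y ∧ x + y = 1 ∧ p = x • a + y • b := by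
  constructor
  · rintro ⟨x, y, hx, hy, h, rfl⟩
    exact ⟨x, y, hx, hy, h, rfl⟩
  · rintro ⟨x, y, hx, hy, h, rfl⟩
    exact ⟨x, y, hx, hy, h, rfl⟩

lemma seg_cases {a b p : Pt} (h : p ∈ segment ℝ a b) : p = a ∨ p = b ∨ p ∈ openSegment ℝ a b := by
  have := insert_endpoints_openSegment ℝ a b
  rw [← this] at h
  simpa using h

lemma mkCycle (φ : Pt → ℕ) (n : ℕ) (hn : 3 ≤ n) (f : ℕ → Pt) (hw : f n = f 0)
    (inj : ∀ i < n, ∀ j < n, f i = f j → i = j)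
    (col : ∀ k < n, φ (f k) ≠ φ (f (k + 1)))
    (hx : ∀ k l, k < l → l < n → ∀ p ∈ segment ℝ (f k) (f (k + 1)),
      p ∈ segment ℝ (f l) (f (l + 1)) → (l = k + 1 ∧ p = f l) ∨ (k = 0 ∧ l + 1 = n ∧ p = f 0)) :
    IsPlaneCycle φ n (fun i : ZMod n => f i.val) := by
  have : NeZero n := ⟨by omega⟩
  have : Fact (1 < n) := ⟨by omega⟩
  have hv : ∀ i : ZMod n, (i + 1).val = (i.val + 1) % n := by
    intro i
    rw [ZMod.val_add, ZMod.val_one]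
  have hv' : ∀ i : ZMod n, (i.val + 1 < n ∧ (i + 1).val = i.val + 1) ∨
      (i.val + 1 = n ∧ (i + 1).val = 0) := by
    intro i
    have h1 := ZMod.val_lt i
    rcases Nat.lt_or_ge (i.val + 1) n with h | h
    · left; exact ⟨h, by rw [hv, Nat.mod_eq_of_lt h]⟩
    · right
      have : i.val + 1 = n := by omega
      exact ⟨this, by rw [hv, this, Nat.mod_self]⟩
  have hf : ∀ i : ZMod n, f ((i + 1).val) = f (i.val + 1) := by
    intro i
    rcases hv' i with ⟨h, h2⟩ | ⟨h, h2⟩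
    · rw [h2]
    · rw [h2, h, hw]
  have hvi : ∀ i j : ZMod n, i.val = j.val → i = j := fun i j h => ZMod.val_injective n h
  refine ⟨hn, ?_, ?_, ?_⟩
  · intro i j h
    exact hvi _ _ (inj _ (ZMod.val_lt i) _ (ZMod.val_lt j) h)
  · intro i
    show φ (f i.val) ≠ φ (f (i + 1).val)
    rw [hf]
    exact col _ (ZMod.val_lt i)
  · intro i j hij
    show (j = i + 1 → segment ℝ (f i.val) (f (i + 1).val) ∩ segment ℝ (f j.val) (f (j + 1).val)
        = {f (i + 1).val}) ∧ (j ≠ i + 1 → i ≠ j + 1 →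
        segment ℝ (f i.val) (f (i + 1).val) ∩ segment ℝ (f j.val) (f (j + 1).val) = ∅)
    rw [hf i, hf j]
    have hi := ZMod.val_lt i
    have hj := ZMod.val_lt j
    constructor
    · intro h
      apply Set.eq_singleton_iff_unique_mem.2
      constructor
      · constructor
        · exact right_mem_segment ℝ _ _
        · rw [← hf i, ← h]; exact left_mem_segment ℝ _ _
      · rintro p ⟨hp1, hp2⟩
        rcases hv' i with ⟨h3, h2⟩ | ⟨h3, h2⟩
        · rw [← h] at h2
          rcases hx i.val j.val (by omega) hj p hp1 hp2 with ⟨h4, h5⟩ | ⟨h4, h5, h6⟩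
          · rw [h5, h2]
          · omega
        · rw [← h] at h2
          rcases hx j.val i.val (by omega) hi p hp2 hp1 with ⟨h4, h5⟩ | ⟨h4, h5, h6⟩
          · omega
          · rw [h6, h5, hw]
    · intro h1 h2
      apply Set.eq_empty_iff_forall_notMem.2
      rintro p ⟨hp1, hp2⟩
      have hne : i.val ≠ j.val := fun h => hij (hvi _ _ h)
      rcases Nat.lt_or_gt_of_ne hne with h | h
      · rcases hx i.val j.val h hj p hp1 hp2 with ⟨h4, h5⟩ | ⟨h4, h5, h6⟩
        · apply h1; apply hvi
          rcases hv' i with ⟨h3, h3'⟩ | ⟨h3, h3'⟩ <;> omega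
        · apply h2; apply hvi
          rcases hv' j with ⟨h3, h3'⟩ | ⟨h3, h3'⟩ <;> omega
      · rcases hx j.val i.val h hi p hp2 hp1 with ⟨h4, h5⟩ | ⟨h4, h5, h6⟩
        · apply h2; apply hvi
          rcases hv' j with ⟨h3, h3'⟩ | ⟨h3, h3'⟩ <;> omega
        · apply h1; apply hvi
          rcases hv' i with ⟨h3, h3'⟩ | ⟨h3, h3'⟩ <;> omega



/-- edge of the closed polygon -/
def Ed {t : ℕ} (γ : ZMod t → Pt) (i : ZMod t) : Set Pt := segment ℝ (γ i) (γ (i + 1))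

structure Ctx (t : ℕ) (φ : Pt → ℕ) (γ : ZMod t → Pt) : Prop where
  ht : 6 ≤ t
  cyc : IsPlaneCycle φ t γ
  gp : ∀ i j k, i ≠ j → i ≠ k → j ≠ k → sideSign (γ i) (γ j) (γ k) ≠ 0
  nog : ∀ n, (t + 1) / 2 + 1 ≤ n → n ≤ t - 1 → ∀ γ' : ZMod n → Pt,
    (∀ i, γ' i ∈ Set.range γ) → ¬ IsPlaneCycle φ n γ'

lemma cyc_inter {t : ℕ} {φ : Pt → ℕ} {γ : ZMod t → Pt} (h : IsPlaneCycle φ t γ) {i j : ZMod t}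
    {p : Pt} (hi : p ∈ Ed γ i) (hj : p ∈ Ed γ j) :
    i = j ∨ (j = i + 1 ∧ p = γ j) ∨ (i = j + 1 ∧ p = γ i) := by
  by_cases hij : i = j
  · exact Or.inl hij
  right
  by_cases h1 : j = i + 1
  · left
    refine ⟨h1, ?_⟩
    have := (h.2.2.2 i j hij).1 h1
    have h2 : p ∈ ({γ (i + 1)} : Set Pt) := by rw [← this]; exact ⟨hi, hj⟩
    rw [h1]; exact h2
  by_cases h2 : i = j + 1
  · right
    refine ⟨h2, ?_⟩
    have := (h.2.2.2 j i (Ne.symm hij)).1 h2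
    have h2' : p ∈ ({γ (j + 1)} : Set Pt) := by rw [← this]; exact ⟨hj, hi⟩
    rw [h2]; exact h2'
  have := (h.2.2.2 i j hij).2 h1 h2
  have h3 : p ∈ (∅ : Set Pt) := by rw [← this]; exact ⟨hi, hj⟩
  exact h3.elim

lemma zne {t : ℕ} (n : ℕ) (h0 : 0 < n) (h : n < t) : (n : ZMod t) ≠ 0 := by
  intro h1
  rw [ZMod.natCast_eq_zero_iff] at h1
  exact absurd (Nat.le_of_dvd h0 h1) (by omega)

lemma zne' {t : ℕ} (ht : 6 ≤ t) : (1 : ZMod t) ≠ 0 ∧ (2 : ZMod t) ≠ 0 ∧ (3 : ZMod t) ≠ 0 ∧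
    (4 : ZMod t) ≠ 0 ∧ (5 : ZMod t) ≠ 0 := by
  have h1 := zne (t := t) 1 (by omega) (by omega)
  have h2 := zne (t := t) 2 (by omega) (by omega)
  have h3 := zne (t := t) 3 (by omega) (by omega)
  have h4 := zne (t := t) 4 (by omega) (by omega)
  have h5 := zne (t := t) 5 (by omega) (by omega)
  push_cast at *
  exact ⟨h1, h2, h3, h4, h5⟩

lemma cyc_vert {t : ℕ} {φ : Pt → ℕ} {γ : ZMod t → Pt} (h : IsPlaneCycle φ t γ) {a b : ZMod t}
    (hb : γ a ∈ Ed γ b) : a = b ∨ a = b + 1 := by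
  have h1 : γ a ∈ Ed γ a := left_mem_segment ℝ _ _
  rcases cyc_inter h h1 hb with h2 | ⟨h2, h3⟩ | ⟨h2, h3⟩
  · exact Or.inl h2
  · exact Or.inl (h.2.1 h3)
  · exact Or.inr h2

lemma zshift_inj {t : ℕ} {a : ZMod t} {k l : ℕ} (hk : k < t) (hl : l < t)
    (h : a + (k : ZMod t) = a + (l : ZMod t)) : k = l := by
  have h1 : (k : ZMod t) = (l : ZMod t) := add_left_cancel h
  rw [ZMod.natCast_eq_natCast_iff'] at h1
  rwa [Nat.mod_eq_of_lt hk, Nat.mod_eq_of_lt hl] at h1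

lemma Ctx.no_close {t : ℕ} {φ : Pt → ℕ} {γ : ZMod t → Pt} (c : Ctx t φ γ) (a : ZMod t) (m : ℕ)
    (hm : (t + 1) / 2 ≤ m) (hm2 : m ≤ t - 2) (hcol : φ (γ (a + m)) ≠ φ (γ a))
    (hfree : ∀ p ∈ openSegment ℝ (γ (a + m)) (γ a), ∀ k < m, p ∉ Ed γ (a + (k : ℕ))) : False := by
  have ht := c.ht
  let f : ℕ → Pt := fun k => if k ≤ m then γ (a + k) else γ a
  have f1 : ∀ k, k ≤ m → f k = γ (a + k) := fun k hk => by simp [f, hk]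
  have f2 : f (m + 1) = γ a := by simp [f]
  have fe : ∀ k, k < m → segment ℝ (f k) (f (k + 1)) = Ed γ (a + k) := by
    intro k hk
    rw [f1 k hk.le, f1 (k + 1) hk]
    unfold Ed
    push_cast
    rw [add_assoc]
  have := mkCycle φ (m + 1) (by omega) f (by rw [f2, f1 0 (by omega)]; simp) ?_ ?_ ?_
  · refine c.nog (m + 1) (by omega) (by omega) _ ?_ this
    intro i
    simp only [f]
    split_ifs <;> exact ⟨_, rfl⟩
  · intro i hi j hj hij
    rw [f1 i (by omega), f1 j (by omega)] at hij
    exact zshift_inj (by omega) (by omega) (c.cyc.2.1 hij)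
  · intro k hk
    rcases Nat.lt_or_ge k m with h | h
    · rw [f1 k h.le, f1 (k + 1) h]
      push_cast
      rw [← add_assoc]
      exact c.cyc.2.2.1 _
    · have : k = m := by omega
      subst this
      rw [f1 k le_rfl, f2]
      exact hcol
  · intro k l hkl hl p hp hq
    rw [fe k (by omega)] at hp
    rcases Nat.lt_or_ge l m with h | h
    · rw [fe l h] at hq
      rcases cyc_inter c.cyc hp hq with h1 | ⟨h1, h2⟩ | ⟨h1, h2⟩
      · have := zshift_inj (by omega) (by omega) h1
        omega
      · left
        have h3 : a + ((k + 1 : ℕ) : ZMod t) = a + (l : ℕ) := by rw [h1]; push_cast; ring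
        have := zshift_inj (by omega) (by omega) h3
        exact ⟨this.symm, by rw [f1 l h.le]; exact h2⟩
      · exfalso
        have h3 : a + ((l + 1 : ℕ) : ZMod t) = a + (k : ℕ) := by rw [h1]; push_cast; ring
        have := zshift_inj (by omega) (by omega) h3
        omega
    · have : l = m := by omega
      subst this
      rw [f1 l le_rfl, f2] at hq
      rcases seg_cases hq with h1 | h1 | h1
      · left
        rw [h1] at hp
        rcases cyc_vert c.cyc hp with h2 | h2
        · have := zshift_inj (by omega) (by omega) h2
          omega
        · have h3 : a + ((k + 1 : ℕ) : ZMod t) = a + (l : ℕ) := by rw [h2]; push_cast; ring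
          have := zshift_inj (by omega) (by omega) h3
          exact ⟨this.symm, by rw [h1, f1 l le_rfl]⟩
      · right
        rw [h1] at hp
        rcases cyc_vert c.cyc hp with h2 | h2
        · have h3 : a + ((k : ℕ) : ZMod t) = a + ((0 : ℕ) : ZMod t) := by rw [← h2]; simp
          have := zshift_inj (by omega) (by omega) h3
          exact ⟨this, rfl, by rw [h1, f1 0 (by omega)]; simp⟩
        · have h3 : a + ((k + 1 : ℕ) : ZMod t) = a + ((0 : ℕ) : ZMod t) := by
            push_cast; rw [← add_assoc, ← h2]; simp
          have := zshift_inj (by omega) (by omega) h3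
          omega
      · exact (hfree p h1 k hkl hp).elim

lemma Ctx.rev {t : ℕ} {φ : Pt → ℕ} {γ : ZMod t → Pt} (c : Ctx t φ γ) :
    Ctx t φ (fun i => γ (-i)) := by
  have key : ∀ i : ZMod t, segment ℝ (γ (-i)) (γ (-(i + 1))) = Ed γ (-i - 1) := by
    intro i
    unfold Ed
    rw [segment_symm]
    congr 2 <;> ring_nf
  refine ⟨c.ht, ⟨c.cyc.1, ?_, ?_, ?_⟩, ?_, ?_⟩
  · intro i j h
    exact neg_injective (c.cyc.2.1 h)
  · intro i
    have := c.cyc.2.2.1 (-(i + 1))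
    rw [show -(i + 1) + 1 = -i by ring] at this
    exact this.symm
  · intro i j hij
    simp only [key]
    constructor
    · intro h
      have := (c.cyc.2.2.2 (-j - 1) (-i - 1) (by intro h2; apply hij; linear_combination h2)).1
        (by rw [h]; ring)
      rw [show -(i + 1) = -j - 1 + 1 by rw [h]; ring]
      rw [Set.inter_comm]
      exact this
    · intro h1 h2
      exact (c.cyc.2.2.2 (-i - 1) (-j - 1) (by intro h2; apply hij; linear_combination -h2)).2
        (by intro h; apply h2; linear_combination h) (by intro h; apply h1; linear_combination h)
  · intro i j k h1 h2 h3
    exact c.gp _ _ _ (by simpa using h1) (by simpa using h2) (by simpa using h3)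
  · intro n h1 h2 γ' h3
    refine c.nog n h1 h2 γ' ?_
    intro i
    obtain ⟨j, hj⟩ := h3 i
    exact ⟨-j, hj⟩

lemma Ed_rev {t : ℕ} (γ : ZMod t → Pt) (i : ZMod t) :
    Ed (fun i => γ (-i)) i = Ed γ (-i - 1) := by
  unfold Ed
  rw [segment_symm]
  congr 2 <;> ring_nf

/-- the open segment between two vertices avoids the polygon -/
def Clear {t : ℕ} (γ : ZMod t → Pt) (i j : ZMod t) : Prop :=
  ∀ p ∈ openSegment ℝ (γ i) (γ j), ∀ k, p ∉ Ed γ k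

lemma Clear.symm {t : ℕ} {γ : ZMod t → Pt} {i j : ZMod t} (h : Clear γ i j) : Clear γ j i := by
  intro p hp
  rw [openSegment_symm] at hp
  exact h p hp

lemma Ctx.clear_mono {t : ℕ} {φ : Pt → ℕ} {γ : ZMod t → Pt} (c : Ctx t φ γ) {i j : ZMod t}
    (h0 : i ≠ j) (h1 : j ≠ i + 1) (h2 : i ≠ j + 1) (h : Clear γ i j) : φ (γ i) = φ (γ j) := by
  have ht := c.ht
  have hz : NeZero t := ⟨by omega⟩
  by_contra hcol
  have key : ∀ i j : ZMod t, Clear γ i j → φ (γ i) ≠ φ (γ j) → (t + 1) / 2 ≤ (j - i).val →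
      (j - i).val ≤ t - 2 → False := by
    intro i j h hc h3 h4
    have e : i + ((j - i).val : ZMod t) = j := by
      rw [ZMod.natCast_zmod_val]; ring
    refine c.no_close i _ h3 h4 ?_ ?_
    · rw [e]; exact hc.symm
    · rw [e]
      intro p hp k _
      exact h.symm p hp _
  have hs : (i - j).val + (j - i).val = t := by
    have : i - j ≠ 0 := sub_ne_zero.2 h0
    have : -(i - j) = j - i := by ring
    rw [← this]
    have h5 : (-(i - j)).val = t - (i - j).val := by
      have : NeZero (i - j) := ⟨sub_ne_zero.2 h0⟩
      exact ZMod.val_neg_of_ne_zero _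
    have := ZMod.val_lt (i - j)
    omega
  have hne : ∀ i j : ZMod t, i ≠ j → j ≠ i + 1 → 2 ≤ (j - i).val := by
    intro i j h3 h4
    by_contra h5
    have h6 : (j - i).val = 0 ∨ (j - i).val = 1 := by omega
    have h7 := ZMod.natCast_zmod_val (j - i)
    rcases h6 with h6 | h6 <;> rw [h6] at h7
    · apply h3; push_cast at h7; linear_combination h7
    · apply h4; push_cast at h7; linear_combination -h7
  have a1 := hne i j h0 h1
  have a2 := hne j i h0.symm h2
  rcases Nat.lt_or_ge (j - i).val ((t + 1) / 2) with h5 | h5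
  · exact key j i h.symm (Ne.symm hcol) (by omega) (by omega)
  · exact key i j h hcol h5 (by omega)


lemma conv_pos {x y a b : ℝ} (hx : 0 ≤ x) (hy : 0 ≤ y) (h : x + y = 1) (ha : 0 < a) (hb : 0 < b)
    (h0 : x * a + y * b = 0) : False := by
  rcases hx.lt_or_eq with h1 | h1
  · nlinarith [mul_pos h1 ha, mul_nonneg hy hb.le]
  · have : y = 1 := by linarith
    rw [← h1, this] at h0
    linarith

/-- scaled barycentric coordinate functions of the triangle `A M X` -/
def bx (A M X p : Pt) : ℝ := sideSign A M p * sideSign A M X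
def bm (A M X p : Pt) : ℝ := sideSign X A p * sideSign A M X
def ba (A M X p : Pt) : ℝ := sideSign M X p * sideSign A M X

lemma bx_comb (A M X a b : Pt) (x y : ℝ) (h : x + y = 1) :
    bx A M X (x • a + y • b) = x * bx A M X a + y * bx A M X b := by
  unfold bx; rw [ss_comb2 _ _ _ _ _ _ h]; ring
lemma bm_comb (A M X a b : Pt) (x y : ℝ) (h : x + y = 1) :
    bm A M X (x • a + y • b) = x * bm A M X a + y * bm A M X b := by
  unfold bm; rw [ss_comb2 _ _ _ _ _ _ h]; ring
lemma ba_comb (A M X a b : Pt) (x y : ℝ) (h : x + y = 1) :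
    ba A M X (x • a + y • b) = x * ba A M X a + y * ba A M X b := by
  unfold ba; rw [ss_comb2 _ _ _ _ _ _ h]; ring

lemma b_vals (A M X : Pt) : bx A M X A = 0 ∧ bm A M X A = 0 ∧ ba A M X A = sideSign A M X ^ 2 ∧
    bx A M X M = 0 ∧ bm A M X M = sideSign A M X ^ 2 ∧ ba A M X M = 0 ∧
    bx A M X X = sideSign A M X ^ 2 ∧ bm A M X X = 0 ∧ ba A M X X = 0 := by
  refine ⟨?_, ?_, ?_, ?_, ?_, ?_, ?_, ?_, ?_⟩ <;> simp only [bx, bm, ba, sideSign] <;> ring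

lemma b_eq_A {A M X p : Pt} (hD : sideSign A M X ≠ 0) (h1 : bm A M X p = 0) (h2 : bx A M X p = 0) :
    p = A := by
  have h3 : sideSign X A p = 0 := by
    unfold bm at h1; simpa [hD] using h1
  have h4 : sideSign A M p = 0 := by
    unfold bx at h2; simpa [hD] using h2
  have h5 := bary A M X p hD
  have h6 := bary_sum A M X p hD
  rw [h3, h4] at h5 h6
  simp only [zero_div, add_zero] at h5 h6
  rw [h6] at h5
  rw [h5]; simp

/-- in the open triangle -/
def Pos (A M X p : Pt) : Prop := 0 < ba A M X p ∧ 0 < bm A M X p ∧ 0 < bx A M X p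

lemma pos_iff {A M X p : Pt} (hD : sideSign A M X ≠ 0) : Pos A M X p ↔ InTri A M X p := by
  constructor
  · rintro ⟨h1, h2, h3⟩
    exact inTri_of_pos h1 h2 h3
  · rintro ⟨x, y, z, hx, hy, hz, hs, rfl⟩
    have hD2 : 0 < sideSign A M X ^ 2 := by positivity
    obtain ⟨v1, v2, v3, v4, v5, v6, v7, v8, v9⟩ := b_vals A M X
    simp only [bx, bm, ba] at v1 v2 v3 v4 v5 v6 v7 v8 v9
    unfold Pos bx bm ba
    rw [ss_comb3 _ _ _ _ _ _ _ _ hs, ss_comb3 _ _ _ _ _ _ _ _ hs, ss_comb3 _ _ _ _ _ _ _ _ hs]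
    refine ⟨?_, ?_, ?_⟩
    · have : 0 < x * sideSign A M X ^ 2 := by positivity
      linear_combination this - x * v3 - y * v6 - z * v9
    · have : 0 < y * sideSign A M X ^ 2 := by positivity
      linear_combination this - x * v2 - y * v5 - z * v8
    · have : 0 < z * sideSign A M X ^ 2 := by positivity
      linear_combination this - x * v1 - y * v4 - z * v7

lemma seg_mem_seg {u v p w : Pt} (hp : p ∈ segment ℝ u v) (hw : w ∈ segment ℝ u v) {x y : ℝ}
    (hx : 0 ≤ x) (hy : 0 ≤ y) (h : x + y = 1) : x • p + y • w ∈ segment ℝ u v :=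
  convex_segment u v hp hw hx hy h

lemma tri_step {A M X u v p : Pt} (hD : sideSign A M X ≠ 0) (hp : p ∈ segment ℝ u v)
    (hpos : Pos A M X p)
    (H : ∀ q ∈ segment ℝ u v, 0 < bm A M X q → 0 ≤ ba A M X q → 0 ≤ bx A M X q →
      0 < ba A M X q ∧ 0 < bx A M X q)
    {w : Pt} (hw : w ∈ segment ℝ u v) (hl : bx A M X w * bm A M X p ≤ bx A M X p * bm A M X w) :
    Pos A M X w ∨ ∃ s : ℝ, 0 < s ∧ s ≤ 1 ∧ A = (1 - s) • p + s • w := by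
  by_cases hwp : Pos A M X w
  · exact Or.inl hwp
  right
  obtain ⟨p1, p2, p3⟩ := hpos
  let g : ℝ → ℝ := fun s => min (min ((1 - s) * ba A M X p + s * ba A M X w)
    ((1 - s) * bm A M X p + s * bm A M X w)) ((1 - s) * bx A M X p + s * bx A M X w)
  have hg : ContinuousOn g (Set.Icc 0 1) := by
    apply Continuous.continuousOn
    fun_prop
  have hg0 : 0 < g 0 := by simp [g, p1, p2, p3]
  have hg1 : g 1 ≤ 0 := by
    by_contra h
    push Not at h
    apply hwp
    simp only [g, sub_self, zero_mul, one_mul, zero_add, lt_min_iff] at h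
    exact ⟨h.1.1, h.1.2, h.2⟩
  obtain ⟨s, ⟨hs0, hs1⟩, hs⟩ := intermediate_value_Icc' (zero_le_one) hg ⟨hg1, hg0.le⟩
  have hs0' : 0 < s := by
    rcases hs0.lt_or_eq with h | h
    · exact h
    · rw [← h] at hs; linarith
  have e : (1 - s) + s = 1 := by ring
  have hq : (1 - s) • p + s • w ∈ segment ℝ u v := seg_mem_seg hp hw (by linarith) hs0 e
  refine ⟨s, hs0', hs1, ?_⟩
  have q1 := ba_comb A M X p w (1 - s) s e
  have q2 := bm_comb A M X p w (1 - s) s e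
  have q3 := bx_comb A M X p w (1 - s) s e
  simp only [g, ← q1, ← q2, ← q3] at hs
  generalize (1 - s) • p + s • w = q at *
  have r0 := hs.ge
  simp only [le_min_iff] at r0
  obtain ⟨⟨r1, r2⟩, r3⟩ := r0
  have hlq : bx A M X q * bm A M X p ≤ bx A M X p * bm A M X q := by
    rw [q2, q3]
    nlinarith
  rcases r2.lt_or_eq with h | h
  · obtain ⟨h4, h5⟩ := H q hq h r1 r3
    exfalso
    have : 0 < min (min (ba A M X q) (bm A M X q)) (bx A M X q) := by
      simp [h, h4, h5]
    linarith
  · rw [← h] at hlq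
    have : bx A M X q = 0 := by nlinarith
    exact (b_eq_A hD h.symm this).symm

lemma tri_end {A M X u v p : Pt} (hD : sideSign A M X ≠ 0) (hp : p ∈ segment ℝ u v)
    (hpos : Pos A M X p)
    (H : ∀ q ∈ segment ℝ u v, 0 < bm A M X q → 0 ≤ ba A M X q → 0 ≤ bx A M X q →
      0 < ba A M X q ∧ 0 < bx A M X q) :
    ∃ w, (w = u ∨ w = v) ∧ Pos A M X w ∧ bx A M X w * bm A M X p ≤ bx A M X p * bm A M X w := by
  have hu := left_mem_segment ℝ u v
  have hv := right_mem_segment ℝ u v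
  obtain ⟨x, y, hx, hy, hxy, hpe⟩ := mem_seg.1 hp
  obtain ⟨p1, p2, p3⟩ := id hpos
  obtain ⟨v1, v2, v3, -⟩ := b_vals A M X
  have em := bm_comb A M X u v x y hxy
  have ex := bx_comb A M X u v x y hxy
  rw [← hpe] at em ex
  have hA : ∀ w, ∀ s : ℝ, 0 < s → s ≤ 1 → A = (1 - s) • p + s • w →
      bm A M X w ≤ 0 ∧ bx A M X w * bm A M X p = bx A M X p * bm A M X w := by
    intro w s h0 h1 h
    have a1 := bm_comb A M X p w (1 - s) s (by ring)
    have a2 := bx_comb A M X p w (1 - s) s (by ring)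
    rw [← h, v2] at a1
    rw [← h, v1] at a2
    constructor
    · by_contra hc
      push Not at hc
      nlinarith
    · have : s * (bx A M X w * bm A M X p - bx A M X p * bm A M X w) = 0 := by
        linear_combination (bx A M X p) * a1 - (bm A M X p) * a2
      have := (mul_eq_zero.1 this).resolve_left h0.ne'
      linarith
  have key : x * (bx A M X u * bm A M X p - bx A M X p * bm A M X u)
      + y * (bx A M X v * bm A M X p - bx A M X p * bm A M X v) = 0 := by
    linear_combination (bx A M X p) * em - (bm A M X p) * ex
  by_cases lu : bx A M X u * bm A M X p ≤ bx A M X p * bm A M X u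
  · rcases tri_step hD hp hpos H hu lu with h | ⟨s, s0, s1, hs⟩
    · exact ⟨u, Or.inl rfl, h, lu⟩
    · obtain ⟨b1, b2⟩ := hA u s s0 s1 hs
      have hy0 : 0 < y := by
        rcases hy.lt_or_eq with h | h
        · exact h
        · rw [← h] at em
          nlinarith
      have lv : bx A M X v * bm A M X p = bx A M X p * bm A M X v := by
        rw [b2, sub_self, mul_zero, zero_add] at key
        have := (mul_eq_zero.1 key).resolve_left hy0.ne'
        linarith
      rcases tri_step hD hp hpos H hv lv.le with h | ⟨s', s0', s1', hs'⟩
      · exact ⟨v, Or.inr rfl, h, lv.le⟩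
      · obtain ⟨c1, c2⟩ := hA v s' s0' s1' hs'
        nlinarith
  · push Not at lu
    have lv : bx A M X v * bm A M X p ≤ bx A M X p * bm A M X v := by
      by_contra hc
      push Not at hc
      exact conv_pos hx hy hxy (sub_pos.2 lu) (sub_pos.2 hc) key
    rcases tri_step hD hp hpos H hv lv with h | ⟨s, s0, s1, hs⟩
    · exact ⟨v, Or.inr rfl, h, lv⟩
    · obtain ⟨b1, b2⟩ := hA v s s0 s1 hs
      exfalso
      rw [b2, sub_self, mul_zero, add_zero] at key
      rcases mul_eq_zero.1 key with h | h
      · rw [h] at em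
        nlinarith
      · linarith

/-- polygon points -/
def OnC {t : ℕ} (γ : ZMod t → Pt) (p : Pt) : Prop := ∃ k, p ∈ Ed γ k

/-- Edges entering the open triangle can only leave through the side `A X`. -/
def Guard {t : ℕ} (γ : ZMod t → Pt) (A M X : Pt) : Prop :=
  ∀ k, ∀ p ∈ Ed γ k, Pos A M X p → ∀ q ∈ Ed γ k, 0 < bm A M X q → 0 ≤ ba A M X q →
    0 ≤ bx A M X q → 0 < ba A M X q ∧ 0 < bx A M X q

lemma guard_end {t : ℕ} {γ : ZMod t → Pt} {A M X p : Pt} (hD : sideSign A M X ≠ 0)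
    (H : Guard γ A M X) (hp : OnC γ p) (hpos : Pos A M X p) :
    ∃ i, Pos A M X (γ i) ∧ bx A M X (γ i) * bm A M X p ≤ bx A M X p * bm A M X (γ i) := by
  obtain ⟨k, hk⟩ := hp
  obtain ⟨w, h1, h2⟩ := tri_end hD hk hpos (H k p hk hpos)
  rcases h1 with rfl | rfl
  · exact ⟨_, h2⟩
  · exact ⟨_, h2⟩

lemma guard_min {t : ℕ} [NeZero t] {γ : ZMod t → Pt} {A M X p : Pt} (hD : sideSign A M X ≠ 0)
    (H : Guard γ A M X) (hp : OnC γ p) (hpos : Pos A M X p) :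
    ∃ i, Pos A M X (γ i) ∧ ∀ q, OnC γ q → Pos A M X q →
      bx A M X (γ i) * bm A M X q ≤ bx A M X q * bm A M X (γ i) := by
  obtain ⟨i0, h0, -⟩ := guard_end hD H hp hpos
  obtain ⟨i, hi, hmin⟩ := Set.exists_min_image {i | Pos A M X (γ i)}
    (fun i => bx A M X (γ i) / bm A M X (γ i)) (Set.toFinite _) ⟨i0, h0⟩
  refine ⟨i, hi, ?_⟩
  intro q hq hqp
  obtain ⟨j, hj, hj2⟩ := guard_end hD H hq hqp
  have h1 := hmin j hj
  have := hj.2.1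
  have := (show Pos A M X (γ i) from hi).2.1
  have := hqp.2.1
  have h2 : bx A M X (γ j) / bm A M X (γ j) ≤ bx A M X q / bm A M X q := by
    rw [div_le_div_iff₀ (by assumption) (by assumption)]
    exact hj2
  have h3 := h1.trans h2
  rwa [div_le_div_iff₀ (by assumption) (by assumption)] at h3

lemma guard_visM {t : ℕ} [NeZero t] {γ : ZMod t → Pt} {A M X p : Pt} (hD : sideSign A M X ≠ 0)
    (H : Guard γ A M X) (hp : OnC γ p) (hpos : Pos A M X p) :
    ∃ i, Pos A M X (γ i) ∧ ∀ q ∈ openSegment ℝ M (γ i), ¬ OnC γ q := by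
  obtain ⟨i, hi, hm⟩ := guard_min hD H hp hpos
  refine ⟨i, hi, ?_⟩
  intro q hq hC
  obtain ⟨x, y, hx, hy, hxy, rfl⟩ := mem_oseg.1 hq
  obtain ⟨v1, v2, v3, v4, v5, v6, v7, v8, v9⟩ := b_vals A M X
  have hD2 : 0 < sideSign A M X ^ 2 := by positivity
  have c1 := ba_comb A M X M (γ i) x y hxy
  have c2 := bm_comb A M X M (γ i) x y hxy
  have c3 := bx_comb A M X M (γ i) x y hxy
  rw [v6] at c1
  rw [v5] at c2
  rw [v4] at c3
  obtain ⟨i1, i2, i3⟩ := id hi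
  have := hm _ hC ⟨by rw [c1]; nlinarith [mul_pos hy i1], by rw [c2]; positivity,
    by rw [c3]; nlinarith [mul_pos hy i3]⟩
  rw [c2, c3] at this
  have h4 : 0 < bx A M X (γ i) * (x * sideSign A M X ^ 2) := by positivity
  nlinarith

lemma guard_visA {t : ℕ} [NeZero t] {γ : ZMod t → Pt} {A M X p : Pt} (hD : sideSign A M X ≠ 0)
    (H : Guard γ A M X) (hp : OnC γ p) (hpos : Pos A M X p)
    (hA : ∀ k, ∀ p ∈ Ed γ k, Pos A M X p → A ∉ Ed γ k) :
    ∃ i, Pos A M X (γ i) ∧ ∀ q ∈ openSegment ℝ A (γ i), ¬ OnC γ q := by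
  obtain ⟨i0, hi0, hm0⟩ := guard_min hD H hp hpos
  obtain ⟨i, ⟨hi, hm⟩, hmax⟩ := Set.exists_max_image {i | Pos A M X (γ i) ∧
    ∀ q, OnC γ q → Pos A M X q → bx A M X (γ i) * bm A M X q ≤ bx A M X q * bm A M X (γ i)}
    (fun i => ba A M X (γ i)) (Set.toFinite _) ⟨i0, hi0, hm0⟩
  refine ⟨i, hi, ?_⟩
  intro q hq hC
  obtain ⟨x, y, hx, hy, hxy, rfl⟩ := mem_oseg.1 hq
  obtain ⟨v1, v2, v3, v4, v5, v6, v7, v8, v9⟩ := b_vals A M X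
  have hD2 : 0 < sideSign A M X ^ 2 := by positivity
  have c1 := ba_comb A M X A (γ i) x y hxy
  have c2 := bm_comb A M X A (γ i) x y hxy
  have c3 := bx_comb A M X A (γ i) x y hxy
  rw [v3] at c1
  rw [v2, mul_zero, zero_add] at c2
  rw [v1, mul_zero, zero_add] at c3
  obtain ⟨i1, i2, i3⟩ := id hi
  have hsum : ba A M X (γ i) < sideSign A M X ^ 2 := by
    have : ba A M X (γ i) + bm A M X (γ i) + bx A M X (γ i) = sideSign A M X ^ 2 := by
      simp only [bx, bm, ba, sideSign]; ring
    linarith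
  have hlt : ba A M X (γ i) < ba A M X (x • A + y • γ i) := by
    rw [c1]
    have : y = 1 - x := by linarith
    subst this
    nlinarith
  have qpos : Pos A M X (x • A + y • γ i) := ⟨by linarith, by rw [c2]; positivity, by rw [c3]; positivity⟩
  generalize x • A + y • γ i = q at *
  have hrat : bx A M X (γ i) * bm A M X q = bx A M X q * bm A M X (γ i) := by
    rw [c2, c3]; ring
  obtain ⟨k, hk⟩ := id hC
  -- any vertex in the triangle with ratio at most that of `q` is a minimiser
  have hmini : ∀ j, Pos A M X (γ j) → bx A M X (γ j) * bm A M X q ≤ bx A M X q * bm A M X (γ j) →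
      ba A M X (γ j) ≤ ba A M X (γ i) ∧
      bx A M X (γ j) * bm A M X q = bx A M X q * bm A M X (γ j) := by
    intro j hj hjl
    have hji := hm (γ j) ⟨j, left_mem_segment ℝ _ _⟩ hj
    obtain ⟨j1, j2, j3⟩ := id hj
    obtain ⟨q1, q2, q3⟩ := id qpos
    have e1 : bx A M X (γ j) * bm A M X (γ i) ≤ bx A M X (γ i) * bm A M X (γ j) := by
      have : bm A M X (γ i) * (bx A M X (γ j) * bm A M X q)
        ≤ bm A M X (γ i) * (bx A M X q * bm A M X (γ j)) := by gcongr
      have h6 : bm A M X q * (bx A M X (γ j) * bm A M X (γ i)) ≤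
          bm A M X q * (bx A M X (γ i) * bm A M X (γ j)) := by
        linear_combination this - bm A M X (γ j) * hrat
      exact le_of_mul_le_mul_left h6 q2
    have e2 := le_antisymm e1 hji
    constructor
    · apply hmax j
      refine ⟨hj, ?_⟩
      intro r hr hrp
      have h7 := hm r hr hrp
      have h8 : bm A M X (γ i) * (bx A M X (γ j) * bm A M X r) ≤
          bm A M X (γ i) * (bx A M X r * bm A M X (γ j)) := by
        have h9 : bm A M X (γ j) * (bx A M X (γ i) * bm A M X r) ≤
          bm A M X (γ j) * (bx A M X r * bm A M X (γ i)) := by gcongr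
        linear_combination h9 + bm A M X r * e2
      exact le_of_mul_le_mul_left h8 i2
    · have h10 : bm A M X (γ i) * (bx A M X (γ j) * bm A M X q) =
          bm A M X (γ i) * (bx A M X q * bm A M X (γ j)) := by
        linear_combination bm A M X q * e2 + bm A M X (γ j) * hrat
      exact mul_left_cancel₀ i2.ne' h10
  have hnA : A ∉ Ed γ k := hA k q hk qpos
  have good : ∀ w ∈ Ed γ k, bx A M X w * bm A M X q ≤ bx A M X q * bm A M X w → Pos A M X w := by
    intro w hw hl
    rcases tri_step hD hk qpos (H k q hk qpos) hw hl with h | ⟨s, s0, s1, hs⟩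
    · exact h
    · exfalso; apply hnA
      rw [hs]
      exact seg_mem_seg hk hw (by linarith) s0.le (by ring)
  have hk' := hk
  unfold Ed at hk'
  obtain ⟨x', y', hx', hy', hxy', hqe⟩ := mem_seg.1 hk'
  have em := bm_comb A M X (γ k) (γ (k + 1)) x' y' hxy'
  have ex := bx_comb A M X (γ k) (γ (k + 1)) x' y' hxy'
  have ea := ba_comb A M X (γ k) (γ (k + 1)) x' y' hxy'
  rw [← hqe] at em ex ea
  have key : x' * (bx A M X (γ k) * bm A M X q - bx A M X q * bm A M X (γ k))
      + y' * (bx A M X (γ (k+1)) * bm A M X q - bx A M X q * bm A M X (γ (k+1))) = 0 := by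
    linear_combination (bx A M X q) * em - (bm A M X q) * ex
  have hu : γ k ∈ Ed γ k := left_mem_segment ℝ _ _
  have hv : γ (k + 1) ∈ Ed γ k := right_mem_segment ℝ _ _
  by_cases lu : bx A M X (γ k) * bm A M X q ≤ bx A M X q * bm A M X (γ k)
  · obtain ⟨m1, m2⟩ := hmini k (good _ hu lu) lu
    rw [m2, sub_self, mul_zero, zero_add] at key
    rcases mul_eq_zero.1 key with h | h
    · have : x' = 1 := by linarith
      rw [this, h] at ea
      linarith
    · have lv : bx A M X (γ (k+1)) * bm A M X q ≤ bx A M X q * bm A M X (γ (k+1)) := by linarith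
      obtain ⟨n1, n2⟩ := hmini (k+1) (good _ hv lv) lv
      have : x' = 1 - y' := by linarith
      subst this
      nlinarith
  · push Not at lu
    have lv : bx A M X (γ (k+1)) * bm A M X q ≤ bx A M X q * bm A M X (γ (k+1)) := by
      by_contra hc
      push Not at hc
      exact conv_pos hx' hy' hxy' (sub_pos.2 lu) (sub_pos.2 hc) key
    obtain ⟨m1, m2⟩ := hmini (k+1) (good _ hv lv) lv
    rw [m2, sub_self, mul_zero, add_zero] at key
    rcases mul_eq_zero.1 key with h | h
    · have : y' = 1 := by linarith
      rw [this, h] at ea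
      linarith
    · linarith


lemma b_form {A M X : Pt} (p : Pt) (hD : sideSign A M X ≠ 0) :
    p = (ba A M X p / sideSign A M X ^ 2) • A + (bm A M X p / sideSign A M X ^ 2) • M +
      (bx A M X p / sideSign A M X ^ 2) • X ∧
    ba A M X p / sideSign A M X ^ 2 + bm A M X p / sideSign A M X ^ 2 +
      bx A M X p / sideSign A M X ^ 2 = 1 := by
  have e : ∀ z : ℝ, z * sideSign A M X / sideSign A M X ^ 2 = z / sideSign A M X := by
    intro z; field_simp
  unfold ba bm bx
  rw [e, e, e]
  exact ⟨bary A M X p hD, bary_sum A M X p hD⟩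

lemma b_bx0 {A M X p : Pt} (hD : sideSign A M X ≠ 0) (h : bx A M X p = 0) (h1 : 0 < ba A M X p)
    (h2 : 0 < bm A M X p) : p ∈ openSegment ℝ A M := by
  obtain ⟨e1, e2⟩ := b_form p hD
  rw [h] at e1 e2
  simp only [zero_div, add_zero, zero_smul] at e1 e2
  exact mem_oseg.2 ⟨_, _, by positivity, by positivity, e2, e1⟩

lemma b_ba0 {A M X p : Pt} (hD : sideSign A M X ≠ 0) (h : ba A M X p = 0) (h1 : 0 ≤ bm A M X p)
    (h2 : 0 ≤ bx A M X p) : p ∈ segment ℝ M X := by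
  obtain ⟨e1, e2⟩ := b_form p hD
  rw [h] at e1 e2
  simp only [zero_div, zero_add, zero_smul] at e1 e2
  exact mem_seg.2 ⟨_, _, by positivity, by positivity, e2, e1⟩

lemma b_ba0' {A M X p : Pt} (hD : sideSign A M X ≠ 0) (h : ba A M X p = 0) (h1 : 0 < bm A M X p)
    (h2 : 0 < bx A M X p) : p ∈ openSegment ℝ M X := by
  obtain ⟨e1, e2⟩ := b_form p hD
  rw [h] at e1 e2
  simp only [zero_div, zero_add, zero_smul] at e1 e2
  exact mem_oseg.2 ⟨_, _, by positivity, by positivity, e2, e1⟩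

lemma eps1 {α : ℝ} (β : ℝ) (h : 0 < α) :
    ∃ e0 : ℝ, 0 < e0 ∧ e0 ≤ 1 ∧ ∀ e, 0 < e → e ≤ e0 → 0 < (1 - e) * α + e * β := by
  refine ⟨α / (2 * α + |β|), by positivity, ?_, ?_⟩
  · rw [div_le_one (by positivity)]
    have := abs_nonneg β
    linarith
  · intro e h1 h2
    rw [le_div_iff₀ (by positivity)] at h2
    have h3 := neg_abs_le β
    nlinarith

section Flemma

variable {t : ℕ} [NeZero t] {φ : Pt → ℕ} {γ : ZMod t → Pt}

/-- every edge is on the line `ab`, or avoids the open segment `ab` -/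
def BaseFree (γ : ZMod t → Pt) (A B : Pt) : Prop :=
  ∀ k, (∀ p ∈ Ed γ k, sideSign A B p = 0) ∨ (∀ p ∈ openSegment ℝ A B, p ∉ Ed γ k)

lemma cont_ss (A B : Pt) : Continuous (fun p => sideSign A B p) := by
  unfold sideSign; fun_prop

lemma compact_seg (A B : Pt) : IsCompact (segment ℝ A B) := by
  rw [segment_eq_image]
  apply isCompact_Icc.image
  fun_prop

lemma base_avoid {A B : Pt} (hE : BaseFree γ A B) {k : ZMod t} {p q : Pt} (hp : p ∈ Ed γ k)
    (h : 0 < sideSign A B p) (hq : q ∈ openSegment ℝ A B) : q ∉ Ed γ k := by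
  rcases hE k with h1 | h1
  · have := h1 p hp; linarith
  · exact h1 q hq

lemma first_hit {A B m : Pt} (hE : BaseFree γ A B) (hm : m ∈ openSegment ℝ A B)
    (v : ZMod t) (hv : 0 < sideSign A B (γ v)) :
    ∃ (p : Pt) (s : ℝ), 0 < s ∧ s ≤ 1 ∧ p = (1 - s) • m + s • γ v ∧ (∀ q ∈ openSegment ℝ m p, ¬ OnC γ q) ∧
      0 < sideSign A B p ∧
      ((∃ i, p = γ i) ∨ ∃ e i j, p ∈ openSegment ℝ (γ i) (γ j) ∧ Ed γ e = segment ℝ (γ i) (γ j) ∧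
        ((i = e ∧ j = e + 1) ∨ (j = e ∧ i = e + 1)) ∧
        sideSign A B p ≤ sideSign A B (γ i) ∧ sideSign m p (γ i) ≠ 0) := by
  have hm0 : sideSign A B m = 0 := by
    obtain ⟨x, y, hx, hy, hxy, rfl⟩ := mem_oseg.1 hm
    rw [ss_comb2 _ _ _ _ _ _ hxy, ss_self1, ss_self2]; ring
  let K : Set Pt := ⋃ k ∈ {k : ZMod t | ∃ p ∈ Ed γ k, 0 < sideSign A B p}, Ed γ k
  have hK : IsCompact K := (Set.toFinite _).isCompact_biUnion (fun i _ => compact_seg _ _)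
  have hKm : ∀ p k, p ∈ Ed γ k → 0 < sideSign A B p → p ∈ K := by
    intro p k hk hp
    exact Set.mem_biUnion (show k ∈ {k : ZMod t | ∃ p ∈ Ed γ k, 0 < sideSign A B p} from ⟨p, hk, hp⟩) hk
  have hmK : m ∉ K := by
    intro h
    simp only [K, Set.mem_iUnion, Set.mem_ofPred_eq] at h
    obtain ⟨k, ⟨p, hp, hp2⟩, h2⟩ := h
    exact base_avoid hE hp hp2 hm h2
  have hS : IsCompact (K ∩ segment ℝ m (γ v)) := hK.inter_right (compact_seg _ _).isClosed
  have hne : (K ∩ segment ℝ m (γ v)).Nonempty :=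
    ⟨γ v, hKm _ v (left_mem_segment ℝ _ _) hv, right_mem_segment ℝ _ _⟩
  obtain ⟨p, ⟨hpK, hps⟩, hmin⟩ := hS.exists_isMinOn hne (cont_ss A B).continuousOn
  obtain ⟨x, s, hx, hs, hxs, hpe⟩ := mem_seg.1 hps
  have hhp : sideSign A B p = s * sideSign A B (γ v) := by
    rw [hpe, ss_comb2 _ _ _ _ _ _ hxs, hm0]; ring
  have hs0 : 0 < s := by
    rcases hs.lt_or_eq with h | h
    · exact h
    · exfalso; apply hmK
      rw [← h] at hpe hxs
      have : x = 1 := by linarith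
      rw [this] at hpe
      have : p = m := by rw [hpe]; simp
      rwa [← this]
  have hp0 : 0 < sideSign A B p := by rw [hhp]; positivity
  have hx' : x = 1 - s := by linarith
  rw [hx'] at hpe
  -- lower points of the segment are free
  have hfree : ∀ r : ℝ, 0 < r → r < 1 → ¬ OnC γ ((1 - r) • m + r • p) := by
    rintro r hr hr1 ⟨k, hk⟩
    have hh : sideSign A B ((1 - r) • m + r • p) = r * sideSign A B p := by
      rw [ss_comb2 _ _ _ _ _ _ (by ring), hm0]; ring
    have h1 := hKm _ k hk (by rw [hh]; positivity)
    have h2 : (1 - r) • m + r • p ∈ segment ℝ m (γ v) :=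
      seg_mem_seg (left_mem_segment ℝ _ _) hps (by linarith) hr.le (by ring)
    have h3 := hmin ⟨h1, h2⟩
    simp only [Set.mem_ofPred_eq] at h3
    rw [hh] at h3
    nlinarith
  refine ⟨p, s, hs0, by linarith, hpe, ?_, hp0, ?_⟩
  · intro q hq
    obtain ⟨x, y, hx, hy, hxy, rfl⟩ := mem_oseg.1 hq
    have : x = 1 - y := by linarith
    subst this
    exact hfree y hy (by linarith)
  simp only [K, Set.mem_iUnion, Set.mem_ofPred_eq] at hpK
  obtain ⟨e, _, he⟩ := hpK
  by_cases hvert : ∃ i, p = γ i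
  · exact Or.inl hvert
  right
  have hop : p ∈ openSegment ℝ (γ e) (γ (e + 1)) := by
    rcases seg_cases he with h | h | h
    · exact (hvert ⟨_, h⟩).elim
    · exact (hvert ⟨_, h⟩).elim
    · exact h
  have main : ∀ i j, p ∈ openSegment ℝ (γ i) (γ j) → Ed γ e = segment ℝ (γ i) (γ j) →
      sideSign A B p ≤ sideSign A B (γ i) → sideSign m p (γ i) ≠ 0 := by
    intro i j hpo hEe hle hD
    -- `h(p) (X - m) = h(X) (p - m)`
    have id1 : sideSign A B p • (γ i - m) = sideSign A B (γ i) • (p - m) := by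
      ext
      · simp only [Prod.smul_fst, Prod.fst_sub, smul_eq_mul]
        have : sideSign A B p * ((γ i).1 - m.1) - sideSign A B (γ i) * (p.1 - m.1)
          = -(sideSign m p (γ i)) * (B.1 - A.1) + sideSign A B m * ((γ i).1 - p.1) := by
          unfold sideSign; ring
        rw [hD, hm0] at this; linarith
      · simp only [Prod.smul_snd, Prod.snd_sub, smul_eq_mul]
        have : sideSign A B p * ((γ i).2 - m.2) - sideSign A B (γ i) * (p.2 - m.2)
          = -(sideSign m p (γ i)) * (B.2 - A.2) + sideSign A B m * ((γ i).2 - p.2) := by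
          unfold sideSign; ring
        rw [hD, hm0] at this; linarith
    rcases hle.lt_or_eq with hlt | heq
    · obtain ⟨x, y, hx, hy, hxy, hpe2⟩ := mem_oseg.1 hpo
      set τ : ℝ := sideSign A B (γ i) / sideSign A B p with hτ
      have hτ1 : 1 < τ := by rw [hτ, lt_div_iff₀ hp0]; linarith
      have hX : γ i = m + τ • (p - m) := by
        have : γ i - m = τ • (p - m) := by
          rw [hτ, div_eq_inv_mul, mul_smul, ← id1, smul_smul, inv_mul_cancel₀ hp0.ne', one_smul]
        rw [← this]; abel
      obtain ⟨e0, e1, e2, e3⟩ := eps1 (1 - (τ - 1) * x / y) (show (0:ℝ) < 1 by norm_num)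
      have hY : γ j = p + (-((τ - 1) * x / y)) • (p - m) := by
        have h5 : γ j = y⁻¹ • (p - x • γ i) := by
          rw [eq_inv_smul_iff₀ hy.ne']
          rw [eq_sub_iff_add_eq, add_comm]; exact hpe2.symm
        rw [h5, hX, inv_smul_eq_iff₀ hy.ne', smul_add y, smul_smul y]
        have hx2 : x = 1 - y := by linarith
        have : y * (-((τ - 1) * x / y)) = - ((τ - 1) * x) := by field_simp
        rw [this, hx2]
        module
      have hq : (1 - e0) • p + e0 • γ j ∈ Ed γ e := by
        rw [hEe]
        exact seg_mem_seg (by rw [← hEe]; exact he) (right_mem_segment ℝ _ _) (by linarith) e1.le (by ring)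
      have hr : (1 - e0) • p + e0 • γ j = (1 - (1 - e0 * ((τ - 1) * x / y))) • m +
          (1 - e0 * ((τ - 1) * x / y)) • p := by
        rw [hY]; module
      rw [hr] at hq
      refine hfree _ ?_ ?_ ⟨e, hq⟩
      · have := e3 e0 e1 le_rfl
        linarith
      · have : 0 < e0 * ((τ - 1) * x / y) := by
          have : 0 < τ - 1 := by linarith
          positivity
        linarith
    · apply hvert
      refine ⟨i, ?_⟩
      rw [← heq] at id1
      have := smul_right_injective Pt hp0.ne' id1
      exact (sub_left_injective this).symm
  rcases le_or_gt (sideSign A B p) (sideSign A B (γ e)) with h | h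
  · exact ⟨e, e, e + 1, hop, rfl, Or.inl ⟨rfl, rfl⟩, h, main _ _ hop rfl h⟩
  · have h2 : sideSign A B p ≤ sideSign A B (γ (e + 1)) := by
      obtain ⟨x, y, hx, hy, hxy, hpe2⟩ := mem_oseg.1 hop
      have := ss_comb2 A B (γ e) (γ (e+1)) x y hxy
      rw [← hpe2] at this
      by_contra hc
      push Not at hc
      have : x = 1 - y := by linarith
      subst this
      nlinarith
    have hop' := hop
    rw [openSegment_symm] at hop'
    exact ⟨e, e + 1, e, hop', segment_symm ℝ _ _, Or.inr ⟨rfl, rfl⟩, h2,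
      main _ _ hop' (segment_symm ℝ _ _) h2⟩

end Flemma


section Flemma2

variable {t : ℕ} [NeZero t] {φ : Pt → ℕ} {γ : ZMod t → Pt}

lemma h_mid {A B m : Pt} (hm : m ∈ openSegment ℝ A B) : sideSign A B m = 0 := by
  obtain ⟨x, y, hx, hy, hxy, rfl⟩ := mem_oseg.1 hm
  rw [ss_comb2 _ _ _ _ _ _ hxy, ss_self1, ss_self2]; ring

lemma exists_vis (hc : IsPlaneCycle φ t γ) {A B m : Pt} (hE : BaseFree γ A B)
    (hm : m ∈ openSegment ℝ A B) (v : ZMod t) (hv : 0 < sideSign A B (γ v)) :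
    ∃ i, 0 < sideSign A B (γ i) ∧ ∀ q ∈ openSegment ℝ m (γ i), ¬ OnC γ q := by
  have hm0 := h_mid hm
  obtain ⟨p, s, hs0, hs1, hps, hpf, hp0, hcase⟩ := first_hit hE hm v hv
  rcases hcase with ⟨i, rfl⟩ | ⟨e, i, j, hpo, hEe, hij, hle, hD⟩
  · exact ⟨i, hp0, hpf⟩
  obtain ⟨x, y, hx, hy, hxy, hpe⟩ := mem_oseg.1 hpo
  obtain ⟨v1, v2, v3, v4, v5, v6, v7, v8, v9⟩ := b_vals m p (γ i)
  have hD2 : 0 < sideSign m p (γ i) ^ 2 := by positivity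
  have hXpos : 0 < sideSign A B (γ i) := by linarith
  have hpp : ∀ q, Pos m p (γ i) q → 0 < sideSign A B q := by
    intro q hq
    obtain ⟨a, b, c, ha, hb, hcc, hs, rfl⟩ := (pos_iff hD).1 hq
    rw [ss_comb3 _ _ _ _ _ _ _ _ hs, hm0]
    have := mul_pos hb hp0
    have := mul_pos hcc hXpos
    linarith
  -- the other end
  have hbaY : ba m p (γ i) (γ j) = 0 := by
    have := ba_comb m p (γ i) (γ i) (γ j) x y hxy
    rw [← hpe, v6, v9] at this
    have : y * ba m p (γ i) (γ j) = 0 := by linarith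
    exact (mul_eq_zero.1 this).resolve_left hy.ne'
  have hbxY : bx m p (γ i) (γ j) < 0 := by
    have := bx_comb m p (γ i) (γ i) (γ j) x y hxy
    rw [← hpe, v4, v7] at this
    by_contra hcon
    push Not at hcon
    nlinarith [mul_pos hx hD2, mul_nonneg hy.le hcon]
  have hke : ∀ k q, q ∈ Ed γ k → 0 < ba m p (γ i) q → k ≠ e := by
    rintro k q hk hq rfl
    rw [hEe] at hk
    obtain ⟨x', y', _, _, hxy', hqe⟩ := mem_seg.1 hk
    have := ba_comb m p (γ i) (γ i) (γ j) x' y' hxy'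
    rw [← hqe, v9, hbaY] at this
    linarith
  have G : Guard γ m p (γ i) := by
    intro k r hr hrp q hq q1 q2 q3
    have hne := hke k r hr hrp.1
    have a1 : 0 < ba m p (γ i) q := by
      rcases q2.lt_or_eq with h | h
      · exact h
      · exfalso
        have h1 := b_ba0 hD h.symm q1.le q3
        have h2 : q ∈ Ed γ e := by
          rw [hEe]
          have hpm : p ∈ segment ℝ (γ i) (γ j) := openSegment_subset_segment ℝ _ _ hpo
          exact (convex_segment (γ i) (γ j)).segment_subset hpm (left_mem_segment ℝ _ _) h1
        have hvtx : q = γ i ∨ q = γ j := by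
          rcases cyc_inter hc hq h2 with h3 | ⟨h3, h4⟩ | ⟨h3, h4⟩
          · exact (hne h3).elim
          · rcases hij with ⟨h5, h6⟩ | ⟨h5, h6⟩
            · left; rw [h4, h5]
            · right; rw [h4, h5]
          · rcases hij with ⟨h5, h6⟩ | ⟨h5, h6⟩
            · right; rw [h4, h6, h3]
            · left; rw [h4, h6, h3]
        rcases hvtx with h3 | h3
        · rw [h3, v8] at q1; linarith
        · rw [h3] at q3; linarith
    refine ⟨a1, ?_⟩
    rcases q3.lt_or_eq with h | h
    · exact h
    · exact (hpf q (b_bx0 hD h.symm a1 q1) ⟨k, hq⟩).elim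
  by_cases hex : ∃ q, OnC γ q ∧ Pos m p (γ i) q
  · obtain ⟨q, hq, hqp⟩ := hex
    obtain ⟨i', h1, h2⟩ := guard_visA hD G hq hqp
      (fun k r hr hrp => base_avoid hE hr (hpp r hrp) hm)
    exact ⟨i', hpp _ h1, h2⟩
  -- the triangle is free: shoot towards `γ i`
  obtain ⟨p', s', hs0', hs1', hps', hpf', hp0', hcase'⟩ := first_hit hE hm i hXpos
  rcases hcase' with ⟨i', rfl⟩ | ⟨e', i', j', hpo', hEe', hij', hle', hD'⟩
  · exact ⟨i', hp0', hpf'⟩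
  rcases hs1'.lt_or_eq with hs1'' | hs1''
  swap
  · rw [hs1''] at hps'
    have : p' = γ i := by rw [hps']; simp
    rw [this] at hpf'
    exact ⟨i, hXpos, hpf'⟩
  exfalso
  have c1 := ba_comb m p (γ i) m (γ i) (1 - s') s' (by ring)
  have c2 := bm_comb m p (γ i) m (γ i) (1 - s') s' (by ring)
  have c3 := bx_comb m p (γ i) m (γ i) (1 - s') s' (by ring)
  rw [← hps', v3, v9] at c1
  rw [← hps', v2, v8] at c2
  rw [← hps', v1, v7] at c3
  have c1' : 0 < ba m p (γ i) p' := by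
    rw [c1]; have : 0 < 1 - s' := by linarith
    positivity
  have c3' : 0 < bx m p (γ i) p' := by rw [c3]; simp; positivity
  have c2' : bm m p (γ i) p' = 0 := by rw [c2]; ring
  obtain ⟨x', y', hx', hy', hxy', hpe'⟩ := mem_oseg.1 hpo'
  have hbi : bm m p (γ i) (γ i') ≠ 0 := by
    intro h0
    apply hD'
    have h1 : sideSign (γ i) m (γ i') = 0 := by
      unfold bm at h0; simpa [hD] using h0
    have : sideSign m p' (γ i') = - s' * sideSign (γ i) m (γ i') := by
      rw [ss_swap' m p', hps', ss_comb2 _ _ _ _ _ _ (by ring), ss_self1, ss_cyc (γ i) m]; ring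
    rw [this, h1]; ring
  have hsum := bm_comb m p (γ i) (γ i') (γ j') x' y' hxy'
  rw [← hpe', c2'] at hsum
  have hW : ∃ W, W ∈ Ed γ e' ∧ 0 < bm m p (γ i) W := by
    rcases lt_or_gt_of_ne hbi with h | h
    · refine ⟨γ j', by rw [hEe']; exact right_mem_segment ℝ _ _, ?_⟩
      by_contra hcon
      push Not at hcon
      nlinarith
    · exact ⟨γ i', by rw [hEe']; exact left_mem_segment ℝ _ _, h⟩
  obtain ⟨W, hW1, hW2⟩ := hW
  obtain ⟨ea, ea1, ea2, ea3⟩ := eps1 (ba m p (γ i) W) c1'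
  obtain ⟨eb, eb1, eb2, eb3⟩ := eps1 (bx m p (γ i) W) c3'
  have hε : 0 < min ea eb := lt_min ea1 eb1
  have f1 := ea3 _ hε (min_le_left _ _)
  have f2 := eb3 _ hε (min_le_right _ _)
  have f3 : min ea eb ≤ 1 := (min_le_left _ _).trans ea2
  generalize min ea eb = ε at *
  apply hex
  refine ⟨(1 - ε) • p' + ε • W, ⟨e', ?_⟩, ?_, ?_, ?_⟩
  · refine seg_mem_seg ?_ hW1 (by linarith) hε.le (by ring)
    show p' ∈ Ed γ e'
    rw [hEe']
    exact openSegment_subset_segment ℝ _ _ hpo'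
  · rw [ba_comb _ _ _ _ _ _ _ (by ring)]; exact f1
  · rw [bm_comb _ _ _ _ _ _ _ (by ring), c2']; nlinarith [mul_pos hε hW2]
  · rw [bx_comb _ _ _ _ _ _ _ (by ring)]; exact f2

lemma F_lemma (hc : IsPlaneCycle φ t γ) {A B : Pt} (hE : BaseFree γ A B) (v : ZMod t)
    (hv : 0 < sideSign A B (γ v)) :
    ∃ x, 0 < sideSign A B (γ x) ∧ ∀ p, InTri A B (γ x) p → ¬ OnC γ p := by
  obtain ⟨m, hm, hmdef⟩ : ∃ m, m ∈ openSegment ℝ A B ∧ m = (1/2 : ℝ) • A + (1/2 : ℝ) • B :=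
    ⟨_, mem_oseg.2 ⟨1/2, 1/2, by norm_num, by norm_num, by norm_num, rfl⟩, rfl⟩
  have hm0 := h_mid hm
  obtain ⟨i0, h0, h0'⟩ := exists_vis hc hE hm v hv
  obtain ⟨x, ⟨hx, hxf⟩, hmin⟩ := Set.exists_min_image {i | 0 < sideSign A B (γ i) ∧
    ∀ q ∈ openSegment ℝ m (γ i), ¬ OnC γ q} (fun i => sideSign A B (γ i)) (Set.toFinite _)
    ⟨i0, h0, h0'⟩
  refine ⟨x, hx, ?_⟩
  have side : ∀ Z : Pt, sideSign A B Z = 0 → (∀ a b : ℝ, 0 ≤ a → 0 < b → a + b = 1 →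
      a • Z + b • m ∈ openSegment ℝ A B) → sideSign Z m (γ x) ≠ 0 →
      ∀ q, OnC γ q → ¬ Pos Z m (γ x) q := by
    intro Z hZ0 hZ hD q hq hqp
    have hpp : ∀ q, Pos Z m (γ x) q → 0 < sideSign A B q ∧ sideSign A B q < sideSign A B (γ x) := by
      intro q hq
      obtain ⟨a, b, c, ha, hb, hcc, hs, rfl⟩ := (pos_iff hD).1 hq
      rw [ss_comb3 _ _ _ _ _ _ _ _ hs, hm0, hZ0]
      constructor
      · have := mul_pos hcc hx
        linarith
      · nlinarith
    have G : Guard γ Z m (γ x) := by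
      intro k r hr hrp q hq q1 q2 q3
      have a1 : 0 < bx Z m (γ x) q := by
        rcases q3.lt_or_eq with h | h
        · exact h
        · exfalso
          obtain ⟨e1, e2⟩ := b_form q hD
          rw [← h] at e1 e2
          simp only [zero_div, add_zero, zero_smul] at e1 e2
          have := hZ _ _ (by positivity) (by positivity) e2
          rw [← e1] at this
          exact base_avoid hE hr (hpp r hrp).1 this hq
      refine ⟨?_, a1⟩
      rcases q2.lt_or_eq with h | h
      · exact h
      · exact (hxf q (b_ba0' hD h.symm q1 a1) ⟨k, hq⟩).elim
    obtain ⟨i, hi, hif⟩ := guard_visM hD G hq hqp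
    have := hmin i ⟨(hpp _ hi).1, hif⟩
    have := (hpp _ hi).2
    linarith
  have sA : sideSign A m (γ x) = 1/2 * sideSign A B (γ x) := by
    rw [hmdef]; unfold sideSign; simp; ring
  have sB : sideSign B m (γ x) = -1/2 * sideSign A B (γ x) := by
    rw [hmdef]; unfold sideSign; simp; ring
  have hDA : sideSign A m (γ x) ≠ 0 := by rw [sA]; positivity
  have hDB : sideSign B m (γ x) ≠ 0 := by
    rw [sB]; intro h; linarith
  have hA := side A (ss_self1 _ _) (by
    intro a b ha hb hab
    rw [hmdef]
    exact mem_oseg.2 ⟨a + b / 2, b / 2, by positivity, by positivity, by linarith, by module⟩) hDA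
  have hB := side B (ss_self2 _ _) (by
    intro a b ha hb hab
    rw [hmdef]
    exact mem_oseg.2 ⟨b / 2, a + b / 2, by positivity, by positivity, by linarith, by module⟩) hDB
  rintro p ⟨a, b, c, ha, hb, hcc, hs, rfl⟩ hC
  rcases lt_trichotomy a b with h | h | h
  · refine hB _ hC ((pos_iff hDB).2 ⟨b - a, 2 * a, c, by linarith, by linarith, hcc, by linarith, ?_⟩)
    rw [hmdef]; module
  · subst h
    refine hxf _ (mem_oseg.2 ⟨2 * a, c, by linarith, hcc, by linarith, ?_⟩) hC
    rw [hmdef]; module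
  · refine hA _ hC ((pos_iff hDA).2 ⟨a - b, 2 * b, c, by linarith, by linarith, hcc, by linarith, ?_⟩)
    rw [hmdef]; module

end Flemma2


section CaseB1

variable {t : ℕ} {φ : Pt → ℕ} {γ : ZMod t → Pt}

/-- the open triangle avoids the polygon -/
def TFree (γ : ZMod t → Pt) (A B X : Pt) : Prop := ∀ p, InTri A B X p → ¬ OnC γ p

lemma TFree.rot {A B X : Pt} (h : TFree γ A B X) : TFree γ B X A :=
  fun p hp => h p hp.rot.rot
lemma TFree.swap {A B X : Pt} (h : TFree γ A B X) : TFree γ B A X :=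
  fun p hp => h p hp.swap

def Ear (γ : ZMod t → Pt) (i : ZMod t) : Prop := TFree γ (γ (i - 1)) (γ i) (γ (i + 1))

lemma Ctx.inj (c : Ctx t φ γ) {i j : ZMod t} (h : i ≠ j) : γ i ≠ γ j := fun h' => h (c.cyc.2.1 h')

lemma Ctx.nz (c : Ctx t φ γ) : NeZero t := ⟨by have := c.ht; omega⟩

lemma Ctx.open_edge (c : Ctx t φ γ) {i k : ZMod t} {p : Pt}
    (hp : p ∈ openSegment ℝ (γ i) (γ (i + 1))) (hk : p ∈ Ed γ k) : k = i := by
  have h1 := (zne' c.ht).1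
  have hne : γ i ≠ γ (i + 1) := c.inj (by intro h; apply h1; linear_combination -h)
  have hi : p ∈ Ed γ i := openSegment_subset_segment ℝ _ _ hp
  rcases cyc_inter c.cyc hi hk with h | ⟨h, h2⟩ | ⟨h, h2⟩
  · exact h.symm
  · exfalso
    rw [h2, h] at hp
    exact hne (right_mem_openSegment_iff.1 hp)
  · exfalso
    rw [h2] at hp
    exact hne (left_mem_openSegment_iff.1 hp)

lemma Ctx.seg_free (c : Ctx t φ γ) {i j k : ZMod t} (hij : i ≠ j) (hik : i ≠ k) (hjk : j ≠ k)
    (hT : TFree γ (γ i) (γ j) (γ k)) : j = i + 1 ∨ i = j + 1 ∨ Clear γ i j := by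
  by_contra hcon
  push Not at hcon
  obtain ⟨n1, n2, hcl⟩ := hcon
  apply hcl
  intro q hq l hl
  have h01 := (zne' c.ht).1
  have hD := c.gp i j k hij hik hjk
  obtain ⟨v1, v2, v3, v4, v5, v6, v7, v8, v9⟩ := b_vals (γ i) (γ j) (γ k)
  have hD2 : 0 < sideSign (γ i) (γ j) (γ k) ^ 2 := by positivity
  obtain ⟨a, b, ha, hb, hab, hqe⟩ := mem_oseg.1 hq
  have c1 := ba_comb (γ i) (γ j) (γ k) (γ i) (γ j) a b hab
  have c2 := bm_comb (γ i) (γ j) (γ k) (γ i) (γ j) a b hab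
  have c3 := bx_comb (γ i) (γ j) (γ k) (γ i) (γ j) a b hab
  rw [← hqe, v3, v6] at c1
  rw [← hqe, v2, v5] at c2
  rw [← hqe, v1, v4] at c3
  have c1' : 0 < ba (γ i) (γ j) (γ k) q := by rw [c1]; simp; positivity
  have c2' : 0 < bm (γ i) (γ j) (γ k) q := by rw [c2]; simp; positivity
  have c3' : bx (γ i) (γ j) (γ k) q = 0 := by rw [c3]; ring
  have vert : ∀ r, bx (γ i) (γ j) (γ k) (γ r) = 0 → r = i ∨ r = j := by
    intro r hr
    by_contra hc
    push Not at hc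
    have := c.gp i j r hij hc.1.symm hc.2.symm
    unfold bx at hr
    simp [hD] at hr
    exact this hr
  have nv : ∀ r, q ≠ γ r := by
    intro r hr
    rw [hr] at c3'
    rcases vert r c3' with h | h
    · rw [hr, h] at hq
      exact c.inj hij (left_mem_openSegment_iff.1 hq)
    · rw [hr, h] at hq
      exact c.inj hij (right_mem_openSegment_iff.1 hq)
  have hop : q ∈ openSegment ℝ (γ l) (γ (l + 1)) := by
    rcases seg_cases hl with h | h | h
    · exact (nv _ h).elim
    · exact (nv _ h).elim
    · exact h
  obtain ⟨x, y, hx, hy, hxy, hqe2⟩ := mem_oseg.1 hop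
  have hsum := bx_comb (γ i) (γ j) (γ k) (γ l) (γ (l+1)) x y hxy
  rw [← hqe2, c3'] at hsum
  have hW : ∃ W, W ∈ Ed γ l ∧ 0 < bx (γ i) (γ j) (γ k) W := by
    rcases lt_trichotomy (bx (γ i) (γ j) (γ k) (γ l)) 0 with h | h | h
    · refine ⟨γ (l + 1), right_mem_segment ℝ _ _, ?_⟩
      by_contra hcon
      push Not at hcon
      nlinarith
    · exfalso
      rw [h, mul_zero, zero_add] at hsum
      have h2 := (mul_eq_zero.1 hsum.symm).resolve_left hy.ne'
      rcases vert _ h with e1 | e1 <;> rcases vert _ h2 with e2 | e2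
      · apply h01; linear_combination e2 - e1
      · apply n1; rw [← e2, e1]
      · apply n2; rw [← e2, e1]
      · apply h01; linear_combination e2 - e1
    · exact ⟨γ l, left_mem_segment ℝ _ _, h⟩
  obtain ⟨W, hW1, hW2⟩ := hW
  obtain ⟨ea, ea1, ea2, ea3⟩ := eps1 (ba (γ i) (γ j) (γ k) W) c1'
  obtain ⟨eb, eb1, eb2, eb3⟩ := eps1 (bm (γ i) (γ j) (γ k) W) c2'
  have hε : 0 < min ea eb := lt_min ea1 eb1
  have f1 := ea3 _ hε (min_le_left _ _)
  have f2 := eb3 _ hε (min_le_right _ _)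
  have f3 : min ea eb ≤ 1 := (min_le_left _ _).trans ea2
  generalize min ea eb = ε at *
  refine hT ((1 - ε) • q + ε • W) ((pos_iff hD).1 ⟨?_, ?_, ?_⟩) ⟨l, ?_⟩
  · rw [ba_comb _ _ _ _ _ _ _ (by ring)]; exact f1
  · rw [bm_comb _ _ _ _ _ _ _ (by ring)]; exact f2
  · rw [bx_comb _ _ _ _ _ _ _ (by ring), c3']; nlinarith [mul_pos hε hW2]
  · exact seg_mem_seg hl hW1 (by linarith) hε.le (by ring)

lemma BaseFree.symm {A B : Pt} (h : BaseFree γ A B) : BaseFree γ B A := by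
  intro k
  rcases h k with h1 | h1
  · left; intro p hp; rw [ss_swap, h1 p hp, neg_zero]
  · right; rw [openSegment_symm]; exact h1

lemma Ctx.F (c : Ctx t φ γ) {A B : Pt} (hE : BaseFree γ A B) (v : ZMod t)
    (hv : sideSign A B (γ v) ≠ 0) :
    ∃ x, 0 < sideSign A B (γ v) * sideSign A B (γ x) ∧ TFree γ A B (γ x) := by
  have := c.nz
  rcases lt_or_gt_of_ne hv with h | h
  · obtain ⟨x, h1, h2⟩ := F_lemma c.cyc hE.symm v (by rw [ss_swap]; linarith)
    rw [ss_swap] at h1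
    exact ⟨x, by nlinarith, TFree.swap h2⟩
  · obtain ⟨x, h1, h2⟩ := F_lemma c.cyc hE v h
    exact ⟨x, by positivity, h2⟩

lemma Ctx.base_edge (c : Ctx t φ γ) (i : ZMod t) : BaseFree γ (γ i) (γ (i + 1)) := by
  intro k
  by_cases h : k = i
  · left
    intro p hp
    rw [h] at hp
    obtain ⟨x, y, _, _, hxy, rfl⟩ := mem_seg.1 hp
    rw [ss_comb2 _ _ _ _ _ _ hxy, ss_self1, ss_self2]; ring
  · right
    intro p hp hk
    exact h (c.open_edge hp hk)

lemma Clear.base {i j : ZMod t} (h : Clear γ i j) : BaseFree γ (γ i) (γ j) :=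
  fun k => Or.inr (fun p hp => h p hp k)

lemma Ctx.F1 (c : Ctx t φ γ) (i v : ZMod t) (h0 : v ≠ i) (h1 : v ≠ i + 1) :
    (0 < sideSign (γ i) (γ (i + 1)) (γ v) * sideSign (γ i) (γ (i + 1)) (γ (i - 1)) ∧ Ear γ i) ∨
    (0 < sideSign (γ i) (γ (i + 1)) (γ v) * sideSign (γ i) (γ (i + 1)) (γ (i + 2)) ∧
      Ear γ (i + 1)) := by
  obtain ⟨z1, z2, z3, z4, z5⟩ := zne' c.ht
  have hi1 : i ≠ i + 1 := by intro h; apply z1; linear_combination -h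
  obtain ⟨x, hx1, hx2⟩ := c.F (c.base_edge i) v (c.gp _ _ _ hi1 h0.symm h1.symm)
  have xi : i ≠ x := by
    rintro rfl; rw [ss_self1] at hx1; simp at hx1
  have xi1 : i + 1 ≠ x := by
    rintro rfl; rw [ss_self2] at hx1; simp at hx1
  by_cases e1 : x = i - 1
  · left
    rw [e1] at hx1 hx2
    exact ⟨hx1, hx2.rot.rot⟩
  by_cases e2 : x = i + 2
  · right
    rw [e2] at hx1 hx2
    refine ⟨hx1, ?_⟩
    unfold Ear
    rw [show i + 1 - 1 = i by ring, show i + 1 + 1 = i + 2 by ring]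
    exact hx2
  exfalso
  have s1 : Clear γ x i := by
    rcases c.seg_free xi.symm xi1.symm hi1 hx2.rot.rot with h | h | h
    · exfalso; apply e1; linear_combination -h
    · exact (xi1 h.symm).elim
    · exact h
  have s2 : Clear γ (i + 1) x := by
    rcases c.seg_free xi1 hi1.symm xi.symm hx2.rot with h | h | h
    · exfalso; apply e2; linear_combination h
    · exfalso; apply xi; linear_combination h
    · exact h
  have m1 := c.clear_mono xi.symm (by intro h; apply e1; linear_combination -h)
    xi1.symm s1
  have m2 := c.clear_mono xi1 (by intro h; apply e2; linear_combination h)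
    (by intro h; apply xi; linear_combination h) s2
  exact c.cyc.2.2.1 i (by rw [m2, m1])

lemma Ctx.ear_clear (c : Ctx t φ γ) {i : ZMod t} (h : Ear γ i) : Clear γ (i - 1) (i + 1) := by
  obtain ⟨z1, z2, z3, z4, z5⟩ := zne' c.ht
  rcases c.seg_free (i := i - 1) (j := i + 1) (k := i) (by intro h; apply z2; linear_combination -h)
    (by intro h; apply z1; linear_combination -h) (by intro h; apply z1; linear_combination h)
    h.rot.rot.swap with h | h | h
  · exfalso; apply z1; linear_combination h
  · exfalso; apply z3; linear_combination -h
  · exact h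

lemma Ctx.ear_col (c : Ctx t φ γ) {i : ZMod t} (h : Ear γ i) : φ (γ (i - 1)) = φ (γ (i + 1)) := by
  obtain ⟨z1, z2, z3, z4, z5⟩ := zne' c.ht
  exact c.clear_mono (by intro h; apply z2; linear_combination -h)
    (by intro h; apply z1; linear_combination h) (by intro h; apply z3; linear_combination -h)
    (c.ear_clear h)

lemma quad {u v w x : Pt} (h : sideSign u w v * sideSign u w x < 0) (h1 : sideSign v x u ≠ 0)
    (h2 : sideSign v x w ≠ 0) :
    (∃ z, z ∈ openSegment ℝ v x ∧ z ∈ openSegment ℝ u w) ∨ InTri v w x u ∨ InTri v u x w := by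
  have hd : sideSign u w x - sideSign u w v ≠ 0 := by
    intro h0
    have : sideSign u w x = sideSign u w v := by linarith
    rw [this] at h
    nlinarith [mul_self_nonneg (sideSign u w v)]
  set d := sideSign u w x - sideSign u w v with hdd
  obtain ⟨lam, hlam⟩ : ∃ l, l = sideSign u w x / d := ⟨_, rfl⟩
  obtain ⟨mu, hmu⟩ : ∃ l, l = -sideSign u w v / d := ⟨_, rfl⟩
  obtain ⟨p, hp⟩ : ∃ l, l = -sideSign v x w / d := ⟨_, rfl⟩
  obtain ⟨q, hq⟩ : ∃ l, l = sideSign v x u / d := ⟨_, rfl⟩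
  have s1 : lam + mu = 1 := by rw [hlam, hmu, ← add_div, div_eq_one_iff_eq hd, hdd]; ring
  have s2 : p + q = 1 := by
    rw [hp, hq, ← add_div, div_eq_one_iff_eq hd, hdd]; unfold sideSign; ring
  have l0 : 0 < lam ∧ 0 < mu := by
    rcases mul_neg_iff.1 h with ⟨ha, hb⟩ | ⟨ha, hb⟩
    · have : d < 0 := by rw [hdd]; linarith
      exact ⟨by rw [hlam]; exact div_pos_of_neg_of_neg hb this,
        by rw [hmu]; exact div_pos_of_neg_of_neg (by linarith) this⟩
    · have : 0 < d := by rw [hdd]; linarith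
      exact ⟨by rw [hlam]; positivity, by rw [hmu]; exact div_pos (by linarith) this⟩
  have p0 : p ≠ 0 := by rw [hp]; exact div_ne_zero (neg_ne_zero.2 h2) hd
  have q0 : q ≠ 0 := by rw [hq]; exact div_ne_zero h1 hd
  have e : lam • v + mu • x = p • u + q • w := by
    rw [hlam, hmu, hp, hq]
    ext
    · simp only [Prod.fst_add, Prod.smul_fst, smul_eq_mul]
      field_simp
      unfold sideSign; ring
    · simp only [Prod.snd_add, Prod.smul_snd, smul_eq_mul]
      field_simp
      unfold sideSign; ring
  rcases lt_or_gt_of_ne p0 with hp0 | hp0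
  · right; right
    have hq1 : 0 < q := by linarith
    refine ⟨lam / q, -p / q, mu / q, div_pos l0.1 hq1, div_pos (by linarith) hq1, div_pos l0.2 hq1,
      by field_simp; linarith, ?_⟩
    have : w = q⁻¹ • (lam • v + mu • x - p • u) := by
      rw [eq_inv_smul_iff₀ hq1.ne', e]; abel
    rw [this]; module
  rcases lt_or_gt_of_ne q0 with hq0 | hq0
  · right; left
    have hp1 : 0 < p := by linarith
    refine ⟨lam / p, -q / p, mu / p, div_pos l0.1 hp1, div_pos (by linarith) hp1, div_pos l0.2 hp1,
      by field_simp; linarith, ?_⟩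
    have : u = p⁻¹ • (lam • v + mu • x - q • w) := by
      rw [eq_inv_smul_iff₀ hp1.ne', e]; abel
    rw [this]; module
  · left
    exact ⟨_, mem_oseg.2 ⟨lam, mu, l0.1, l0.2, s1, rfl⟩, mem_oseg.2 ⟨p, q, hp0, hq0, s2, e⟩⟩

lemma through {u v w x z p : Pt} (h1 : z ∈ openSegment ℝ v x) (h2 : z ∈ openSegment ℝ u w)
    (hp : p ∈ openSegment ℝ v x) : p = z ∨ InTri u v w p ∨ InTri u w x p := by
  obtain ⟨a, b, ha, hb, hab, e1⟩ := mem_oseg.1 h1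
  obtain ⟨c, d, hc, hd, hcd, e2⟩ := mem_oseg.1 h2
  obtain ⟨r, s, hr, hs, hrs, e3⟩ := mem_oseg.1 hp
  have ha' : a = 1 - b := by linarith
  have hr' : r = 1 - s := by linarith
  subst ha' hr'
  rcases lt_trichotomy s b with h | h | h
  · right; left
    refine ⟨s / b * c, 1 - s / b, s / b * d, by positivity, ?_, by positivity, ?_, ?_⟩
    · rw [sub_pos, div_lt_one hb]; exact h
    · linear_combination (s / b) * hcd
    · have : p = (1 - s / b) • v + (s / b) • z := by
        rw [e1, e3, smul_add, smul_smul, smul_smul, ← add_assoc, ← add_smul]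
        congr 2 <;> (field_simp; try ring)
      rw [this, e2]; module
  · left; rw [e1, e3, h]
  · right; right
    have hk : 0 < (1 - s) / (1 - b) := div_pos hr (by linarith)
    refine ⟨(1 - s) / (1 - b) * c, (1 - s) / (1 - b) * d, 1 - (1 - s) / (1 - b), by positivity,
      by positivity, ?_, ?_, ?_⟩
    · rw [sub_pos, div_lt_one (by linarith)]; linarith
    · linear_combination ((1 - s) / (1 - b)) * hcd
    · have : p = ((1 - s) / (1 - b)) • z + (1 - (1 - s) / (1 - b)) • x := by
        rw [e1, e3, smul_add, smul_smul, smul_smul, add_assoc, ← add_smul]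
        have : (1 - b) ≠ 0 := by linarith
        congr 2 <;> (field_simp; try ring)
      rw [this, e2]; module

end CaseB1


lemma cone_geo {o a w x c d : Pt} (h1 : InTri a w x o) (h2 : InTri a c d o)
    (na : sideSign o a c ≠ 0) (nw : sideSign o w c ≠ 0) (nx : sideSign o x c ≠ 0)
    (nS : sideSign o a x ≠ 0)
    (hn1 : ¬ (0 < sideSign o w c * sideSign o w x ∧ 0 < sideSign o c x * sideSign o w x))
    (hn2 : ¬ (0 < sideSign o a c * sideSign o a w ∧ 0 < sideSign o c w * sideSign o a w)) :
    ∃ A B : ℝ, 0 < A ∧ 0 < B ∧ x = (1 - A - B) • o + A • c + B • d := by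
  obtain ⟨l1, l2, l3, p1, p2, p3, hl, ho⟩ := h1
  obtain ⟨m1, m2, m3, r1, r2, r3, hm, ho2⟩ := h2
  have q1 := ss_comb3 o a a w x l1 l2 l3 hl
  have q2 := ss_comb3 o w a w x l1 l2 l3 hl
  have q3 := ss_comb3 o c a w x l1 l2 l3 hl
  rw [← ho, ss_self1, ss_self2] at q1 q2
  rw [← ho, ss_self1] at q3
  rw [ss_swap' o w a] at q2
  rw [ss_swap' o c a, ss_swap' o c w, ss_swap' o c x] at q3
  rw [ss_swap' o c x] at hn1
  rw [ss_swap' o c w] at hn2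
  have hb := bary o a x c nS
  have hbs := bary_sum o a x c nS
  rw [ss_swap x o c] at hb hbs
  generalize sideSign o a x = S at *
  generalize sideSign o a c = Ac at *
  generalize sideSign o w c = Wc at *
  generalize sideSign o x c = Xc at *
  generalize sideSign o a w = Aw at *
  generalize sideSign o w x = Wx at *
  have eAw : Aw = -(l3 / l2) * S := by field_simp; linarith
  have eWx : Wx = -(l1 / l2) * S := by
    have : Wx = l1 / l3 * Aw := by field_simp; linarith
    rw [this, eAw]; field_simp
  have hS2 : 0 < S ^ 2 := by positivity
  have k1 : 0 < l1 / l2 := by positivity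
  have k3 : 0 < l3 / l2 := by positivity
  have i1 : Wc * S < 0 → 0 < Xc * S → False := by
    intro u v
    apply hn1
    rw [eWx]
    constructor
    · nlinarith [mul_pos k1 (neg_pos.2 u)]
    · nlinarith [mul_pos k1 v]
  have i2 : Ac * S < 0 → 0 < Wc * S → False := by
    intro u v
    apply hn2
    rw [eAw]
    constructor
    · nlinarith [mul_pos k3 (neg_pos.2 u)]
    · nlinarith [mul_pos k3 v]
  have i3 : l1 * (Ac * S) + l2 * (Wc * S) + l3 * (Xc * S) = 0 := by linear_combination S * q3
  have n1 : Ac * S ≠ 0 := mul_ne_zero na nS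
  have n2 : Wc * S ≠ 0 := mul_ne_zero nw nS
  have n3 : Xc * S ≠ 0 := mul_ne_zero nx nS
  have cA : 0 < Ac * S := by
    by_contra h
    have hA : Ac * S < 0 := lt_of_le_of_ne (not_lt.1 h) n1
    have hW : Wc * S < 0 := lt_of_le_of_ne (not_lt.1 (i2 hA)) n2
    have hX : Xc * S < 0 := lt_of_le_of_ne (not_lt.1 (i1 hW)) n3
    nlinarith [mul_pos p1 (neg_pos.2 hA), mul_pos p2 (neg_pos.2 hW), mul_pos p3 (neg_pos.2 hX)]
  have cX : Xc * S < 0 := by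
    by_contra h
    have hX : 0 < Xc * S := lt_of_le_of_ne (not_lt.1 h) n3.symm
    have hW : 0 < Wc * S := by
      by_contra h
      exact i1 (lt_of_le_of_ne (not_lt.1 h) n2) hX
    nlinarith [mul_pos p1 cA, mul_pos p2 hW, mul_pos p3 hX]
  obtain ⟨s, hs⟩ : ∃ s, s = -Xc / S := ⟨_, rfl⟩
  obtain ⟨r, hr⟩ : ∃ r, r = Ac / S := ⟨_, rfl⟩
  have s0 : 0 < s := by
    have : s = -(Xc * S) / S ^ 2 := by rw [hs]; field_simp
    rw [this]; exact div_pos (by linarith) hS2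
  have r0 : 0 < r := by
    have : r = (Ac * S) / S ^ 2 := by rw [hr]; field_simp
    rw [this]; positivity
  rw [← hs, ← hr] at hb hbs
  have hf : sideSign a x c / S = 1 - s - r := by linarith
  rw [hf] at hb
  -- c = (1-s-r) o + s a + r x
  have hx : x = r⁻¹ • (c - (1 - s - r) • o - s • a) := by
    rw [eq_inv_smul_iff₀ r0.ne']; nth_rewrite 1 [hb]; abel
  have ha : a = m1⁻¹ • (o - m2 • c - m3 • d) := by
    rw [eq_inv_smul_iff₀ r1.ne']
    have : o - m2 • c - m3 • d = (m1 • a + m2 • c + m3 • d) - m2 • c - m3 • d := by rw [← ho2]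
    rw [this]; abel
  refine ⟨r⁻¹ * (1 + s * m2 / m1), r⁻¹ * (s * m3 / m1), by positivity, by positivity, ?_⟩
  have hm' : m1 = 1 - m2 - m3 := by linarith
  have e0 : 1 - r⁻¹ * (1 + s * m2 / m1) - r⁻¹ * (s * m3 / m1)
      = r⁻¹ * (-(1 - s - r) - s * m1⁻¹) := by
    field_simp
    rw [hm']; ring
  rw [e0, hx, ha]
  module

lemma cone_emit {o p q c : Pt} (h1 : 0 < sideSign o p c * sideSign o p q)
    (h2 : 0 < sideSign o c q * sideSign o p q) :
    ∃ e : ℝ, 0 < e ∧ e ≤ 1 ∧ InTri o p q ((1 - e) • o + e • c) := by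
  have hD : sideSign o p q ≠ 0 := by rintro h; simp [h] at h1
  obtain ⟨v1, v2, v3, v4, v5, v6, v7, v8, v9⟩ := b_vals o p q
  have hb : 0 < ba o p q o := by rw [v3]; positivity
  obtain ⟨e, e1, e2, e3⟩ := eps1 (ba o p q c) hb
  refine ⟨e, e1, e2, (pos_iff hD).1 ⟨?_, ?_, ?_⟩⟩
  · rw [ba_comb _ _ _ _ _ _ _ (by ring)]; exact e3 e e1 le_rfl
  · rw [bm_comb _ _ _ _ _ _ _ (by ring), v2]
    have : bm o p q c = sideSign o c q * sideSign o p q := by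
      unfold bm; rw [ss_cyc q o c]
    rw [this]
    nlinarith [mul_pos e1 h2]
  · rw [bx_comb _ _ _ _ _ _ _ (by ring), v1]
    have : bx o p q c = sideSign o p c * sideSign o p q := rfl
    rw [this]
    nlinarith [mul_pos e1 h1]

section CaseB2

variable {t : ℕ} {φ : Pt → ℕ} {γ : ZMod t → Pt}

def RR (γ : ZMod t → Pt) (i : ZMod t) : Prop := ∃ k, k ≠ i - 1 ∧ k ≠ i ∧ k ≠ i + 1 ∧ k ≠ i + 2 ∧
  k ≠ i - 2 ∧ TFree γ (γ (i - 1)) (γ (i + 1)) (γ k) ∧ InTri (γ i) (γ (i - 1)) (γ k) (γ (i + 1))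

def LL (γ : ZMod t → Pt) (i : ZMod t) : Prop := ∃ k, k ≠ i - 1 ∧ k ≠ i ∧ k ≠ i + 1 ∧ k ≠ i + 2 ∧
  k ≠ i - 2 ∧ TFree γ (γ (i - 1)) (γ (i + 1)) (γ k) ∧ InTri (γ i) (γ (i + 1)) (γ k) (γ (i - 1))

def XX (γ : ZMod t → Pt) (i : ZMod t) : Prop := InTri (γ (i - 1)) (γ (i + 1)) (γ (i + 2)) (γ i)
def YY (γ : ZMod t → Pt) (i : ZMod t) : Prop := InTri (γ (i - 1)) (γ i) (γ (i + 2)) (γ (i + 1))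

def NonExt (γ : ZMod t → Pt) (j : ZMod t) : Prop := ∃ a b c, a ≠ b ∧ a ≠ c ∧ b ≠ c ∧
  a ≠ j ∧ b ≠ j ∧ c ≠ j ∧ InTri (γ a) (γ b) (γ c) (γ j)

lemma Ctx.F2 (c : Ctx t φ γ) {i v : ZMod t} (hE : Ear γ i)
    (hv : sideSign (γ (i - 1)) (γ (i + 1)) (γ v) * sideSign (γ (i - 1)) (γ (i + 1)) (γ i) < 0) :
    RR γ i ∨ LL γ i := by
  obtain ⟨z1, z2, z3, z4, z5⟩ := zne' c.ht
  have hcl := c.ear_clear hE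
  have hcol := c.ear_col hE
  have hv0 : sideSign (γ (i - 1)) (γ (i + 1)) (γ v) ≠ 0 := by
    intro h; rw [h] at hv; simp at hv
  obtain ⟨k, hk1, hk2⟩ := c.F hcl.base v hv0
  have hop : sideSign (γ (i - 1)) (γ (i + 1)) (γ i) * sideSign (γ (i - 1)) (γ (i + 1)) (γ k) < 0 := by
    by_contra h
    push Not at h
    have hp : 0 < sideSign (γ (i - 1)) (γ (i + 1)) (γ v) ^ 2 := by positivity
    rcases lt_or_gt_of_ne hv0 with h5 | h5
    · have : 0 < sideSign (γ (i - 1)) (γ (i + 1)) (γ i) := by nlinarith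
      have : sideSign (γ (i - 1)) (γ (i + 1)) (γ k) < 0 := by nlinarith
      nlinarith
    · have : sideSign (γ (i - 1)) (γ (i + 1)) (γ i) < 0 := by nlinarith
      have : 0 < sideSign (γ (i - 1)) (γ (i + 1)) (γ k) := by nlinarith
      nlinarith
  have k1 : k ≠ i - 1 := by rintro rfl; rw [ss_self1] at hop; simp at hop
  have k2 : k ≠ i + 1 := by rintro rfl; rw [ss_self2] at hop; simp at hop
  have k3 : k ≠ i := by rintro rfl; nlinarith [mul_self_nonneg (sideSign (γ (k - 1)) (γ (k + 1)) (γ k))]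
  have d1 : i - 1 ≠ i + 1 := by intro h; apply z2; linear_combination -h
  have d2 : i - 1 ≠ i := by intro h; apply z1; linear_combination -h
  have d3 : i + 1 ≠ i := by intro h; apply z1; linear_combination h
  have k4 : k ≠ i + 2 := by
    rintro rfl
    have a1 : i - 1 ≠ i + 2 := by intro h; apply z3; linear_combination -h
    have a2 : i + 2 ≠ i - 1 + 1 := by intro h; apply z2; linear_combination h
    have a3 : i - 1 ≠ i + 2 + 1 := by intro h; apply z4; linear_combination -h
    rcases c.seg_free a1 d1 k2 (hk2.rot.rot.swap) with h | h | h
    · exact a2 h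
    · exact a3 h
    · have := c.clear_mono a1 a2 a3 h
      apply c.cyc.2.2.1 (i + 1)
      rw [← hcol, this]
      congr 2; ring
  have k5 : k ≠ i - 2 := by
    rintro rfl
    have a1 : i + 1 ≠ i - 2 := by intro h; apply z3; linear_combination h
    have a2 : i - 2 ≠ i + 1 + 1 := by intro h; apply z4; linear_combination -h
    have a3 : i + 1 ≠ i - 2 + 1 := by intro h; apply z2; linear_combination h
    rcases c.seg_free a1 d1.symm k1 (hk2.rot) with h | h | h
    · exact a2 h
    · exact a3 h
    · have := c.clear_mono a1 a2 a3 h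
      apply c.cyc.2.2.1 (i - 2)
      rw [← this, ← hcol]
      congr 2; ring
  rcases quad hop (c.gp _ _ _ k3.symm d2.symm k1) (c.gp _ _ _ k3.symm d3.symm k2) with
    ⟨z, hz1, hz2⟩ | h | h
  · exfalso
    have hik : Clear γ i k := by
      intro p hp l hl
      rcases through hz1 hz2 hp with h | h | h
      · rw [h] at hl; exact hcl z hz2 l hl
      · exact hE p h ⟨l, hl⟩
      · exact hk2 p h ⟨l, hl⟩
    have m1 := c.clear_mono k3.symm k2 (by intro h; apply k1; linear_combination -h) hik
    have a2 : k ≠ i - 1 + 1 := by intro h; apply k3; linear_combination h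
    have a3 : i - 1 ≠ k + 1 := by intro h; apply k5; linear_combination -h
    rcases c.seg_free k1.symm d1 k2 (hk2.rot.rot.swap) with h | h | h
    · exact a2 h
    · exact a3 h
    · have m2 := c.clear_mono k1.symm a2 a3 h
      apply c.cyc.2.2.1 (i - 1)
      rw [m2, ← m1]
      congr 2; ring
  · right
    exact ⟨k, k1, k3, k2, k4, k5, hk2, h⟩
  · left
    exact ⟨k, k1, k3, k2, k4, k5, hk2, h⟩

lemma Ctx.nonhull (c : Ctx t φ γ) {i v1 v2 : ZMod t}
    (h : sideSign (γ i) (γ (i + 1)) (γ v1) * sideSign (γ i) (γ (i + 1)) (γ v2) < 0) :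
    Ear γ i ∧ Ear γ (i + 1) ∧ (XX γ i ∨ YY γ i) := by
  obtain ⟨z1, z2, z3, z4, z5⟩ := zne' c.ht
  have nv : ∀ v, sideSign (γ i) (γ (i + 1)) (γ v) ≠ 0 → v ≠ i ∧ v ≠ i + 1 := by
    intro v hv
    constructor
    · rintro rfl; exact hv (ss_self1 _ _)
    · rintro rfl; exact hv (ss_self2 _ _)
  have n1 : sideSign (γ i) (γ (i + 1)) (γ v1) ≠ 0 := by intro h0; rw [h0] at h; simp at h
  have n2 : sideSign (γ i) (γ (i + 1)) (γ v2) ≠ 0 := by intro h0; rw [h0] at h; simp at h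
  have key : ∀ a b p q : ℝ, a * b < 0 → 0 < a * p → 0 < b * q → p * q < 0 := by
    intro a b p q h1 h2 h3
    have : 0 < (a * p) * (b * q) := mul_pos h2 h3
    by_contra hc
    push Not at hc
    nlinarith
  have both : Ear γ i ∧ Ear γ (i + 1) ∧
      sideSign (γ i) (γ (i + 1)) (γ (i - 1)) * sideSign (γ i) (γ (i + 1)) (γ (i + 2)) < 0 := by
    rcases c.F1 i v1 (nv _ n1).1 (nv _ n1).2 with ⟨a1, a2⟩ | ⟨a1, a2⟩ <;>
    rcases c.F1 i v2 (nv _ n2).1 (nv _ n2).2 with ⟨b1, b2⟩ | ⟨b1, b2⟩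
    · have := key _ _ _ _ h a1 b1
      nlinarith [mul_self_nonneg (sideSign (γ i) (γ (i + 1)) (γ (i - 1)))]
    · exact ⟨a2, b2, key _ _ _ _ h a1 b1⟩
    · refine ⟨b2, a2, ?_⟩
      rw [mul_comm]; exact key _ _ _ _ h a1 b1
    · have := key _ _ _ _ h a1 b1
      nlinarith [mul_self_nonneg (sideSign (γ i) (γ (i + 1)) (γ (i + 2)))]
  obtain ⟨e1, e2, hop⟩ := both
  refine ⟨e1, e2, ?_⟩
  have d1 : i - 1 ≠ i + 2 := by intro h; apply z3; linear_combination -h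
  have d2 : i - 1 ≠ i := by intro h; apply z1; linear_combination -h
  have d3 : i - 1 ≠ i + 1 := by intro h; apply z2; linear_combination -h
  have d4 : i + 2 ≠ i := by intro h; apply z2; linear_combination h
  have d5 : i + 2 ≠ i + 1 := by intro h; apply z1; linear_combination h
  rcases quad hop (c.gp _ _ _ d1 d2 d4) (c.gp _ _ _ d1 d3 d5) with ⟨z, hz1, hz2⟩ | h | h
  · exfalso
    have ht := c.ht
    have e0 : i + 2 + ((t - 3 : ℕ) : ZMod t) = i - 1 := by
      have : ((t - 3 : ℕ) : ZMod t) = -3 := by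
        rw [Nat.cast_sub (by omega)]; simp
      rw [this]; ring
    refine c.no_close (i + 2) (t - 3) (by omega) (by omega) ?_ ?_
    · rw [e0, c.ear_col e1]
      have := c.cyc.2.2.1 (i + 1)
      rwa [show i + 1 + 1 = i + 2 by ring] at this
    · rw [e0]
      intro p hp k hk hpk
      rcases through hz1 hz2 hp with h | h | h
      · rw [h] at hpk
        have h6 := c.open_edge hz2 hpk
        have : ((k + 2 : ℕ) : ZMod t) = 0 := by push_cast; linear_combination h6
        exact zne (k + 2) (by omega) (by omega) this
      · exact e1 p h.swap ⟨_, hpk⟩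
      · refine e2 p ?_ ⟨_, hpk⟩
        rw [show i + 1 - 1 = i by ring, show i + 1 + 1 = i + 2 by ring]
        exact h
  · left; exact h
  · right; exact h

lemma Ctx.N1 (c : Ctx t φ γ) {j k : ZMod t} (h : NonExt γ j) (hk : k ≠ j) :
    ∃ v1 v2, sideSign (γ j) (γ k) (γ v1) * sideSign (γ j) (γ k) (γ v2) < 0 := by
  obtain ⟨a, b, d, hab, had, hbd, haj, hbj, hdj, x, y, z, hx, hy, hz, hs, he⟩ := h
  have e := ss_comb3 (γ j) (γ k) (γ a) (γ b) (γ d) x y z hs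
  rw [← he, ss_self1] at e
  have n : ∀ r, r ≠ j → r ≠ k → sideSign (γ j) (γ k) (γ r) ≠ 0 :=
    fun r h1 h2 => c.gp _ _ _ hk.symm h1.symm h2.symm
  by_contra hcon
  push Not at hcon
  have h1 := hcon a b
  have h2 := hcon a d
  have h3 := hcon b d
  by_cases hak : a = k
  · have := n b hbj (by rw [← hak]; exact hab.symm)
    have h5 : 0 < sideSign (γ j) (γ k) (γ b) ^ 2 := by positivity
    have : x * (sideSign (γ j) (γ k) (γ a) * sideSign (γ j) (γ k) (γ b)) +
      y * (sideSign (γ j) (γ k) (γ b)) ^ 2 +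
      z * (sideSign (γ j) (γ k) (γ b) * sideSign (γ j) (γ k) (γ d)) = 0 := by
      linear_combination -sideSign (γ j) (γ k) (γ b) * e
    nlinarith [mul_pos hy h5, mul_nonneg hx.le h1, mul_nonneg hz.le h3]
  · have := n a haj hak
    have h5 : 0 < sideSign (γ j) (γ k) (γ a) ^ 2 := by positivity
    have : y * (sideSign (γ j) (γ k) (γ a) * sideSign (γ j) (γ k) (γ b)) +
      x * (sideSign (γ j) (γ k) (γ a)) ^ 2 +
      z * (sideSign (γ j) (γ k) (γ a) * sideSign (γ j) (γ k) (γ d)) = 0 := by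
      linear_combination -sideSign (γ j) (γ k) (γ a) * e
    nlinarith [mul_pos hx h5, mul_nonneg hy.le h1, mul_nonneg hz.le h2]

lemma Ctx.nonhull_l (c : Ctx t φ γ) {i : ZMod t} (h : NonExt γ i) :
    Ear γ i ∧ Ear γ (i + 1) ∧ (XX γ i ∨ YY γ i) := by
  have z1 := (zne' c.ht).1
  obtain ⟨v1, v2, h1⟩ := c.N1 (k := i + 1) h (by intro h; apply z1; linear_combination h)
  exact c.nonhull h1

lemma Ctx.nonhull_r (c : Ctx t φ γ) {i : ZMod t} (h : NonExt γ (i + 1)) :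
    Ear γ i ∧ Ear γ (i + 1) ∧ (XX γ i ∨ YY γ i) := by
  have z1 := (zne' c.ht).1
  obtain ⟨v1, v2, h1⟩ := c.N1 (k := i) h (by intro h; apply z1; linear_combination -h)
  rw [ss_swap, ss_swap _ _ (γ v2), neg_mul_neg] at h1
  exact c.nonhull h1

lemma opp_pick {a b p : ℝ} (h : a * b < 0) (hp : p ≠ 0) : a * p < 0 ∨ b * p < 0 := by
  by_contra hc
  push Not at hc
  have hp2 : 0 < p ^ 2 := by positivity
  nlinarith [mul_nonneg hc.1 hc.2]

lemma Ctx.RL_r (c : Ctx t φ γ) {i : ZMod t} (h : NonExt γ (i + 1)) : RR γ i ∨ LL γ i := by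
  obtain ⟨z1, z2, z3, z4, z5⟩ := zne' c.ht
  have d1 : i - 1 ≠ i + 1 := by intro h; apply z2; linear_combination -h
  have d2 : i - 1 ≠ i := by intro h; apply z1; linear_combination -h
  have d3 : i + 1 ≠ i := by intro h; apply z1; linear_combination h
  obtain ⟨v1, v2, h1⟩ := c.N1 (k := i - 1) h d1
  rw [ss_swap, ss_swap _ _ (γ v2), neg_mul_neg] at h1
  rcases opp_pick h1 (c.gp (i - 1) (i + 1) i d1 d2 d3) with h2 | h2
  · exact c.F2 (c.nonhull_r h).1 h2
  · exact c.F2 (c.nonhull_r h).1 h2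

lemma Ctx.RL_l (c : Ctx t φ γ) {i : ZMod t} (h : NonExt γ (i - 1)) : RR γ i ∨ LL γ i := by
  obtain ⟨z1, z2, z3, z4, z5⟩ := zne' c.ht
  have d1 : i - 1 ≠ i + 1 := by intro h; apply z2; linear_combination -h
  have d2 : i - 1 ≠ i := by intro h; apply z1; linear_combination -h
  have d3 : i + 1 ≠ i := by intro h; apply z1; linear_combination h
  have hE : Ear γ i := by
    have := (c.nonhull_l h).2.1
    rwa [sub_add_cancel] at this
  obtain ⟨v1, v2, h1⟩ := c.N1 (k := i + 1) h d1.symm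
  rcases opp_pick h1 (c.gp (i - 1) (i + 1) i d1 d2 d3) with h2 | h2
  · exact c.F2 hE h2
  · exact c.F2 hE h2

end CaseB2

section CaseB3

variable {t : ℕ} {φ : Pt → ℕ} {γ : ZMod t → Pt}

lemma RR_ne (c : Ctx t φ γ) {i : ZMod t} (h : RR γ i) : NonExt γ (i + 1) := by
  obtain ⟨z1, z2, z3, z4, z5⟩ := zne' c.ht
  obtain ⟨k, k1, k2, k3, k4, k5, hT, hI⟩ := h
  exact ⟨i, i - 1, k, by intro h; apply z1; linear_combination h, k2.symm, k1.symm,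
    by intro h; apply z1; linear_combination -h, by intro h; apply z2; linear_combination -h, k3, hI⟩

lemma Ctx.RY (c : Ctx t φ γ) {i : ZMod t} (h : RR γ i) : YY γ (i + 1) := by
  obtain ⟨z1, z2, z3, z4, z5⟩ := zne' c.ht
  have hne := RR_ne c h
  obtain ⟨k, k1, k2, k3, k4, k5, hT, hI⟩ := h
  have E0 := (c.nonhull_r hne).1
  obtain ⟨E1, E2, hXY⟩ := c.nonhull_l hne
  refine hXY.resolve_left fun hX => ?_
  unfold XX at hX
  have e1 : i + 1 - 1 = i := by ring
  have e2 : i + 1 + 1 = i + 2 := by ring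
  have e3 : i + 1 + 2 = i + 3 := by ring
  have e4 : i + 2 - 1 = i + 1 := by ring
  have e5 : i + 2 + 1 = i + 3 := by ring
  unfold Ear at E0 E2
  rw [e2, e4, e5] at E2
  rw [e1, e2, e3] at hX
  have edge : ∀ e : ℝ, 0 < e → e ≤ 1 → OnC γ ((1 - e) • γ (i + 1) + e • γ (i + 2)) := by
    intro e h1 h2
    refine ⟨i + 1, ?_⟩
    unfold Ed
    rw [e2]
    exact mem_seg.2 ⟨_, _, by linarith, h1.le, by ring, rfl⟩
  have n1 : i + 1 ≠ i := by intro h; apply z1; linear_combination h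
  have n2 : i + 1 ≠ i + 2 := by intro h; apply z1; linear_combination -h
  have n3 : i + 1 ≠ i - 1 := by intro h; apply z2; linear_combination h
  have n4 : i ≠ i + 2 := by intro h; apply z2; linear_combination -h
  have n5 : i - 1 ≠ i + 2 := by intro h; apply z3; linear_combination -h
  have n6 : i + 1 ≠ i + 3 := by intro h; apply z2; linear_combination -h
  have n7 : i + 2 ≠ i + 3 := by intro h; apply z1; linear_combination -h
  obtain ⟨A, B, hA, hB, hx⟩ := cone_geo hI hX (c.gp _ _ _ n1 n2 n4) (c.gp _ _ _ n3 n2 n5)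
    (c.gp _ _ _ k3.symm n2 k4) (c.gp _ _ _ n1 k3.symm k2.symm)
    (by
      rintro ⟨h1, h2⟩
      obtain ⟨e, h3, h4, h5⟩ := cone_emit h1 h2
      exact hT _ h5.swap (edge e h3 h4))
    (by
      rintro ⟨h1, h2⟩
      obtain ⟨e, h3, h4, h5⟩ := cone_emit h1 h2
      exact E0 _ h5.swap.rot.rot (edge e h3 h4))
  have hS : (1 - A - B) + A + B = 1 := by ring
  have k6 : k ≠ i + 3 := by
    rintro rfl
    have := ss_comb3 (γ (i + 3)) (γ (i + 1)) (γ (i + 1)) (γ (i + 2)) (γ (i + 3)) _ _ _ hS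
    rw [← hx, ss_self1, ss_self2] at this
    have h0 := c.gp (i + 3) (i + 1) (i + 2) n6.symm n7.symm n2
    have : A * sideSign (γ (i + 3)) (γ (i + 1)) (γ (i + 2)) = 0 := by linarith
    exact (mul_ne_zero hA.ne' h0) this
  rcases lt_trichotomy (A + B) 1 with h | h | h
  · exact E2 (γ k) ⟨_, _, _, by linarith, hA, hB, hS, hx⟩ ⟨k, left_mem_segment ℝ _ _⟩
  · have := ss_comb3 (γ (i + 2)) (γ (i + 3)) (γ (i + 1)) (γ (i + 2)) (γ (i + 3)) _ _ _ hS
    rw [← hx, ss_self1, ss_self2] at this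
    apply c.gp (i + 2) (i + 3) k n7 k4.symm k6.symm
    rw [this, show 1 - A - B = 0 by linarith]; ring
  · have hp : 0 < A + B := by linarith
    have hi : (A + B)⁻¹ < 1 := inv_lt_one_of_one_lt₀ h
    rcases c.seg_free k3.symm n3 k1 hT.rot with h1 | h1 | h1
    · rw [e2] at h1; exact k4 h1
    · apply k2; linear_combination -h1
    · refine h1 ((1 - (A + B)⁻¹) • γ (i + 1) + (A + B)⁻¹ • γ k)
        (mem_oseg.2 ⟨_, _, by linarith, by positivity, by ring, rfl⟩) (i + 2) ?_
      unfold Ed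
      rw [e5]
      refine mem_seg.2 ⟨A / (A + B), B / (A + B), by positivity, by positivity, by field_simp, ?_⟩
      rw [hx]
      have e : (1 - (A + B)⁻¹) + (A + B)⁻¹ * (1 - A - B) = 0 := by field_simp; ring
      have : (1 - (A + B)⁻¹) • γ (i + 1) + (A + B)⁻¹ • ((1 - A - B) • γ (i + 1) + A • γ (i + 2) + B • γ (i + 3))
        = ((1 - (A + B)⁻¹) + (A + B)⁻¹ * (1 - A - B)) • γ (i + 1) + (A / (A + B)) • γ (i + 2) + (B / (A + B)) • γ (i + 3) := by
        simp only [div_eq_mul_inv]; module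
      rw [this, e]; simp

lemma YY_ne (c : Ctx t φ γ) {i : ZMod t} (h : YY γ i) : NonExt γ (i + 1) := by
  obtain ⟨z1, z2, z3, z4, z5⟩ := zne' c.ht
  exact ⟨i - 1, i, i + 2, by intro h; apply z1; linear_combination -h,
    by intro h; apply z3; linear_combination -h, by intro h; apply z2; linear_combination -h,
    by intro h; apply z2; linear_combination -h, by intro h; apply z1; linear_combination -h,
    by intro h; apply z1; linear_combination h, h⟩

lemma XX_ne (c : Ctx t φ γ) {i : ZMod t} (h : XX γ i) : NonExt γ i := by
  obtain ⟨z1, z2, z3, z4, z5⟩ := zne' c.ht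
  exact ⟨i - 1, i + 1, i + 2, by intro h; apply z2; linear_combination -h,
    by intro h; apply z3; linear_combination -h, by intro h; apply z1; linear_combination -h,
    by intro h; apply z1; linear_combination -h, by intro h; apply z1; linear_combination h,
    by intro h; apply z2; linear_combination h, h⟩

lemma XY_excl (c : Ctx t φ γ) {i : ZMod t} (h : XX γ i) (h' : YY γ i) : False := by
  obtain ⟨z1, z2, z3, z4, z5⟩ := zne' c.ht
  obtain ⟨x, y, z, hx, hy, hz, hs, e⟩ := h
  obtain ⟨x', y', z', hx', hy', hz', hs', e'⟩ := h'
  have g := c.gp (i - 1) (i + 2) i (by intro h; apply z3; linear_combination -h)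
    (by intro h; apply z1; linear_combination -h) (by intro h; apply z2; linear_combination h)
  have q := ss_comb3 (γ (i - 1)) (γ (i + 2)) (γ (i - 1)) (γ (i + 1)) (γ (i + 2)) x y z hs
  have q' := ss_comb3 (γ (i - 1)) (γ (i + 2)) (γ (i - 1)) (γ i) (γ (i + 2)) x' y' z' hs'
  rw [← e, ss_self1, ss_self2] at q
  rw [← e', ss_self1, ss_self2] at q'
  generalize sideSign (γ (i - 1)) (γ (i + 2)) (γ i) = a at *
  generalize sideSign (γ (i - 1)) (γ (i + 2)) (γ (i + 1)) = b at *
  have q1 : a = y * b := by linarith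
  have q2 : b = y' * a := by linarith
  have : (1 - y * y') * a = 0 := by rw [q2] at q1; linear_combination q1
  rcases mul_eq_zero.1 this with h | h
  · nlinarith
  · exact g h

lemma NonExt_rev {j : ZMod t} (h : NonExt (fun i => γ (-i)) j) : NonExt γ (-j) := by
  obtain ⟨a, b, c, h1, h2, h3, h4, h5, h6, h7⟩ := h
  exact ⟨-a, -b, -c, by simpa using h1, by simpa using h2, by simpa using h3, by simpa using h4,
    by simpa using h5, by simpa using h6, h7⟩

lemma OnC_rev {p : Pt} (h : OnC γ p) : OnC (fun i => γ (-i)) p := by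
  obtain ⟨k, hk⟩ := h
  refine ⟨-k - 1, ?_⟩
  have := Ed_rev γ (-k - 1)
  rw [this]
  convert hk using 2; ring

lemma OnC_rev' {p : Pt} (h : OnC (fun i => γ (-i)) p) : OnC γ p := by
  obtain ⟨k, hk⟩ := h
  rw [Ed_rev] at hk
  exact ⟨_, hk⟩

lemma LL_rev {i : ZMod t} (h : LL γ i) : RR (fun i => γ (-i)) (-i) := by
  obtain ⟨k, k1, k2, k3, k4, k5, hT, hI⟩ := h
  refine ⟨-k, ?_, ?_, ?_, ?_, ?_, ?_, ?_⟩
  · intro h; apply k3; linear_combination -h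
  · intro h; apply k2; linear_combination -h
  · intro h; apply k1; linear_combination -h
  · intro h; apply k5; linear_combination -h
  · intro h; apply k4; linear_combination -h
  · have e1 : -(-i - 1) = i + 1 := by ring
    have e2 : -(-i + 1) = i - 1 := by ring
    intro p hp ho
    simp only [e1, e2, neg_neg] at hp
    exact hT p hp.swap (OnC_rev' ho)
  · have e1 : -(-i - 1) = i + 1 := by ring
    have e2 : -(-i + 1) = i - 1 := by ring
    simp only [e1, e2, neg_neg]
    exact hI

lemma RR_rev {i : ZMod t} (h : RR γ i) : LL (fun i => γ (-i)) (-i) := by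
  obtain ⟨k, k1, k2, k3, k4, k5, hT, hI⟩ := h
  refine ⟨-k, ?_, ?_, ?_, ?_, ?_, ?_, ?_⟩
  · intro h; apply k3; linear_combination -h
  · intro h; apply k2; linear_combination -h
  · intro h; apply k1; linear_combination -h
  · intro h; apply k5; linear_combination -h
  · intro h; apply k4; linear_combination -h
  · have e1 : -(-i - 1) = i + 1 := by ring
    have e2 : -(-i + 1) = i - 1 := by ring
    intro p hp ho
    simp only [e1, e2, neg_neg] at hp
    exact hT p hp.swap (OnC_rev' ho)
  · have e1 : -(-i - 1) = i + 1 := by ring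
    have e2 : -(-i + 1) = i - 1 := by ring
    simp only [e1, e2, neg_neg]
    exact hI

lemma LL_ne (c : Ctx t φ γ) {i : ZMod t} (h : LL γ i) : NonExt γ (i - 1) := by
  have := NonExt_rev (RR_ne c.rev (LL_rev h))
  rwa [show -(-i + 1) = i - 1 by ring] at this

lemma Ctx.LX (c : Ctx t φ γ) {i : ZMod t} (h : LL γ i) : XX γ (i - 2) := by
  have := c.rev.RY (LL_rev h)
  unfold YY at this
  simp only [show -(-i + 1 - 1) = i by ring, show -(-i + 1) = i - 1 by ring,
    show -(-i + 1 + 2) = i - 3 by ring, show -(-i + 1 + 1) = i - 2 by ring] at this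
  unfold XX
  rw [show i - 2 - 1 = i - 3 by ring, show i - 2 + 1 = i - 1 by ring, show i - 2 + 2 = i by ring]
  exact this.swap.rot.rot

lemma Ctx.RRstep (c : Ctx t φ γ) {i : ZMod t} (h : RR γ i) : RR γ (i + 3) := by
  have hy := c.RY h
  have hn := YY_ne c hy
  rcases c.RL_l (i := i + 3) (by rwa [show i + 3 - 1 = i + 1 + 1 by ring]) with h1 | h1
  · exact h1
  · exfalso
    have := c.LX h1
    rw [show i + 3 - 2 = i + 1 by ring] at this
    exact XY_excl c this hy

lemma Ctx.RRn (c : Ctx t φ γ) {i : ZMod t} (h : RR γ i) (n : ℕ) : RR γ (i + 3 * n) := by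
  induction n with
  | zero => simpa using h
  | succ n ih =>
    have := c.RRstep ih
    rwa [show i + 3 * (n : ZMod t) + 3 = i + 3 * ((n + 1 : ℕ) : ZMod t) by push_cast; ring] at this

lemma Ctx.RRz (c : Ctx t φ γ) {i : ZMod t} (h : RR γ i) (n : ZMod t) : RR γ (i + 3 * n) := by
  have := c.nz
  have := c.RRn h n.val
  rwa [ZMod.natCast_zmod_val] at this

lemma Ctx.LLz (c : Ctx t φ γ) {i : ZMod t} (h : LL γ i) (n : ZMod t) : LL γ (i - 3 * n) := by
  have := RR_rev (c.rev.RRz (LL_rev h) n)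
  simp only [neg_neg] at this
  rwa [show -(-i + 3 * n) = i - 3 * n by ring] at this

lemma Ctx.N2 (c : Ctx t φ γ) (h : ∀ j, NonExt γ j) : False := by
  have := c.nz
  obtain ⟨m, -, hm⟩ := Finset.exists_max_image (univ : Finset (ZMod t)) (fun i => (γ i).1) ⟨0, mem_univ _⟩
  obtain ⟨a, b, d, hab, had, hbd, haj, hbj, hdj, x, y, z, hx, hy, hz, hs, he⟩ := h m
  have h1 := hm a (mem_univ _)
  have h2 := hm b (mem_univ _)
  have h3 := hm d (mem_univ _)
  have e : (γ m).1 = x * (γ a).1 + y * (γ b).1 + z * (γ d).1 := by rw [he]; simp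
  have e5 : x * ((γ m).1 - (γ a).1) + y * ((γ m).1 - (γ b).1) + z * ((γ m).1 - (γ d).1) = 0 := by
    linear_combination (γ m).1 * hs + e
  have i1 : (γ a).1 = (γ m).1 := by
    by_contra hne
    have : (γ a).1 < (γ m).1 := lt_of_le_of_ne h1 hne
    nlinarith [mul_pos hx (sub_pos.2 this), mul_nonneg hy.le (sub_nonneg.2 h2), mul_nonneg hz.le (sub_nonneg.2 h3)]
  have i2 : (γ b).1 = (γ m).1 := by
    by_contra hne
    have : (γ b).1 < (γ m).1 := lt_of_le_of_ne h2 hne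
    nlinarith [mul_pos hy (sub_pos.2 this), mul_nonneg hx.le (sub_nonneg.2 h1), mul_nonneg hz.le (sub_nonneg.2 h3)]
  apply c.gp m a b haj.symm hbj.symm hab
  unfold sideSign
  rw [i1, i2]; ring

lemma Ctx.no_R (c : Ctx t φ γ) {i : ZMod t} (h : RR γ i) : False := by
  have n1 : ∀ n : ZMod t, NonExt γ (i + 3 * n + 1) := fun n => RR_ne c (c.RRz h n)
  have n2 : ∀ n : ZMod t, NonExt γ (i + 3 * n + 2) := fun n => by
    have := YY_ne c (c.RY (c.RRz h n))
    rwa [show i + 3 * n + 1 + 1 = i + 3 * n + 2 by ring] at this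
  have n0 : ∀ n : ZMod t, NonExt γ (i + 3 * n) := by
    have h2 := n2 0
    rw [show i + 3 * 0 + 2 = (i + 1) + 1 by ring] at h2
    rcases c.RL_r h2 with h1 | h1
    · intro n
      have := YY_ne c (c.RY (c.RRz h1 (n - 1)))
      rwa [show i + 1 + 3 * (n - 1) + 1 + 1 = i + 3 * n by ring] at this
    · intro n
      have := LL_ne c (c.LLz h1 (-n))
      rwa [show i + 1 - 3 * (-n) - 1 = i + 3 * n by ring] at this
  apply c.N2
  intro j
  have := c.nz
  have hj : j = i + ((j - i).val : ZMod t) := by rw [ZMod.natCast_zmod_val]; ring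
  have hd := Nat.div_add_mod (j - i).val 3
  have hlt := Nat.mod_lt (j - i).val (show 3 > 0 by norm_num)
  generalize (j - i).val = v at *
  obtain ⟨r, hr⟩ : ∃ r, r = v % 3 := ⟨_, rfl⟩
  have hjj : j = i + 3 * ((v / 3 : ℕ) : ZMod t) + (r : ZMod t) := by
    rw [hj, hr]; nth_rewrite 1 [← hd]; push_cast; ring
  rw [hjj]
  have : r = 0 ∨ r = 1 ∨ r = 2 := by omega
  rcases this with rfl | rfl | rfl
  · simpa using n0 _
  · simpa using n1 _
  · simpa using n2 _

lemma Ctx.no_L (c : Ctx t φ γ) {i : ZMod t} (h : LL γ i) : False := c.rev.no_R (LL_rev h)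

theorem Ctx.false (c : Ctx t φ γ) : False := by
  obtain ⟨z1, z2, z3, z4, z5⟩ := zne' c.ht
  by_cases hh : ∃ i v1 v2, sideSign (γ i) (γ (i + 1)) (γ v1) * sideSign (γ i) (γ (i + 1)) (γ v2) < 0
  · obtain ⟨i, v1, v2, h⟩ := hh
    have hn : ∃ j, NonExt γ j := by
      rcases (c.nonhull h).2.2 with h | h
      · exact ⟨_, XX_ne c h⟩
      · exact ⟨_, YY_ne c h⟩
    obtain ⟨j, hj⟩ := hn
    rcases c.RL_r (i := j - 1) (by rwa [sub_add_cancel]) with h | h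
    · exact c.no_R h
    · exact c.no_L h
  · push Not at hh
    have hE : ∃ j, Ear γ j := by
      rcases c.F1 0 2 z2 (by intro h; apply z1; linear_combination h) with h | h
      · exact ⟨_, h.2⟩
      · exact ⟨_, h.2⟩
    obtain ⟨j, hE⟩ := hE
    have d1 : j - 1 ≠ j + 1 := by intro h; apply z2; linear_combination -h
    have d2 : j - 1 ≠ j := by intro h; apply z1; linear_combination -h
    have d3 : j + 1 ≠ j := by intro h; apply z1; linear_combination h
    have d4 : j - 1 ≠ j + 2 := by intro h; apply z3; linear_combination -h
    have d5 : j + 1 ≠ j + 2 := by intro h; apply z1; linear_combination -h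
    have d6 : j ≠ j + 2 := by intro h; apply z2; linear_combination -h
    have s1 := hh (j - 1) (j + 1) (j + 2)
    rw [sub_add_cancel] at s1
    have s2 := hh j (j - 1) (j + 2)
    have g1 := c.gp (j - 1) (j + 1) (j + 2) d1 d4 d5
    have g2 := c.gp (j - 1) (j + 1) j d1 d2 d3
    have g3 := c.gp (j - 1) j (j + 2) d2 d4 d6
    have g4 := c.gp j (j + 1) (j + 2) d3.symm d6 d5
    have hv : sideSign (γ (j - 1)) (γ (j + 1)) (γ (j + 2)) * sideSign (γ (j - 1)) (γ (j + 1)) (γ j) < 0 := by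
      by_contra hcon
      have hp : 0 < sideSign (γ (j - 1)) (γ (j + 1)) (γ (j + 2)) * sideSign (γ (j - 1)) (γ (j + 1)) (γ j) :=
        lt_of_le_of_ne (not_lt.1 hcon) (mul_ne_zero g1 g2).symm
      have e1 : sideSign (γ (j - 1)) (γ (j + 1)) (γ j) = - sideSign (γ (j - 1)) (γ j) (γ (j + 1)) := ss_swap' _ _ _
      have e2 : sideSign (γ j) (γ (j + 1)) (γ (j - 1)) = sideSign (γ (j - 1)) (γ j) (γ (j + 1)) := (ss_cyc _ _ _).symm
      have g5 : sideSign (γ (j - 1)) (γ j) (γ (j + 1)) ≠ 0 := by rw [e1] at g2; simpa using g2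
      have p1 := lt_of_le_of_ne s1 (mul_ne_zero g5 g3).symm
      rw [e2] at s2
      have p2 := lt_of_le_of_ne s2 (mul_ne_zero g5 g4).symm
      refine hE (γ (j + 2)) (inTri_of_pos ?_ ?_ ?_) ⟨j + 2, left_mem_segment ℝ _ _⟩
      · linarith
      · rw [ss_swap (γ (j + 1)) (γ (j - 1))]; rw [e1] at hp; linarith
      · linarith
    rcases c.F2 hE hv with h | h
    · exact c.no_R h
    · exact c.no_L h

end CaseB3

structure Ang (o : Pt) (θ : Pt → ℝ) : Prop where
  rng : ∀ x, -Real.pi < θ x ∧ θ x ≤ Real.pi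
  ray : ∀ x (s : ℝ), 0 < s → θ ((1 - s) • o + s • x) = θ x
  sn : ∀ x y, x ≠ o → y ≠ o → ∃ R : ℝ, 0 < R ∧ sideSign o x y = R * Real.sin (θ y - θ x)

lemma exists_angle (o e : Pt) (he : e ≠ 0) :
    ∃ θ, Ang o θ ∧ θ (o + e) = 0 ∧ θ (o - e) = Real.pi := by
  have hE : 0 < e.1 ^ 2 + e.2 ^ 2 := by
    by_contra h
    apply he
    have h1 : e.1 = 0 := by nlinarith [sq_nonneg e.1, sq_nonneg e.2]
    have h2 : e.2 = 0 := by nlinarith [sq_nonneg e.1, sq_nonneg e.2]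
    exact Prod.ext h1 h2
  let T : Pt → ℂ := fun x => ⟨e.1 * (x.1 - o.1) + e.2 * (x.2 - o.2),
    e.1 * (x.2 - o.2) - e.2 * (x.1 - o.1)⟩
  have T0 : ∀ x, x ≠ o → T x ≠ 0 := by
    intro x hx h
    have h1 : e.1 * (x.1 - o.1) + e.2 * (x.2 - o.2) = 0 := congrArg Complex.re h
    have h2 : e.1 * (x.2 - o.2) - e.2 * (x.1 - o.1) = 0 := congrArg Complex.im h
    apply hx
    have a1 : (e.1 ^ 2 + e.2 ^ 2) * (x.1 - o.1) = 0 := by linear_combination e.1 * h1 - e.2 * h2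
    have a2 : (e.1 ^ 2 + e.2 ^ 2) * (x.2 - o.2) = 0 := by linear_combination e.2 * h1 + e.1 * h2
    have b1 := (mul_eq_zero.1 a1).resolve_left hE.ne'
    have b2 := (mul_eq_zero.1 a2).resolve_left hE.ne'
    exact Prod.ext (by linarith) (by linarith)
  refine ⟨fun x => (T x).arg, ⟨?_, ?_, ?_⟩, ?_, ?_⟩
  · intro x
    exact ⟨Complex.neg_pi_lt_arg _, Complex.arg_le_pi _⟩
  · intro x s hs
    have : T ((1 - s) • o + s • x) = (s : ℂ) * T x := by
      apply Complex.ext <;> simp [T] <;> ring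
    show (T ((1 - s) • o + s • x)).arg = (T x).arg
    rw [this, Complex.arg_real_mul _ hs]
  · intro x y hx hy
    have nx := norm_pos_iff.2 (T0 x hx)
    have ny := norm_pos_iff.2 (T0 y hy)
    refine ⟨‖T x‖ * ‖T y‖ / (e.1 ^ 2 + e.2 ^ 2), by positivity, ?_⟩
    have c1 := Complex.norm_mul_cos_arg (T x)
    have c2 := Complex.norm_mul_sin_arg (T x)
    have c3 := Complex.norm_mul_cos_arg (T y)
    have c4 := Complex.norm_mul_sin_arg (T y)
    have : ‖T x‖ * ‖T y‖ * Real.sin ((T y).arg - (T x).arg) = (e.1 ^ 2 + e.2 ^ 2) * sideSign o x y := by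
      rw [Real.sin_sub]
      have : ‖T x‖ * ‖T y‖ * (Real.sin (T y).arg * Real.cos (T x).arg - Real.cos (T y).arg * Real.sin (T x).arg)
        = (T y).im * (T x).re - (T y).re * (T x).im := by
        rw [← c1, ← c2, ← c3, ← c4]; ring
      rw [this]
      simp only [T, sideSign]; ring
    show sideSign o x y = ‖T x‖ * ‖T y‖ / (e.1 ^ 2 + e.2 ^ 2) * Real.sin ((T y).arg - (T x).arg)
    field_simp
    linarith
  · have : T (o + e) = ((e.1 ^ 2 + e.2 ^ 2 : ℝ) : ℂ) := by
      apply Complex.ext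
      · simp only [T, Complex.ofReal_re, Prod.fst_add, Prod.snd_add]; ring
      · simp only [T, Complex.ofReal_im, Prod.fst_add, Prod.snd_add]; ring
    show (T (o + e)).arg = 0
    rw [this]; exact Complex.arg_ofReal_of_nonneg hE.le
  · have : T (o - e) = ((-(e.1 ^ 2 + e.2 ^ 2) : ℝ) : ℂ) := by
      apply Complex.ext
      · simp only [T, Complex.ofReal_re, Prod.fst_sub, Prod.snd_sub]; ring
      · simp only [T, Complex.ofReal_im, Prod.fst_sub, Prod.snd_sub]; ring
    show (T (o - e)).arg = Real.pi
    rw [this]; exact Complex.arg_ofReal_of_neg (by linarith)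

lemma sin_range {x : ℝ} (h : 0 < Real.sin x) (h1 : -(2 * Real.pi) < x) (h2 : x < 2 * Real.pi) :
    (0 < x ∧ x < Real.pi) ∨ x < -Real.pi := by
  by_contra hc
  push Not at hc
  obtain ⟨a, b⟩ := hc
  rcases le_or_gt x 0 with h3 | h3
  · exact absurd (Real.sin_nonpos_of_nonpos_of_neg_pi_le h3 b) (by linarith)
  · have h4 := a h3
    have := Real.sin_nonneg_of_nonneg_of_le_pi (x := x - Real.pi) (by linarith) (by linarith)
    rw [Real.sin_sub_pi] at this
    linarith

lemma Ang.edge {o : Pt} {θ : Pt → ℝ} (A : Ang o θ) {x y z : Pt} (hx : x ≠ o) (hy : y ≠ o)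
    (h1 : θ x < θ y) (h2 : θ y < θ x + Real.pi) (hz : z ∈ segment ℝ x y) :
    z ≠ o ∧ θ x ≤ θ z ∧ θ z ≤ θ y ∧ (θ z = θ x → z = x) ∧ (θ z = θ y → z = y) := by
  obtain ⟨a, b, ha, hb, hab, rfl⟩ := mem_seg.1 hz
  rcases ha.eq_or_lt with h | ha
  · have : b = 1 := by linarith
    subst this; subst h
    simp only [zero_smul, one_smul, zero_add]
    exact ⟨hy, h1.le, le_rfl, fun h => absurd h h1.ne', fun _ => trivial⟩
  rcases hb.eq_or_lt with h | hb
  · have : a = 1 := by linarith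
    subst this; subst h
    simp only [zero_smul, one_smul, add_zero]
    exact ⟨hx, le_rfl, h1.le, fun _ => trivial, fun h => absurd h h1.ne⟩
  obtain ⟨R, hR, e⟩ := A.sn x y hx hy
  have hxy : 0 < sideSign o x y := by
    rw [e]; exact mul_pos hR (Real.sin_pos_of_pos_of_lt_pi (by linarith) (by linarith))
  have q1 := ss_comb2 o x x y a b hab
  rw [ss_self2] at q1
  have q2 := ss_comb2 o y x y a b hab
  rw [ss_self2, ss_swap' o y x] at q2
  generalize a • x + b • y = z at *
  have hz0 : z ≠ o := by
    rintro rfl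
    rw [ss_self1] at q1
    nlinarith [mul_pos hb hxy]
  obtain ⟨R1, hR1, e1⟩ := A.sn x z hx hz0
  obtain ⟨R2, hR2, e2⟩ := A.sn z y hz0 hy
  have s1 : 0 < Real.sin (θ z - θ x) := by
    have : 0 < R1 * Real.sin (θ z - θ x) := by rw [← e1, q1]; nlinarith [mul_pos hb hxy]
    exact (pos_iff_pos_of_mul_pos this).1 hR1
  have s2 : 0 < Real.sin (θ y - θ z) := by
    have : 0 < R2 * Real.sin (θ y - θ z) := by
      rw [← e2, ss_swap' o z y, q2]; nlinarith [mul_pos ha hxy]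
    exact (pos_iff_pos_of_mul_pos this).1 hR2
  have rx := A.rng x
  have ry := A.rng y
  have rz := A.rng z
  have := sin_range s1 (by linarith) (by linarith)
  have := sin_range s2 (by linarith) (by linarith)
  have k : θ x < θ z ∧ θ z < θ y := by
    rcases sin_range s1 (by linarith) (by linarith) with h3 | h3 <;>
    rcases sin_range s2 (by linarith) (by linarith) with h4 | h4 <;>
    constructor <;> linarith
  exact ⟨hz0, k.1.le, k.2.le, fun h => absurd h k.1.ne', fun h => absurd h k.2.ne⟩

lemma enum_sorted (Y : Finset Pt) (θ : Pt → ℝ) (hi : Set.InjOn θ Y) :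
    ∃ y : ℕ → Pt, (∀ k < Y.card, y k ∈ Y) ∧ (∀ k l, k < l → l < Y.card → θ (y k) < θ (y l)) ∧
      ∀ x ∈ Y, ∃ k < Y.card, y k = x := by
  have hc : (Y.image θ).card = Y.card := Finset.card_image_of_injOn hi
  let em := (Y.image θ).orderEmbOfFin hc
  have h1 : ∀ k : Fin Y.card, ∃ x ∈ Y, θ x = em k := by
    intro k
    have := (Y.image θ).orderEmbOfFin_mem hc k
    exact Finset.mem_image.1 this
  choose g hg1 hg2 using h1
  refine ⟨fun k => if h : k < Y.card then g ⟨k, h⟩ else 0, ?_, ?_, ?_⟩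
  · intro k hk; simp only [hk, dif_pos]; exact hg1 _
  · intro k l hkl hl
    have hk : k < Y.card := by omega
    simp only [hk, hl, dif_pos, hg2]
    exact em.strictMono hkl
  · intro x hx
    have : θ x ∈ Set.range em := by
      rw [Finset.range_orderEmbOfFin]; exact Finset.mem_image_of_mem θ hx
    obtain ⟨k, hk⟩ := this
    refine ⟨k, k.2, ?_⟩
    simp only [k.2, dif_pos]
    exact hi (hg1 _) hx (by rw [hg2]; exact hk)

lemma star (φ : Pt → ℕ) {o : Pt} {θ : Pt → ℝ} (A : Ang o θ) (Y : Finset Pt) (ho : o ∉ Y)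
    (hn : 2 ≤ Y.card) (hgen : ∀ x ∈ Y, ∀ y ∈ Y, x ≠ y → sideSign o x y ≠ 0)
    (hgap : ∀ x ∈ Y, ∀ y ∈ Y, θ x < θ y → θ x + Real.pi ≤ θ y → ∃ z ∈ Y, θ x < θ z ∧ θ z < θ y)
    (hc1 : ∀ x ∈ Y, (∀ y ∈ Y, θ x ≤ θ y) → φ x ≠ φ o)
    (hc2 : ∀ x ∈ Y, (∀ y ∈ Y, θ y ≤ θ x) → φ x ≠ φ o)
    (hc3 : ∀ x ∈ Y, ∀ y ∈ Y, θ x < θ y → (∀ z ∈ Y, ¬ (θ x < θ z ∧ θ z < θ y)) → φ x ≠ φ y) :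
    ∃ γ : ZMod (Y.card + 1) → Pt, IsPlaneCycle φ (Y.card + 1) γ ∧
      Set.range γ = insert o (Y : Set Pt) := by
  have ne : ∀ x ∈ Y, x ≠ o := by rintro x hx rfl; exact ho hx
  have hi : Set.InjOn θ Y := by
    intro x hx y hy h
    by_contra hxy
    obtain ⟨R, hR, e⟩ := A.sn x y (ne x hx) (ne y hy)
    apply hgen x hx y hy hxy
    rw [e, h]; simp
  obtain ⟨y, y1, y2, y3⟩ := enum_sorted Y θ hi
  generalize hN : Y.card = n at *
  have ym : ∀ k l, k ≤ l → l < n → θ (y k) ≤ θ (y l) := by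
    intro k l h1 h2
    rcases h1.eq_or_lt with rfl | h
    · exact le_rfl
    · exact (y2 k l h h2).le
  have ylt : ∀ k l, k < n → l < n → θ (y k) ≤ θ (y l) → k ≤ l := by
    intro k l hk hl h
    by_contra hc
    have := y2 l k (by omega) hk
    linarith
  have yinj : ∀ k l, k < n → l < n → y k = y l → k = l := by
    intro k l hk hl h
    have h1 := ylt k l hk hl (by rw [h])
    have h2 := ylt l k hl hk (by rw [h])
    omega
  have nob : ∀ k, k + 1 < n → ∀ z ∈ Y, ¬ (θ (y k) < θ z ∧ θ z < θ (y (k + 1))) := by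
    rintro k hk z hz ⟨h1, h2⟩
    obtain ⟨j, hj, rfl⟩ := y3 z hz
    have a1 : ¬ j ≤ k := fun h => by have := ym j k h (by omega); linarith
    have a2 : ¬ k + 1 ≤ j := fun h => by have := ym (k + 1) j h (by omega); linarith
    omega
  have edge : ∀ k, k + 1 < n → ∀ z ∈ segment ℝ (y k) (y (k + 1)),
      z ≠ o ∧ θ (y k) ≤ θ z ∧ θ z ≤ θ (y (k + 1)) ∧ (θ z = θ (y k) → z = y k) ∧
        (θ z = θ (y (k + 1)) → z = y (k + 1)) := by
    intro k hk z hz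
    have m1 := y1 k (by omega)
    have m2 := y1 (k + 1) hk
    have h1 := y2 k (k + 1) (by omega) hk
    refine A.edge (ne _ m1) (ne _ m2) h1 ?_ hz
    by_contra hc
    obtain ⟨w, hw, h3⟩ := hgap _ m1 _ m2 h1 (not_lt.1 hc)
    exact nob k hk w hw h3
  have spoke : ∀ x z, z ∈ segment ℝ o x → z ≠ o → θ z = θ x := by
    intro x z hz hzo
    obtain ⟨a, b, ha, hb, hab, rfl⟩ := mem_seg.1 hz
    have : a = 1 - b := by linarith
    subst this
    refine A.ray x b (lt_of_le_of_ne hb ?_)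
    rintro rfl
    apply hzo; simp
  let f : ℕ → Pt := fun k => if k = 0 ∨ k = n + 1 then o else y (k - 1)
  have f0 : f 0 = o := by simp [f]
  have fn : f (n + 1) = o := by simp [f]
  have fk : ∀ k, k < n → f (k + 1) = y k := by
    intro k hk
    have : ¬ (k + 1 = 0 ∨ k + 1 = n + 1) := by omega
    simp only [f, if_neg this, Nat.add_sub_cancel]
  have cyc := mkCycle φ (n + 1) (by omega) f (by rw [f0, fn]) ?_ ?_ ?_
  · refine ⟨_, cyc, ?_⟩
    ext p
    simp only [Set.mem_range, Set.mem_insert_iff, Finset.mem_coe]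
    constructor
    · rintro ⟨i, rfl⟩
      have hlt := ZMod.val_lt i
      rcases Nat.eq_zero_or_pos i.val with h | h
      · left; rw [h, f0]
      · right
        obtain ⟨m, hm⟩ : ∃ m, i.val = m + 1 := ⟨i.val - 1, by omega⟩
        rw [hm, fk m (by omega)]
        exact y1 m (by omega)
    · rintro (rfl | hp)
      · exact ⟨0, by rw [ZMod.val_zero, f0]⟩
      · obtain ⟨k, hk, rfl⟩ := y3 p hp
        refine ⟨((k + 1 : ℕ) : ZMod (n + 1)), ?_⟩
        rw [ZMod.val_cast_of_lt (by omega), fk k hk]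
  · intro i hi j hj h
    rcases Nat.eq_zero_or_pos i with h1 | h1 <;> rcases Nat.eq_zero_or_pos j with h2 | h2
    · omega
    · exfalso
      obtain ⟨m, rfl⟩ : ∃ m, j = m + 1 := ⟨j - 1, by omega⟩
      rw [h1, f0, fk m (by omega)] at h
      exact ne _ (y1 m (by omega)) h.symm
    · exfalso
      obtain ⟨m, rfl⟩ : ∃ m, i = m + 1 := ⟨i - 1, by omega⟩
      rw [h2, f0, fk m (by omega)] at h
      exact ne _ (y1 m (by omega)) h
    · obtain ⟨m, rfl⟩ : ∃ m, j = m + 1 := ⟨j - 1, by omega⟩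
      obtain ⟨l, rfl⟩ : ∃ m, i = m + 1 := ⟨i - 1, by omega⟩
      rw [fk m (by omega), fk l (by omega)] at h
      have := yinj _ _ (by omega) (by omega) h
      omega
  · intro k hk
    rcases Nat.eq_zero_or_pos k with h1 | h1
    · subst h1
      rw [f0, fk 0 (by omega)]
      refine (hc1 _ (y1 0 (by omega)) ?_).symm
      intro w hw
      obtain ⟨j, hj, rfl⟩ := y3 w hw
      exact ym 0 j (by omega) hj
    · obtain ⟨m, rfl⟩ : ∃ m, k = m + 1 := ⟨k - 1, by omega⟩
      rw [fk m (by omega)]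
      rcases Nat.lt_or_ge (m + 1) n with h2 | h2
      · rw [fk (m + 1) h2]
        exact hc3 _ (y1 m (by omega)) _ (y1 _ h2) (y2 _ _ (by omega) h2) (nob m h2)
      · have : m + 1 = n := by omega
        rw [this, fn]
        refine hc2 _ (y1 m (by omega)) ?_
        intro w hw
        obtain ⟨j, hj, rfl⟩ := y3 w hw
        exact ym j m (by omega) (by omega)
  · intro k l hkl hl p hp hq
    obtain ⟨j, rfl⟩ : ∃ m, l = m + 1 := ⟨l - 1, by omega⟩
    rcases Nat.eq_zero_or_pos k with h1 | h1
    · subst h1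
      rw [zero_add, f0, show (1 : ℕ) = 0 + 1 from rfl, fk 0 (by omega)] at hp
      rcases Nat.lt_or_ge (j + 1) n with h2 | h2
      · rw [fk j (by omega), fk (j + 1) h2] at hq
        obtain ⟨b1, b2, b3, b4, b5⟩ := edge j h2 p hq
        have h3 := spoke _ _ hp b1
        rw [h3] at b2
        have : j = 0 := by have := ylt j 0 (by omega) (by omega) b2; omega
        subst this
        left
        refine ⟨rfl, ?_⟩
        rw [fk 0 (by omega)]
        exact b4 h3
      · have hj : j + 1 = n := by omega
        rw [fk j (by omega), hj, fn, segment_symm] at hq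
        right
        refine ⟨rfl, by omega, ?_⟩
        rw [f0]
        by_contra hpo
        have h3 := spoke _ _ hp hpo
        have h4 := spoke _ _ hq hpo
        have := ylt j 0 (by omega) (by omega) (by rw [← h3, ← h4])
        omega
    · obtain ⟨i, rfl⟩ : ∃ m, k = m + 1 := ⟨k - 1, by omega⟩
      left
      rw [fk i (by omega), fk (i + 1) (by omega)] at hp
      obtain ⟨a1, a2, a3, a4, a5⟩ := edge i (by omega) p hp
      rcases Nat.lt_or_ge (j + 1) n with h2 | h2
      · rw [fk j (by omega), fk (j + 1) h2] at hq
        obtain ⟨b1, b2, b3, b4, b5⟩ := edge j h2 p hq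
        have h3 := ylt j (i + 1) (by omega) (by omega) (by linarith)
        have : j = i + 1 := by omega
        subst this
        refine ⟨rfl, ?_⟩
        rw [fk _ (by omega)]
        exact a5 (by linarith)
      · have hj : j + 1 = n := by omega
        rw [fk j (by omega), hj, fn, segment_symm] at hq
        have h4 := spoke _ _ hq a1
        have h3 := ylt j (i + 1) (by omega) (by omega) (by linarith)
        have : j = i + 1 := by omega
        subst this
        refine ⟨rfl, ?_⟩
        rw [fk _ (by omega)]
        exact a5 (by linarith)

def GPF (S : Finset Pt) : Prop := ∀ a ∈ S, ∀ b ∈ S, ∀ c ∈ S, a ≠ b → a ≠ c → b ≠ c → sideSign a b c ≠ 0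

def Col1 (φ : Pt → ℕ) (S : Finset Pt) (p q : Pt) : Prop :=
  ∀ x ∈ S, ∀ y ∈ S, φ x = φ y → x ≠ y → (x = p ∧ y = q) ∨ (x = q ∧ y = p)

lemma Col1.symm {φ : Pt → ℕ} {S : Finset Pt} {p q : Pt} (h : Col1 φ S p q) : Col1 φ S q p :=
  fun x hx y hy h1 h2 => (h x hx y hy h1 h2).symm

def NE (S : Finset Pt) (b : Pt) : Prop := ∃ x ∈ S, ∃ y ∈ S, ∃ z ∈ S, x ≠ y ∧ x ≠ z ∧ y ≠ z ∧
  x ≠ b ∧ y ≠ b ∧ z ≠ b ∧ InTri x y z b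

lemma sgn_of {R s : ℝ} (hR : 0 < R) : (0 < R * s ↔ 0 < s) ∧ (R * s < 0 ↔ s < 0) ∧ (0 ≤ R * s ↔ 0 ≤ s) :=
  ⟨mul_pos_iff_of_pos_left hR, by
    constructor
    · intro h; by_contra hc; have := mul_nonneg hR.le (not_lt.1 hc); linarith
    · intro h; exact mul_neg_of_pos_of_neg hR h, mul_nonneg_iff_of_pos_left hR⟩

lemma starA {φ : Pt → ℕ} {S : Finset Pt} {p q x1 x2 : Pt} (hg : GPF S) (hp : p ∈ S) (hq : q ∈ S)
    (hpq : p ≠ q) (hc : Col1 φ S p q) (h1 : x1 ∈ S) (h2 : x2 ∈ S)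
    (s1 : 0 < sideSign p q x1) (s2 : sideSign p q x2 < 0) :
    ∃ γ : ZMod S.card → Pt, IsPlaneCycle φ S.card γ ∧ Set.range γ = (S : Set Pt) := by
  obtain ⟨θ, A, t0, -⟩ := exists_angle p (q - p) (sub_ne_zero.2 hpq.symm)
  rw [add_sub_cancel] at t0
  have n1 : x1 ≠ p := by rintro rfl; rw [ss_self1] at s1; exact lt_irrefl _ s1
  have n2 : x2 ≠ p := by rintro rfl; rw [ss_self1] at s2; exact lt_irrefl _ s2
  have m1 : 0 < θ x1 := by
    obtain ⟨R, hR, e⟩ := A.sn q x1 hpq.symm n1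
    rw [e, t0, sub_zero, (sgn_of hR).1] at s1
    by_contra hcon
    have := Real.sin_nonpos_of_nonpos_of_neg_pi_le (not_lt.1 hcon) (A.rng x1).1.le
    linarith
  have m2 : θ x2 < 0 := by
    obtain ⟨R, hR, e⟩ := A.sn q x2 hpq.symm n2
    rw [e, t0, sub_zero, (sgn_of hR).2.1] at s2
    by_contra hcon
    have := Real.sin_nonneg_of_nonneg_of_le_pi (not_lt.1 hcon) (A.rng x2).2
    linarith
  have key : ∀ x ∈ S.erase p, φ x = φ p → x = q := by
    intro x hx h
    rcases hc x (mem_of_mem_erase hx) p hp h (ne_of_mem_erase hx) with h | h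
    · exact absurd h.1 (ne_of_mem_erase hx)
    · exact h.1
  have hcard : (S.erase p).card + 1 = S.card := Finset.card_erase_add_one hp
  have hx12 : x1 ≠ x2 := by rintro rfl; linarith
  have := star φ A (S.erase p) (by simp) ?_ ?_ ?_ ?_ ?_ ?_
  · rw [hcard] at this
    obtain ⟨γ, h3, h4⟩ := this
    refine ⟨γ, h3, ?_⟩
    rw [h4]
    have := Finset.insert_erase hp
    rw [← Finset.coe_insert, this]
  · exact Finset.one_lt_card.2 ⟨x1, mem_erase.2 ⟨n1, h1⟩, x2, mem_erase.2 ⟨n2, h2⟩, hx12⟩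
  · intro x hx y hy hxy
    exact hg p hp x (mem_of_mem_erase hx) y (mem_of_mem_erase hy) (ne_of_mem_erase hx).symm
      (ne_of_mem_erase hy).symm hxy
  · intro x hx y hy _ hgap
    have rx := A.rng x
    have ry := A.rng y
    refine ⟨q, mem_erase.2 ⟨hpq.symm, hq⟩, ?_, by rw [t0]; linarith⟩
    rw [t0]
    by_contra hcon
    have hx0 : θ x = 0 := by linarith
    have hy0 : θ y = Real.pi := by linarith
    have hyq : q ≠ y := by rintro rfl; rw [hy0] at t0; exact Real.pi_pos.ne' t0
    obtain ⟨R, hR, e⟩ := A.sn q y hpq.symm (ne_of_mem_erase hy)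
    refine hg p hp q hq y (mem_of_mem_erase hy) hpq (ne_of_mem_erase hy).symm hyq ?_
    rw [e, t0, hy0]; simp
  · intro x hx hm h
    have := hm x2 (mem_erase.2 ⟨n2, h2⟩)
    rw [key x hx h, t0] at this
    linarith
  · intro x hx hm h
    have := hm x1 (mem_erase.2 ⟨n1, h1⟩)
    rw [key x hx h, t0] at this
    linarith
  · intro x hx y hy hlt _ h
    rcases hc x (mem_of_mem_erase hx) y (mem_of_mem_erase hy) h (by rintro rfl; exact lt_irrefl _ hlt) with h | h
    · exact absurd h.1 (ne_of_mem_erase hx)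
    · exact absurd h.2 (ne_of_mem_erase hy)

lemma starB {φ : Pt → ℕ} {S : Finset Pt} {p q b0 : Pt} (hg : GPF S) (hp : p ∈ S) (hq : q ∈ S)
    (hpq : p ≠ q) (hc : Col1 φ S p q) (h4 : 4 ≤ S.card)
    (hs : ∀ x ∈ S, x ≠ p → x ≠ q → 0 < sideSign p q x) (hb0 : b0 ∈ S) (hN0 : NE S b0) :
    ∃ γ : ZMod S.card → Pt, IsPlaneCycle φ S.card γ ∧ Set.range γ = (S : Set Pt) := by
  classical
  obtain ⟨b, hbm, hmin⟩ := Finset.exists_min_image (S.filter (NE S)) (fun x => sideSign p q x)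
    ⟨b0, mem_filter.2 ⟨hb0, hN0⟩⟩
  obtain ⟨hb, hN⟩ := mem_filter.1 hbm
  have nonneg : ∀ x ∈ S, 0 ≤ sideSign p q x := by
    intro x hx
    by_cases h1 : x = p
    · rw [h1, ss_self1]
    by_cases h2 : x = q
    · rw [h2, ss_self2]
    exact (hs x hx h1 h2).le
  have hbpos : 0 < sideSign p q b := by
    obtain ⟨x, hx, y, hy, z, hz, xy, xz, yz, xb, yb, zb, l1, l2, l3, p1, p2, p3, hl, he⟩ := hN
    have e := ss_comb3 p q x y z l1 l2 l3 hl
    rw [← he] at e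
    have a1 := nonneg x hx
    have a2 := nonneg y hy
    have a3 := nonneg z hz
    rw [e]
    have : 0 < sideSign p q x ∨ 0 < sideSign p q y ∨ 0 < sideSign p q z := by
      have hx' : x = p ∨ x = q ∨ 0 < sideSign p q x := by
        by_cases h1 : x = p
        · exact Or.inl h1
        by_cases h2 : x = q
        · exact Or.inr (Or.inl h2)
        exact Or.inr (Or.inr (hs x hx h1 h2))
      have hy' : y = p ∨ y = q ∨ 0 < sideSign p q y := by
        by_cases h1 : y = p
        · exact Or.inl h1
        by_cases h2 : y = q
        · exact Or.inr (Or.inl h2)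
        exact Or.inr (Or.inr (hs y hy h1 h2))
      have hz' : z = p ∨ z = q ∨ 0 < sideSign p q z := by
        by_cases h1 : z = p
        · exact Or.inl h1
        by_cases h2 : z = q
        · exact Or.inr (Or.inl h2)
        exact Or.inr (Or.inr (hs z hz h1 h2))
      grind
    rcases this with h | h | h
    · nlinarith [mul_pos p1 h, mul_nonneg p2.le a2, mul_nonneg p3.le a3]
    · nlinarith [mul_pos p2 h, mul_nonneg p1.le a1, mul_nonneg p3.le a3]
    · nlinarith [mul_pos p3 h, mul_nonneg p2.le a2, mul_nonneg p1.le a1]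
  have bp : b ≠ p := by rintro rfl; rw [ss_self1] at hbpos; exact lt_irrefl _ hbpos
  have bq : b ≠ q := by rintro rfl; rw [ss_self2] at hbpos; exact lt_irrefl _ hbpos
  obtain ⟨m, hm⟩ : ∃ m : Pt, m = (1 / 2 : ℝ) • p + (1 / 2 : ℝ) • q := ⟨_, rfl⟩
  have mcomb : ∀ u v, sideSign u v m = 1 / 2 * sideSign u v p + 1 / 2 * sideSign u v q := by
    intro u v; rw [hm, ss_comb2 _ _ _ _ _ _ (by norm_num)]
  have mb : m ≠ b := by
    rintro rfl
    have := mcomb p q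
    rw [ss_self1, ss_self2] at this
    linarith
  obtain ⟨θ, A, -, tm⟩ := exists_angle b (b - m) (sub_ne_zero.2 mb.symm)
  rw [sub_sub_cancel] at tm
  have opq : sideSign b p q = sideSign p q b := ss_cyc _ _ _
  have tp : 0 < θ p ∧ θ p < Real.pi := by
    obtain ⟨R, hR, e⟩ := A.sn p m bp.symm mb
    have h1 := mcomb b p
    rw [ss_self2, opq] at h1
    have : 0 < sideSign b p m := by linarith
    rw [e, tm, (sgn_of hR).1, Real.sin_pi_sub] at this
    have rp := A.rng p
    constructor
    · by_contra hcon
      have := Real.sin_nonpos_of_nonpos_of_neg_pi_le (not_lt.1 hcon) rp.1.le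
      linarith
    · refine lt_of_le_of_ne rp.2 ?_
      intro h; rw [h] at this; simp at this
  have tq : θ q < 0 := by
    obtain ⟨R, hR, e⟩ := A.sn q m bq.symm mb
    have h1 := mcomb b q
    rw [ss_self2, ss_swap' b q p, opq] at h1
    have : sideSign b q m < 0 := by linarith
    rw [e, tm, (sgn_of hR).2.1, Real.sin_pi_sub] at this
    by_contra hcon
    have := Real.sin_nonneg_of_nonneg_of_le_pi (not_lt.1 hcon) (A.rng q).2
    linarith
  have btw : ∀ x ∈ S, x ≠ b → x ≠ p → x ≠ q → θ q < θ x ∧ θ x < θ p := by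
    intro x hx xb xp xq
    by_contra hcon
    have g1 := hg b hb p hp x hx bp xb.symm xp.symm
    have g2 := hg b hb x hx q hq xb.symm bq xq
    have main : 0 ≤ sideSign b p x ∧ 0 ≤ sideSign b x q := by
      have rx := A.rng x
      have hmx := mcomb b x
      rw [ss_swap' b x p] at hmx
      rcases lt_or_ge (θ x) (θ p) with h | h
      · have h5 : θ x ≤ θ q := by
          by_contra h5; exact hcon ⟨not_le.1 h5, h⟩
        have rq := A.rng q
        obtain ⟨R, hR, e⟩ := A.sn x q xb bq.symm
        have s1 : 0 ≤ sideSign b x q := by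
          rw [e]; exact mul_nonneg hR.le (Real.sin_nonneg_of_nonneg_of_le_pi (by linarith) (by linarith))
        obtain ⟨R', hR', e'⟩ := A.sn x m xb mb
        have s2 : sideSign b x m ≤ 0 := by
          rw [e', tm, Real.sin_pi_sub]
          exact mul_nonpos_of_nonneg_of_nonpos hR'.le
            (Real.sin_nonpos_of_nonpos_of_neg_pi_le (by linarith) rx.1.le)
        exact ⟨by linarith, s1⟩
      · obtain ⟨R, hR, e⟩ := A.sn p x bp.symm xb
        have s1 : 0 ≤ sideSign b p x := by
          rw [e]; exact mul_nonneg hR.le (Real.sin_nonneg_of_nonneg_of_le_pi (by linarith) (by linarith))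
        obtain ⟨R', hR', e'⟩ := A.sn x m xb mb
        have s2 : 0 ≤ sideSign b x m := by
          rw [e', tm, Real.sin_pi_sub]
          exact mul_nonneg hR'.le (Real.sin_nonneg_of_nonneg_of_le_pi (by linarith) rx.2)
        exact ⟨s1, by linarith⟩
    have p1 := lt_of_le_of_ne main.1 g1.symm
    have p2 := lt_of_le_of_ne main.2 g2.symm
    have hI : InTri b p q x := by
      apply inTri_of_pos
      · rw [opq]; exact mul_pos (hs x hx xp xq) hbpos
      · rw [opq, ss_cyc q b x]; exact mul_pos p2 hbpos
      · rw [opq]; exact mul_pos p1 hbpos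
    have := hmin x (mem_filter.2 ⟨hx, b, hb, p, hp, q, hq, bp, bq, hpq, xb.symm, xp.symm, xq.symm, hI⟩)
    obtain ⟨l1, l2, l3, q1, q2, q3, hl, he⟩ := hI
    have e := ss_comb3 p q b p q l1 l2 l3 hl
    rw [← he, ss_self1, ss_self2] at e
    have : sideSign p q x = l1 * sideSign p q b := by linarith
    nlinarith
  have hcard : (S.erase b).card + 1 = S.card := Finset.card_erase_add_one hb
  have hcb : ∀ x ∈ S.erase b, φ x ≠ φ b := by
    intro x hx h
    rcases hc x (mem_of_mem_erase hx) b hb h (ne_of_mem_erase hx) with h | h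
    · exact bq h.2
    · exact bp h.2
  have := star φ A (S.erase b) (by simp) (by omega) ?_ ?_ (fun x hx _ => hcb x hx)
    (fun x hx _ => hcb x hx) ?_
  · rw [hcard] at this
    obtain ⟨γ, h3, h4⟩ := this
    refine ⟨γ, h3, ?_⟩
    rw [h4]
    have := Finset.insert_erase hb
    rw [← Finset.coe_insert, this]
  · intro x hx y hy hxy
    exact hg b hb x (mem_of_mem_erase hx) y (mem_of_mem_erase hy) (ne_of_mem_erase hx).symm
      (ne_of_mem_erase hy).symm hxy
  · intro x hx y hy _ hgap
    by_contra hcon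
    push Not at hcon
    have ry := A.rng y
    have rx := A.rng x
    obtain ⟨z1, hz1, z2, hz2, z3, hz3, z12, z13, z23, zb1, zb2, zb3, l1, l2, l3, p1, p2, p3, hl, he⟩ := hN
    have e := ss_comb3 b x z1 z2 z3 l1 l2 l3 hl
    rw [← he, ss_self1] at e
    have xb := ne_of_mem_erase hx
    have le : ∀ z ∈ S, z ≠ b → sideSign b x z ≤ 0 := by
      intro z hz hzb
      obtain ⟨R, hR, e⟩ := A.sn x z xb hzb
      rw [e]
      apply mul_nonpos_of_nonneg_of_nonpos hR.le
      have rz := A.rng z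
      rcases le_or_gt (θ z) (θ x) with h | h
      · exact Real.sin_nonpos_of_nonpos_of_neg_pi_le (by linarith) (by linarith)
      · have h6 := hcon z (mem_erase.2 ⟨hzb, hz⟩) h
        have := Real.sin_nonneg_of_nonneg_of_le_pi (x := θ z - θ x - Real.pi) (by linarith) (by linarith)
        rw [Real.sin_sub_pi] at this
        linarith
    have lt : ∀ z ∈ S, z ≠ b → z ≠ x → sideSign b x z < 0 := by
      intro z hz hzb hzx
      exact lt_of_le_of_ne (le z hz hzb) (hg b hb x (mem_of_mem_erase hx) z hz xb.symm hzb.symm hzx.symm)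
    have a1 := le z1 hz1 zb1
    have a2 := le z2 hz2 zb2
    have a3 := le z3 hz3 zb3
    by_cases hzx : z1 = x
    · have a4 := lt z2 hz2 zb2 (by rw [← hzx]; exact z12.symm)
      nlinarith [mul_pos p2 (neg_pos.2 a4), mul_nonneg p1.le (neg_nonneg.2 a1), mul_nonneg p3.le (neg_nonneg.2 a3)]
    · have a4 := lt z1 hz1 zb1 hzx
      nlinarith [mul_pos p1 (neg_pos.2 a4), mul_nonneg p2.le (neg_nonneg.2 a2), mul_nonneg p3.le (neg_nonneg.2 a3)]
  · intro x hx y hy hlt hno h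
    have hxy : x ≠ y := by rintro rfl; exact lt_irrefl _ hlt
    obtain ⟨w, hw, hw2⟩ : ∃ w ∈ S, w ∉ ({b, p, q} : Finset Pt) := by
      by_contra hcon
      push Not at hcon
      have h1 := Finset.card_le_card (show S ⊆ {b, p, q} from hcon)
      have h2 := Finset.card_le_three (a := b) (b := p) (c := q)
      omega
    simp only [mem_insert, mem_singleton, not_or] at hw2
    have hb3 := btw w hw hw2.1 hw2.2.1 hw2.2.2
    rcases hc x (mem_of_mem_erase hx) y (mem_of_mem_erase hy) h hxy with ⟨rfl, rfl⟩ | ⟨rfl, rfl⟩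
    · linarith [tp.1]
    · exact hno w (mem_erase.2 ⟨hw2.1, hw⟩) hb3

structure CA (φ : Pt → ℕ) (V : Finset Pt) (h : ℕ) : Prop where
  gp : GPF V
  hh : 4 ≤ h
  col : h ≤ (V.image φ).card
  nog : ¬ ∃ γ : ZMod (h + 1) → Pt, IsPlaneCycle φ (h + 1) γ ∧ (∀ i, γ i ∈ V) ∧ NonRainbow φ (h + 1) γ

section CaseA
variable {φ : Pt → ℕ} {V : Finset Pt} {h : ℕ}

lemma CA.ext (c : CA φ V h) {F : Finset Pt} {p q : Pt} (hF : F ⊆ V) (h5 : F.card ≤ 5) (hp : p ∈ F)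
    (hq : q ∈ F) (hpq : p ≠ q) (he : φ p = φ q) (hc : Col1 φ F p q) :
    ∃ S, F ⊆ S ∧ S ⊆ V ∧ S.card = h + 1 ∧ Col1 φ S p q := by
  classical
  have hcard : (F.image φ).card + 1 = F.card := by
    have e1 : F.image φ = (F.erase q).image φ := by
      ext x
      simp only [mem_image, mem_erase]
      constructor
      · rintro ⟨a, ha, rfl⟩
        by_cases h : a = q
        · exact ⟨p, ⟨hpq, hp⟩, by rw [he, h]⟩
        · exact ⟨a, ⟨h, ha⟩, rfl⟩
      · rintro ⟨a, ha, rfl⟩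
        exact ⟨a, ha.2, rfl⟩
    rw [e1, Finset.card_image_of_injOn, Finset.card_erase_add_one hq]
    intro x hx y hy hxy
    by_contra hne
    have hx := mem_erase.1 (mem_coe.1 hx)
    have hy := mem_erase.1 (mem_coe.1 hy)
    rcases hc x hx.2 y hy.2 hxy hne with h | h
    · exact hy.1 h.2
    · exact hx.1 h.1
  have h4 := c.hh
  obtain ⟨D, hD1, hD2, hD3⟩ := Finset.exists_subsuperset_card_eq
    (Finset.image_subset_image (f := φ) hF) (n := h) (by omega) c.col
  have : ∀ d, ∃ x, d ∈ D → x ∈ V ∧ φ x = d := by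
    intro d
    by_cases hd : d ∈ D
    · obtain ⟨x, hx, hxd⟩ := mem_image.1 (hD2 hd)
      exact ⟨x, fun _ => ⟨hx, hxd⟩⟩
    · exact ⟨0, fun h => absurd h hd⟩
  choose g hg using this
  have hG : ∀ x ∈ (D \ F.image φ).image g, x ∈ V ∧ φ x ∉ F.image φ ∧ φ x ∈ D ∧ g (φ x) = x := by
    intro x hx
    obtain ⟨d, hd, rfl⟩ := mem_image.1 hx
    obtain ⟨hd1, hd2⟩ := mem_sdiff.1 hd
    have := hg d hd1
    rw [this.2]
    exact ⟨this.1, hd2, hd1, rfl⟩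
  refine ⟨F ∪ (D \ F.image φ).image g, subset_union_left, ?_, ?_, ?_⟩
  · intro x hx
    rcases mem_union.1 hx with h | h
    · exact hF h
    · exact (hG x h).1
  · rw [Finset.card_union_of_disjoint, Finset.card_image_of_injOn, Finset.card_sdiff_of_subset hD1]
    · omega
    · intro a ha b hb hab
      have h1 := (hg a (mem_sdiff.1 (mem_coe.1 ha)).1).2
      have h2 := (hg b (mem_sdiff.1 (mem_coe.1 hb)).1).2
      rw [← h1, ← h2, hab]
    · rw [Finset.disjoint_left]
      intro x hx hx2
      exact (hG x hx2).2.1 (mem_image_of_mem _ hx)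
  · intro x hx y hy hxy hne
    rcases mem_union.1 hx with h1 | h1 <;> rcases mem_union.1 hy with h2 | h2
    · exact hc x h1 y h2 hxy hne
    · exact absurd (hxy ▸ mem_image_of_mem φ h1) (hG y h2).2.1
    · exact absurd (hxy ▸ mem_image_of_mem φ h2) (hG x h1).2.1
    · exfalso; apply hne
      rw [← (hG x h1).2.2.2, ← (hG y h2).2.2.2, hxy]

lemma GPF.mono {S : Finset Pt} (hg : GPF V) (hS : S ⊆ V) : GPF S :=
  fun a ha b hb c hc => hg a (hS ha) b (hS hb) c (hS hc)

lemma CA.fin (c : CA φ V h) {S : Finset Pt} {p q : Pt} (hS : S ⊆ V) (hc : S.card = h + 1)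
    (hp : p ∈ S) (hq : q ∈ S) (hpq : p ≠ q) (he : φ p = φ q)
    (hγ : ∃ γ : ZMod S.card → Pt, IsPlaneCycle φ S.card γ ∧ Set.range γ = (S : Set Pt)) : False := by
  rw [hc] at hγ
  obtain ⟨γ, h1, h2⟩ := hγ
  apply c.nog
  refine ⟨γ, h1, ?_, ?_⟩
  · intro i
    apply hS
    rw [← mem_coe, ← h2]; exact ⟨i, rfl⟩
  · have a1 : p ∈ Set.range γ := by rw [h2]; exact hp
    have a2 : q ∈ Set.range γ := by rw [h2]; exact hq
    obtain ⟨i, rfl⟩ := a1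
    obtain ⟨j, rfl⟩ := a2
    exact ⟨i, j, fun h => hpq (by rw [h]), he⟩

lemma CA.good (c : CA φ V h) {F : Finset Pt} {p q : Pt} (hF : F ⊆ V) (h5 : F.card ≤ 5) (hp : p ∈ F)
    (hq : q ∈ F) (hpq : p ≠ q) (he : φ p = φ q) (hc : Col1 φ F p q)
    (hs : (∃ x1 ∈ F, ∃ x2 ∈ F, 0 < sideSign p q x1 ∧ sideSign p q x2 < 0) ∨ ∃ b ∈ F, NE F b) : False := by
  have h4 := c.hh
  obtain ⟨S, hS1, hS2, hS3, hS4⟩ := c.ext hF h5 hp hq hpq he hc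
  have hg := c.gp.mono hS2
  by_cases hA : ∃ x1 ∈ S, ∃ x2 ∈ S, 0 < sideSign p q x1 ∧ sideSign p q x2 < 0
  · obtain ⟨x1, h1, x2, h2, s1, s2⟩ := hA
    exact c.fin hS2 hS3 (hS1 hp) (hS1 hq) hpq he (starA hg (hS1 hp) (hS1 hq) hpq hS4 h1 h2 s1 s2)
  · rcases hs with ⟨x1, h1, x2, h2, s⟩ | ⟨b, hb, x, hx, y, hy, z, hz, r⟩
    · exact hA ⟨x1, hS1 h1, x2, hS1 h2, s⟩
    · have hN : NE S b := ⟨x, hS1 hx, y, hS1 hy, z, hS1 hz, r⟩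
      push Not at hA
      by_cases hpos : ∃ x ∈ S, 0 < sideSign p q x
      · obtain ⟨x1, hx1, s1⟩ := hpos
        refine c.fin hS2 hS3 (hS1 hp) (hS1 hq) hpq he (starB hg (hS1 hp) (hS1 hq) hpq hS4 (by omega) ?_ (hS1 hb) hN)
        intro x hx n1 n2
        exact lt_of_le_of_ne (hA x1 hx1 x hx s1) (hg p (hS1 hp) q (hS1 hq) x hx hpq n1.symm n2.symm).symm
      · push Not at hpos
        refine c.fin hS2 hS3 (hS1 hq) (hS1 hp) hpq.symm he.symm (starB hg (hS1 hq) (hS1 hp) hpq.symm hS4.symm (by omega) ?_ (hS1 hb) hN)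
        intro x hx n1 n2
        rw [ss_swap]
        have := lt_of_le_of_ne (hpos x hx) (hg p (hS1 hp) q (hS1 hq) x hx hpq n2.symm n1.symm)
        linarith

lemma CA.opp (c : CA φ V h) {p q r s : Pt} (hp : p ∈ V) (hq : q ∈ V) (hr : r ∈ V) (hs : s ∈ V)
    (hpq : p ≠ q) (he : φ p = φ q) (h1 : φ r ≠ φ p) (h2 : φ s ≠ φ p) (h3 : φ r ≠ φ s)
    (s1 : 0 < sideSign p q r) (s2 : sideSign p q s < 0) : False := by
  refine c.good (F := {p, q, r, s}) (p := p) (q := q) ?_ ?_ (by simp) (by simp) hpq he ?_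
    (Or.inl ⟨r, by simp, s, by simp, s1, s2⟩)
  · intro x hx
    simp only [mem_insert, mem_singleton] at hx
    grind
  · exact (Finset.card_le_four).trans (by norm_num)
  · intro x hx y hy
    simp only [mem_insert, mem_singleton] at hx hy
    grind

lemma CA.triV (c : CA φ V h) {x y z b : Pt} (hx : x ∈ V) (hy : y ∈ V) (hz : z ∈ V) (hb : b ∈ V)
    (hxy : x ≠ y) (he : φ x = φ y) (h1 : φ x ≠ φ z) (h2 : φ x ≠ φ b) (h3 : φ z ≠ φ b)
    (hI : InTri x y z b) : False := by
  refine c.good (F := {x, y, z, b}) (p := x) (q := y) ?_ ?_ (by simp) (by simp) hxy he ?_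
    (Or.inr ⟨b, by simp, x, by simp, y, by simp, z, by simp, hxy, ?_, ?_, ?_, ?_, ?_, hI⟩)
  · intro x hx
    simp only [mem_insert, mem_singleton] at hx
    grind
  · exact (Finset.card_le_four).trans (by norm_num)
  · intro x hx y hy
    simp only [mem_insert, mem_singleton] at hx hy
    grind
  all_goals grind

lemma CA.triB (c : CA φ V h) {x y z b : Pt} (hx : x ∈ V) (hy : y ∈ V) (hz : z ∈ V) (hb : b ∈ V)
    (hxb : x ≠ b) (he : φ x = φ b) (h1 : φ x ≠ φ y) (h2 : φ x ≠ φ z) (h3 : φ y ≠ φ z)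
    (hI : InTri x y z b) : False := by
  refine c.good (F := {x, y, z, b}) (p := x) (q := b) ?_ ?_ (by simp) (by simp) hxb he ?_
    (Or.inr ⟨b, by simp, x, by simp, y, by simp, z, by simp, ?_, ?_, ?_, ?_, ?_, ?_, hI⟩)
  · intro x hx
    simp only [mem_insert, mem_singleton] at hx
    grind
  · exact (Finset.card_le_four).trans (by norm_num)
  · intro x hx y hy
    simp only [mem_insert, mem_singleton] at hx hy
    grind
  all_goals grind

lemma CA.tri5 (c : CA φ V h) {x y z b q : Pt} (hx : x ∈ V) (hy : y ∈ V) (hz : z ∈ V) (hb : b ∈ V)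
    (hq : q ∈ V) (hxq : x ≠ q) (he : φ x = φ q) (h1 : φ x ≠ φ y) (h2 : φ x ≠ φ z) (h3 : φ y ≠ φ z)
    (h4 : φ b ≠ φ x) (h5 : φ b ≠ φ y) (h6 : φ b ≠ φ z)
    (hI : InTri x y z b) : False := by
  refine c.good (F := {x, y, z, b, q}) (p := x) (q := q) ?_ ?_ (by simp) (by simp) hxq he ?_
    (Or.inr ⟨b, by simp, x, by simp, y, by simp, z, by simp, ?_, ?_, ?_, ?_, ?_, ?_, hI⟩)
  · intro x hx
    simp only [mem_insert, mem_singleton] at hx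
    grind
  · exact (Finset.card_le_five)
  · intro x hx y hy
    simp only [mem_insert, mem_singleton] at hx hy
    grind
  all_goals grind

end CaseA

lemma subdiv {a b d z s : Pt} (hI : InTri a b d z) (ha : sideSign z s a ≠ 0) (hb : sideSign z s b ≠ 0)
    (hd : sideSign z s d ≠ 0) (hD : sideSign a b d ≠ 0) :
    InTri s a b z ∨ InTri s b d z ∨ InTri s d a z := by
  obtain ⟨l, m, n, hl, hm, hn, hs, he⟩ := hI
  have e0 := ss_comb3 z s a b d l m n hs
  have e1 := ss_comb3 a b a b d l m n hs
  have e2 := ss_comb3 b d a b d l m n hs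
  have e3 := ss_comb3 d a a b d l m n hs
  rw [← he] at e0 e1 e2 e3
  rw [ss_self1] at e0
  rw [ss_self1, ss_self2] at e1 e2 e3
  rw [← ss_cyc a b d] at e2
  rw [ss_cyc d a b] at e3
  have hD2 : 0 < sideSign a b d ^ 2 := by positivity
  have t3 : ∀ x y : Pt, 0 < sideSign x y z * sideSign a b d → 0 < sideSign z s x * sideSign a b d →
      sideSign z s y * sideSign a b d < 0 → InTri s x y z := by
    intro x y h1 h2 h3
    have f1 : sideSign s x z = sideSign z s x := ss_cyc _ _ _ |>.trans (ss_cyc _ _ _)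
    have f2 : sideSign y s z = - sideSign z s y := by
      rw [ss_swap y s z, ss_cyc s y z, ss_cyc y z s]
    have f3 : sideSign s x y = sideSign x y z + sideSign z s x - sideSign z s y := by
      unfold sideSign; ring
    have g : 0 < sideSign s x y * sideSign a b d := by rw [f3]; nlinarith
    have fin : ∀ w : ℝ, 0 < w * sideSign a b d → 0 < w * sideSign s x y := by
      intro w hw
      have := mul_pos hw g
      have : 0 < (w * sideSign s x y) * sideSign a b d ^ 2 := by nlinarith
      exact (pos_iff_pos_of_mul_pos this).2 hD2
    apply inTri_of_pos
    · exact fin _ h1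
    · rw [f2]; apply fin; linarith
    · rw [f1]; exact fin _ h2
  have k1 : 0 < sideSign a b z * sideSign a b d := by rw [e1]; nlinarith [mul_pos hn hD2]
  have k2 : 0 < sideSign b d z * sideSign a b d := by rw [e2]; nlinarith [mul_pos hl hD2]
  have k3 : 0 < sideSign d a z * sideSign a b d := by rw [e3]; nlinarith [mul_pos hm hD2]
  have na := mul_ne_zero ha hD
  have nb := mul_ne_zero hb hD
  have nd := mul_ne_zero hd hD
  have e : l * (sideSign z s a * sideSign a b d) + m * (sideSign z s b * sideSign a b d)
    + n * (sideSign z s d * sideSign a b d) = 0 := by linear_combination -sideSign a b d * e0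
  rcases lt_or_gt_of_ne na with ia | ia <;> rcases lt_or_gt_of_ne nb with ib | ib <;>
    rcases lt_or_gt_of_ne nd with id' | id'
  · nlinarith [mul_pos hl (neg_pos.2 ia), mul_pos hm (neg_pos.2 ib), mul_pos hn (neg_pos.2 id')]
  · exact Or.inr (Or.inr (t3 d a k3 id' ia))
  · exact Or.inr (Or.inl (t3 b d k2 ib id'))
  · exact Or.inr (Or.inr (t3 d a k3 id' ia))
  · exact Or.inl (t3 a b k1 ia ib)
  · exact Or.inl (t3 a b k1 ia ib)
  · exact Or.inr (Or.inl (t3 b d k2 ib id'))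
  · nlinarith [mul_pos hl ia, mul_pos hm ib, mul_pos hn id']

section CaseA2
variable {φ : Pt → ℕ} {V : Finset Pt} {h : ℕ}

lemma CA.third (c : CA φ V h) (a b : ℕ) : ∃ s ∈ V, φ s ≠ a ∧ φ s ≠ b := by
  by_contra hcon
  push Not at hcon
  have : V.image φ ⊆ {a, b} := by
    intro x hx
    obtain ⟨s, hs, rfl⟩ := mem_image.1 hx
    have := hcon s hs
    simp only [mem_insert, mem_singleton]
    tauto
  have h1 := Finset.card_le_card this
  have h2 : ({a, b} : Finset ℕ).card ≤ 2 := Finset.card_le_two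
  have := c.col
  have := c.hh
  omega

lemma CA.same (c : CA φ V h) {p q r s : Pt} (hp : p ∈ V) (hq : q ∈ V) (hr : r ∈ V) (hs : s ∈ V)
    (hpq : p ≠ q) (he : φ p = φ q) (h1 : φ r ≠ φ p) (h2 : φ s ≠ φ p)
    (s1 : 0 < sideSign p q r) : 0 < sideSign p q s := by
  have nz : ∀ w ∈ V, φ w ≠ φ p → sideSign p q w ≠ 0 := by
    intro w hw hwp
    exact c.gp p hp q hq w hw hpq (by rintro rfl; exact hwp rfl) (by rintro rfl; exact hwp he.symm)
  by_contra hcon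
  have s2 := lt_of_le_of_ne (not_lt.1 hcon) (nz s hs h2)
  by_cases hrs : φ r = φ s
  · obtain ⟨w, hw, w1, w2⟩ := c.third (φ p) (φ r)
    rcases lt_or_gt_of_ne (nz w hw w1) with h | h
    · exact c.opp hp hq hr hw hpq he h1 w1 w2.symm s1 h
    · exact c.opp hp hq hw hs hpq he w1 h2 (by rw [← hrs]; exact w2) h s2
  · exact c.opp hp hq hr hs hpq he h1 h2 hrs s1 s2

def Lft (φ : Pt → ℕ) (V : Finset Pt) (κ : ℕ) (a b : Pt) : Prop := ∀ r ∈ V, φ r ≠ κ → 0 < sideSign a b r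

lemma CA.total (c : CA φ V h) {κ : ℕ} {a b : Pt} (ha : a ∈ V) (hb : b ∈ V) (hab : a ≠ b)
    (ka : φ a = κ) (kb : φ b = κ) : Lft φ V κ a b ∨ Lft φ V κ b a := by
  subst ka
  obtain ⟨r, hr, h1, -⟩ := c.third (φ a) (φ a)
  have n : sideSign a b r ≠ 0 := c.gp a ha b hb r hr hab (by rintro rfl; exact h1 rfl)
    (by rintro rfl; exact h1 kb)
  rcases lt_or_gt_of_ne n with h | h
  · right
    intro s hs hsk
    exact c.same hb ha hr hs hab.symm kb (by rw [kb]; exact h1) (by rw [kb]; exact hsk)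
      (by rw [ss_swap]; linarith)
  · left
    intro s hs hsk
    exact c.same ha hb hr hs hab kb.symm h1 hsk h

lemma CA.asym (c : CA φ V h) {κ : ℕ} {a b : Pt} (h1 : Lft φ V κ a b) (h2 : Lft φ V κ b a) : False := by
  obtain ⟨r, hr, hk, -⟩ := c.third κ κ
  have a1 := h1 r hr hk
  have a2 := h2 r hr hk
  rw [ss_swap] at a2
  linarith

lemma CA.acyc (c : CA φ V h) {κ : ℕ} {x y z : Pt} (hx : x ∈ V) (hy : y ∈ V) (hz : z ∈ V)
    (kx : φ x = κ) (ky : φ y = κ) (kz : φ z = κ) (h1 : Lft φ V κ x y) (h2 : Lft φ V κ y z)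
    (h3 : Lft φ V κ z x) : False := by
  obtain ⟨r, hr, r1, -⟩ := c.third κ κ
  obtain ⟨s, hs, s1, s2⟩ := c.third κ (φ r)
  have a1 := h1 r hr r1
  have a2 := h2 r hr r1
  have a3 := h3 r hr r1
  have e : sideSign x y z = sideSign x y r + sideSign y z r + sideSign z x r := by
    unfold sideSign; ring
  have hD : 0 < sideSign x y z := by rw [e]; linarith
  have nxy : x ≠ y := by rintro rfl; simp [ss_self1, ss_self2, sideSign] at hD
  have nxz : x ≠ z := by rintro rfl; rw [ss_self1] at hD; exact lt_irrefl _ hD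
  have nyz : y ≠ z := by rintro rfl; rw [ss_self2] at hD; exact lt_irrefl _ hD
  have hI : InTri x y z r := inTri_of_pos (mul_pos a2 hD) (mul_pos a3 hD) (mul_pos a1 hD)
  have hrs : r ≠ s := by rintro rfl; exact s2 rfl
  have nz : ∀ w ∈ V, φ w = κ → sideSign r s w ≠ 0 := by
    intro w hw hk
    exact c.gp r hr s hs w hw hrs (by rintro rfl; exact r1 hk) (by rintro rfl; exact s1 hk)
  rcases subdiv hI (nz x hx kx) (nz y hy ky) (nz z hz kz) hD.ne' with h | h | h
  · exact c.triV hx hy hs hr nxy (by rw [kx, ky]) (by rw [kx]; exact s1.symm) (by rw [kx]; exact r1.symm) s2 h.rot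
  · exact c.triV hy hz hs hr nyz (by rw [ky, kz]) (by rw [ky]; exact s1.symm) (by rw [ky]; exact r1.symm) s2 h.rot
  · exact c.triV hz hx hs hr nxz.symm (by rw [kz, kx]) (by rw [kz]; exact s1.symm) (by rw [kz]; exact r1.symm) s2 h.rot

lemma CA.source (c : CA φ V h) {κ : ℕ} {a : Pt} (ha : a ∈ V) (ka : φ a = κ) :
    ∃ p ∈ V, φ p = κ ∧ ∀ k ∈ V, φ k = κ → k ≠ p → Lft φ V κ p k := by
  classical
  let out : Pt → Finset Pt := fun p => V.filter (fun k => φ k = κ ∧ Lft φ V κ p k)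
  obtain ⟨p, hp, hmax⟩ := Finset.exists_max_image (V.filter (fun k => φ k = κ)) (fun p => (out p).card)
    ⟨a, mem_filter.2 ⟨ha, ka⟩⟩
  obtain ⟨hpV, kp⟩ := mem_filter.1 hp
  refine ⟨p, hpV, kp, ?_⟩
  intro k hk kk hne
  refine (c.total hpV hk hne.symm kp kk).resolve_right fun hkp => ?_
  have hle := hmax k (mem_filter.2 ⟨hk, kk⟩)
  have : out p ⊂ out k := by
    rw [Finset.ssubset_iff_of_subset]
    · refine ⟨p, mem_filter.2 ⟨hpV, kp, hkp⟩, ?_⟩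
      intro hpp
      have := (mem_filter.1 hpp).2.2
      exact c.asym this this
    · intro j hj
      obtain ⟨hjV, kj, hpj⟩ := mem_filter.1 hj
      refine mem_filter.2 ⟨hjV, kj, ?_⟩
      have hjk : j ≠ k := by rintro rfl; exact c.asym hpj hkp
      refine (c.total hk hjV hjk.symm kk kj).resolve_right fun hjk2 => ?_
      exact c.acyc hpV hjV hk kp kj kk hpj hjk2 hkp
  have := Finset.card_lt_card this
  omega

lemma CA.finish (c : CA φ V h) {κ : ℕ} {p q z u v : Pt} (hp : p ∈ V) (hq : q ∈ V) (hz : z ∈ V)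
    (hu : u ∈ V) (hv : v ∈ V) (kp : φ p = κ) (kq : φ q = κ) (hpq : q ≠ p)
    (hsrc : ∀ k ∈ V, φ k = κ → k ≠ p → Lft φ V κ p k)
    (hzk : φ z ≠ κ) (hup : u ≠ p) (hvp : v ≠ p) (hvz : v ≠ z) (huv : φ u ≠ φ v)
    (hfu : 0 < sideSign p z u) (hfv : sideSign p z v < 0)
    (hdis : segment ℝ u v ∩ segment ℝ p z = ∅) : False := by
  have huz : u ≠ z := by rintro rfl; rw [ss_self2] at hfu; exact lt_irrefl _ hfu
  have huv' : u ≠ v := by rintro rfl; exact huv rfl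
  have hzp : z ≠ p := by rintro rfl; exact hzk kp
  have huk : φ u ≠ κ := by
    intro hk
    have := hsrc u hu hk hup z hz hzk
    rw [ss_swap'] at this
    linarith
  rcases quad (u := p) (w := z) (v := u) (x := v) (by nlinarith)
    (c.gp u hu v hv p hp huv' hup hvp) (c.gp u hu v hv z hz huv' huz hvz) with ⟨w, w1, w2⟩ | hI | hI
  · have : w ∈ segment ℝ u v ∩ segment ℝ p z :=
      ⟨openSegment_subset_segment ℝ _ _ w1, openSegment_subset_segment ℝ _ _ w2⟩
    rw [hdis] at this
    exact this
  · obtain ⟨l, m, n, hl, hm, hn, hs, he⟩ := hI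
    have key : ∀ k ∈ V, φ k = κ → k ≠ p → 0 ≤ sideSign p k v → False := by
      intro k hk kk hkp hkv
      have e := ss_comb3 p k u z v l m n hs
      rw [← he, ss_self1] at e
      have a1 := hsrc k hk kk hkp u hu huk
      have a2 := hsrc k hk kk hkp z hz hzk
      nlinarith [mul_pos hl a1, mul_pos hm a2, mul_nonneg hn.le hkv]
    by_cases hvk : φ v = κ
    · exact key v hv hvk hvp (by rw [ss_self2])
    · exact key q hq kq hpq (hsrc q hq kq hpq v hv hvk).le
  · -- z in tri u p v
    by_cases zu : φ z = φ u
    · by_cases pv : φ v = κ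
      · obtain ⟨s, hs, s1, s2⟩ := c.third κ (φ z)
        have hsz : z ≠ s := by rintro rfl; exact s2 rfl
        have hsu : s ≠ u := by rintro rfl; exact s2 zu.symm
        have hsp : s ≠ p := by rintro rfl; exact s1 kp
        have hsv : s ≠ v := by rintro rfl; exact s1 pv
        rcases subdiv hI (c.gp z hz s hs u hu hsz huz.symm hsu) (c.gp z hz s hs p hp hsz hzp hsp)
          (c.gp z hz s hs v hv hsz hvz.symm hsv) (c.gp u hu p hp v hv hup huv' hvp.symm) with h | h | h
        · -- s u p
          exact c.triB hu hp hs hz huz zu.symm (by rw [kp]; exact huk) (by rw [← zu]; exact s2.symm)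
            (by rw [kp]; exact s1.symm) h.rot
        · -- s p v
          exact c.triV hp hv hs hz hvp.symm (by rw [kp, pv]) (by rw [kp]; exact s1.symm)
            (by rw [kp]; exact hzk.symm) s2 h.rot
        · -- s v u
          exact c.triB hu hs hv hz huz zu.symm (by rw [← zu]; exact s2.symm) huv
            (by rw [pv]; exact s1) h.rot.rot
      · exact c.triB hu hp hv hz huz zu.symm (by rw [kp]; exact huk) huv
          (by rw [kp]; exact fun h => pv h.symm) hI
    · by_cases zv : φ z = φ v
      · exact c.triB hv hu hp hz hvz zv.symm huv.symm (by rw [kp, ← zv]; exact hzk)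
          (by rw [kp]; exact huk) hI.rot.rot
      · by_cases pv : φ v = κ
        · exact c.triV hp hv hu hz hvp.symm (by rw [kp, pv]) (by rw [kp]; exact huk.symm)
            (by rw [kp]; exact hzk.symm) (fun h => zu h.symm) hI.rot
        · exact c.tri5 hp hv hu hz hq hpq.symm (by rw [kp, kq]) (by rw [kp]; exact fun h => pv h.symm)
            (by rw [kp]; exact huk.symm) huv.symm (by rw [kp]; exact hzk) zv zu hI.rot

lemma CA.walk (c : CA φ V h) {κ : ℕ} {t : ℕ} {γ : ZMod t → Pt} (hcyc : IsPlaneCycle φ t γ)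
    (hV : ∀ i, γ i ∈ V) {i j : ZMod t} (kp : φ (γ i) = κ)
    (kq : φ (γ j) = κ) (hij : j ≠ i)
    (hsrc : ∀ k ∈ V, φ k = κ → k ≠ γ i → Lft φ V κ (γ i) k)
    (hy : 0 < sideSign (γ i) (γ (i + 1)) (γ (i - 1))) : False := by
  have ht := hcyc.1
  have : NeZero t := ⟨by omega⟩
  have hzk : φ (γ (i + 1)) ≠ κ := by rw [← kp]; exact (hcyc.2.2.1 i).symm
  have hq0 : sideSign (γ i) (γ (i + 1)) (γ j) < 0 := by
    have := hsrc (γ j) (hV j) kq (fun h => hij (hcyc.2.1 h)) _ (hV (i + 1)) hzk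
    rw [ss_swap'] at this
    linarith
  -- walk backwards
  have hex : ∃ n : ℕ, sideSign (γ i) (γ (i + 1)) (γ (i - 1 - n)) ≤ 0 := by
    refine ⟨(i - 1 - j).val, ?_⟩
    rw [ZMod.natCast_zmod_val]
    rw [show i - 1 - (i - 1 - j) = j by ring]
    exact hq0.le
  classical
  obtain ⟨n, hn⟩ : ∃ n, n = Nat.find hex := ⟨_, rfl⟩
  have hn1 := Nat.find_spec hex
  have hn2 : ∀ m < n, 0 < sideSign (γ i) (γ (i + 1)) (γ (i - 1 - (m : ZMod t))) := by
    intro m hm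
    rw [hn] at hm
    exact not_le.1 (Nat.find_min hex hm)
  rw [← hn] at hn1
  have hn0 : n ≠ 0 := by
    rintro rfl
    simp at hn1; linarith
  obtain ⟨m, rfl⟩ : ∃ m, n = m + 1 := ⟨n - 1, by omega⟩
  -- every earlier vertex is different from i, i+1
  have hjv : m + 1 ≤ (i - 1 - j).val := by
    rw [hn]
    apply Nat.find_min'
    rw [ZMod.natCast_zmod_val, show i - 1 - (i - 1 - j) = j by ring]
    exact hq0.le
  have hvlt := ZMod.val_lt (i - 1 - j)
  have hj1 : j ≠ i + 1 := by rintro rfl; rw [ss_self2] at hq0; exact lt_irrefl _ hq0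
  have hb : (i - 1 - j).val + 2 < t := by
    by_contra hc
    have h6 : (i - 1 - j).val + 2 = t ∨ (i - 1 - j).val + 1 = t := by omega
    have hcast : (((i - 1 - j).val : ℕ) : ZMod t) = i - 1 - j := ZMod.natCast_zmod_val _
    rcases h6 with h6 | h6
    · have : (((i - 1 - j).val + 2 : ℕ) : ZMod t) = 0 := by rw [h6]; simp
      push_cast at this
      rw [hcast] at this
      exact hj1 (by linear_combination -this)
    · have : (((i - 1 - j).val + 1 : ℕ) : ZMod t) = 0 := by rw [h6]; simp
      push_cast at this
      rw [hcast] at this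
      exact hij (by linear_combination -this)
  have nz : ∀ k : ℕ, 0 < k → k < t → (k : ZMod t) ≠ 0 := fun k h0 h1 => zne k h0 h1
  have u1 := nz (m + 1) (by omega) (by omega)
  have u2 := nz (m + 2) (by omega) (by omega)
  have u3 := nz (m + 3) (by omega) (by omega)
  have z1 := nz 1 (by omega) (by omega)
  have z2 := nz 2 (by omega) (by omega)
  push_cast at u1 u2 u3 z1 z2 hn1
  obtain ⟨k, hk⟩ : ∃ k : ZMod t, k = i - 1 - (m + 1) := ⟨_, rfl⟩
  have hk1 : k + 1 = i - 1 - m := by rw [hk]; ring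
  have inj : ∀ a b : ZMod t, a ≠ b → γ a ≠ γ b := fun a b h h' => h (hcyc.2.1 h')
  have ki : k ≠ i := by intro h; apply u2; linear_combination hk - h
  have ki1 : k ≠ i + 1 := by intro h; apply u3; linear_combination hk - h
  have k1i : k + 1 ≠ i := by intro h; apply u1; linear_combination hk - h
  have fu := hn2 m (by omega)
  rw [← hk1] at fu
  rw [← hk] at hn1
  have fv : sideSign (γ i) (γ (i + 1)) (γ k) < 0 := by
    refine lt_of_le_of_ne hn1 (c.gp _ (hV _) _ (hV _) _ (hV _) ?_ ?_ ?_)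
    · exact inj _ _ (by intro h; apply z1; linear_combination -h)
    · exact inj _ _ ki.symm
    · exact inj _ _ ki1.symm
  refine c.finish (hV i) (hV j) (hV (i + 1)) (hV (k + 1)) (hV k) kp kq (inj _ _ hij) hsrc hzk
    (inj _ _ k1i) (inj _ _ ki) (inj _ _ ki1) (hcyc.2.2.1 k).symm fu fv ?_
  rw [segment_symm]
  exact (hcyc.2.2.2 k i ki).2 (fun h => k1i h.symm) ki1

lemma cyc_rev {t : ℕ} {γ : ZMod t → Pt} (hc : IsPlaneCycle φ t γ) :
    IsPlaneCycle φ t (fun i => γ (-i)) := by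
  have key : ∀ i : ZMod t, segment ℝ (γ (-i)) (γ (-(i + 1))) = Ed γ (-i - 1) := by
    intro i
    unfold Ed
    rw [segment_symm]
    congr 2 <;> ring_nf
  refine ⟨hc.1, ?_, ?_, ?_⟩
  · intro i j h
    exact neg_injective (hc.2.1 h)
  · intro i
    have := hc.2.2.1 (-(i + 1))
    rw [show -(i + 1) + 1 = -i by ring] at this
    exact this.symm
  · intro i j hij
    simp only [key]
    constructor
    · intro h
      have := (hc.2.2.2 (-j - 1) (-i - 1) (by intro h2; apply hij; linear_combination h2)).1
        (by rw [h]; ring)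
      rw [show -(i + 1) = -j - 1 + 1 by rw [h]; ring]
      rw [Set.inter_comm]
      exact this
    · intro h1 h2
      exact (hc.2.2.2 (-i - 1) (-j - 1) (by intro h2; apply hij; linear_combination -h2)).2
        (by intro h; apply h2; linear_combination h) (by intro h; apply h1; linear_combination h)

theorem CA.false (c : CA φ V h) {t : ℕ} {γ : ZMod t → Pt} (hcyc : IsPlaneCycle φ t γ)
    (hV : ∀ x, x ∈ V ↔ ∃ i, γ i = x) (hnr : NonRainbow φ t γ) : False := by
  obtain ⟨a, b, hab, he⟩ := hnr
  have hV' : ∀ i, γ i ∈ V := fun i => (hV _).2 ⟨i, rfl⟩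
  obtain ⟨p, hp, kp, hsrc⟩ := c.source (hV' a) rfl
  obtain ⟨i, rfl⟩ := (hV p).1 hp
  have hj : ∃ j, j ≠ i ∧ φ (γ j) = φ (γ a) := by
    by_cases h : a = i
    · exact ⟨b, by rw [← h]; exact hab.symm, he.symm⟩
    · exact ⟨a, h, rfl⟩
  obtain ⟨j, hji, kj⟩ := hj
  have ht := hcyc.1
  have z1 := zne (t := t) 1 (by omega) (by omega)
  have z2 := zne (t := t) 2 (by omega) (by omega)
  push_cast at z1 z2
  have inj : ∀ a b : ZMod t, a ≠ b → γ a ≠ γ b := fun a b h h' => h (hcyc.2.1 h')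
  have n : sideSign (γ i) (γ (i + 1)) (γ (i - 1)) ≠ 0 := by
    refine c.gp _ (hV' _) _ (hV' _) _ (hV' _) (inj _ _ ?_) (inj _ _ ?_) (inj _ _ ?_)
    · intro h; apply z1; linear_combination -h
    · intro h; apply z1; linear_combination h
    · intro h; apply z2; linear_combination h
  rcases lt_or_gt_of_ne n with h1 | h1
  · refine c.walk (κ := φ (γ a)) (cyc_rev hcyc) (fun i => hV' _) (i := -i) (j := -j)
      (by simpa using kp) (by simpa using kj) (by simpa using hji) (by simpa using hsrc) ?_
    rw [ss_swap']
    simp only [neg_neg]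
    rw [show -(-i - 1) = i + 1 by ring, show -(-i + 1) = i - 1 by ring]
    linarith
  · exact c.walk hcyc hV' kp kj hji hsrc h1

end CaseA2

/-- if a geometric complete multipartite graph contains a non-rainbow plane
cycle of length `t ≥ 6`, then it contains a non-rainbow plane cycle of some length `t'` with
`⌈t/2⌉ + 1 ≤ t' ≤ t - 1`. -/
theorem stmt_6 (P : Set Pt) (φ : Pt → ℕ) (hfin : P.Finite) (hgp : GenPos P)
    (t : ℕ) (ht : 6 ≤ t) (γ : ZMod t → Pt)
    (hcyc : IsPlaneCycle φ t γ) (hmem : ∀ i, γ i ∈ P) (hnr : NonRainbow φ t γ) :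
    ∃ t' : ℕ, (t + 1) / 2 + 1 ≤ t' ∧ t' ≤ t - 1 ∧
      ∃ γ' : ZMod t' → Pt, IsPlaneCycle φ t' γ' ∧ (∀ i, γ' i ∈ P) ∧ NonRainbow φ t' γ' := by
  classical
  by_contra hno
  have hne : NeZero t := ⟨by omega⟩
  have hV : ∀ x, x ∈ (Finset.univ.image γ) ↔ ∃ i, γ i = x := by
    intro x; simp
  by_cases hc : (t + 1) / 2 + 1 ≤ ((Finset.univ.image γ).image φ).card
  · have c : CA φ (Finset.univ.image γ) ((t + 1) / 2 + 1) := by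
      refine ⟨?_, by omega, hc, ?_⟩
      · intro a ha b hb d hd hab had hbd
        obtain ⟨i, rfl⟩ := (hV a).1 ha
        obtain ⟨j, rfl⟩ := (hV b).1 hb
        obtain ⟨k, rfl⟩ := (hV d).1 hd
        exact ss_ne_zero hgp (hmem i) (hmem j) (hmem k) hab had hbd
      · rintro ⟨γ', h1, h2, h3⟩
        refine hno ⟨_, by omega, by omega, γ', h1, ?_, h3⟩
        intro i
        obtain ⟨j, hj⟩ := (hV _).1 (h2 i)
        rw [← hj]; exact hmem j
    exact c.false hcyc hV hnr
  · have c : Ctx t φ γ := by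
      refine ⟨ht, hcyc, ?_, ?_⟩
      · intro i j k hij hik hjk
        exact ss_ne_zero hgp (hmem i) (hmem j) (hmem k)
          (hcyc.2.1.ne hij) (hcyc.2.1.ne hik) (hcyc.2.1.ne hjk)
      · intro n hn1 hn2 γ' hr hp
        have hnn : NeZero n := ⟨by omega⟩
        refine hno ⟨n, hn1, hn2, γ', hp, ?_, ?_⟩
        · intro i
          obtain ⟨j, hj⟩ := hr i
          rw [← hj]; exact hmem j
        · by_contra hnr'
          have hinj : Function.Injective (fun i => φ (γ' i)) := by
            intro i j hij
            by_contra hne'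
            exact hnr' ⟨i, j, hne', hij⟩
          have h1 : (Finset.univ.image (fun i => φ (γ' i))).card = n := by
            rw [Finset.card_image_of_injective _ hinj, Finset.card_univ, ZMod.card]
          have h2 : (Finset.univ.image (fun i => φ (γ' i))) ⊆
              (Finset.univ.image γ).image φ := by
            intro x hx
            obtain ⟨i, -, rfl⟩ := Finset.mem_image.1 hx
            obtain ⟨j, hj⟩ := hr i
            exact Finset.mem_image_of_mem _ ((hV _).2 ⟨j, hj⟩)
          have h3 := Finset.card_le_card h2
          omega
    exact c.false
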